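/- arXiv:1412.4405 — 6 statements merged into one kernel-verified Lean document; each statement's English description precedes it below -/
import Mathlib

section
/- Let d and k be natural numbers with k ≥ 2. Suppose that for every r ∈ ℕ there exists a finite set V of points in Euclidean space ℝ^d that contains the complete k-partite graph K_k(r) in its double-normal graph. Then k + D(k) ≤ d, where D(k) is the smallest dimension n such that ℝ^n contains k distinct points forming only non-obtuse angles. -/
open scoped RealInnerProductSpace

abbrev Euc (d : ℕ) := EuclideanSpace ℝ (Fin d)

/-- `p, q` form a double-normal pair of the finite point set `V`. -/
def IsDoubleNormalPair {d : ℕ} (V : Finset (Euc d)) (p q : Euc d) : Prop :=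
  p ≠ q ∧ p ∈ V ∧ q ∈ V ∧
    ∀ x ∈ V, 0 ≤ ⟪x - p, q - p⟫ ∧ 0 ≤ ⟪x - q, p - q⟫

/-- `p, q` form a strict double-normal pair of the finite point set `V`. -/
def IsStrictDoubleNormalPair {d : ℕ} (V : Finset (Euc d)) (p q : Euc d) : Prop :=
  p ≠ q ∧ p ∈ V ∧ q ∈ V ∧
    ∀ x ∈ V, x ≠ p → x ≠ q → 0 < ⟪x - p, q - p⟫ ∧ 0 < ⟪x - q, p - q⟫

/-- Some finite set in `ℝ^d` contains the complete `k`-partite graph `K_k(r)`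
in its double-normal graph. -/
def ContainsDNMultipartite (d k r : ℕ) : Prop :=
  ∃ (V : Finset (Euc d)) (P : Fin k → Finset (Euc d)),
    (∀ i, P i ⊆ V) ∧ (∀ i, (P i).card = r) ∧
    (∀ i j, i ≠ j → Disjoint (P i) (P j)) ∧
    (∀ i j, i ≠ j → ∀ p ∈ P i, ∀ q ∈ P j, IsDoubleNormalPair V p q)

/-- Some finite set in `ℝ^d` contains the complete `k`-partite graph `K_k(r)`
in its strict double-normal graph. -/
def ContainsStrictDNMultipartite (d k r : ℕ) : Prop :=
  ∃ (V : Finset (Euc d)) (P : Fin k → Finset (Euc d)),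
    (∀ i, P i ⊆ V) ∧ (∀ i, (P i).card = r) ∧
    (∀ i j, i ≠ j → Disjoint (P i) (P j)) ∧
    (∀ i j, i ≠ j → ∀ p ∈ P i, ∀ q ∈ P j, IsStrictDoubleNormalPair V p q)

/-- `k` distinct points forming only non-obtuse angles. -/
def NonObtuseSet {n : ℕ} (P : Finset (Euc n)) : Prop :=
  ∀ x ∈ P, ∀ y ∈ P, ∀ z ∈ P, x ≠ y → z ≠ y → x ≠ z → 0 ≤ ⟪x - y, z - y⟫

/-- `D k`: the smallest dimension `n` such that `ℝ^n` contains `k` distinct points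
forming only non-obtuse angles. -/
noncomputable def minNonObtuseDim (k : ℕ) : ℕ :=
  sInf {n : ℕ | ∃ P : Finset (Euc n), P.card = k ∧ NonObtuseSet P}

section Auxiliary

variable {ι E : Type*} [NormedAddCommGroup E] [InnerProductSpace ℝ E]

lemma linearIndependent_of_det_inner_ne_zero [Fintype ι] [DecidableEq ι] (e f : ι → E)
    (h : (Matrix.of fun m l => ⟪e m, f l⟫).det ≠ 0) : LinearIndependent ℝ e := by
  rw [Fintype.linearIndependent_iff]
  intro g hg
  have hv : Matrix.vecMul g (Matrix.of fun m l => ⟪e m, f l⟫) = 0 := by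
    ext l
    have := congrArg (fun z => ⟪z, f l⟫) hg
    simpa [Matrix.vecMul, dotProduct, sum_inner, inner_smul_left] using this
  exact fun i => congrFun (Matrix.eq_zero_of_vecMul_eq_zero h hv) i

/-- A large finite set has many pairs of points at rapidly decreasing distances. -/
lemma exists_multiscale_pairs [FiniteDimensional ℝ E] {η : ℝ} (hη : 0 < η) (m : ℕ) :
    ∃ R : ℕ, ∀ S : Finset E, R ≤ S.card → ∃ p q : Fin m → E,
      (∀ a, p a ∈ S ∧ q a ∈ S ∧ p a ≠ q a) ∧
      ∀ a b, a < b → dist (p b) (q b) ≤ η * dist (p a) (q a) := by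
  induction m with
  | zero => exact ⟨0, fun S _ => ⟨Fin.elim0, Fin.elim0, fun a => a.elim0, fun a => a.elim0⟩⟩
  | succ m ih =>
    classical
    obtain ⟨R, hR⟩ := ih
    obtain ⟨t, htf, ht⟩ :=
      Metric.totallyBounded_iff.1 (isCompact_closedBall (0 : E) 1).totallyBounded (η / 2)
        (half_pos hη)
    refine ⟨htf.toFinset.card * R + 2, fun S hS => ?_⟩
    obtain ⟨a, ha, b, hb, hab⟩ := Finset.one_lt_card.1 (show 1 < S.card by omega)
    obtain ⟨⟨p, q⟩, hpq, hmax⟩ := Finset.exists_max_image (S ×ˢ S) (fun z => dist z.1 z.2)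
      ⟨(a, b), Finset.mem_product.2 ⟨ha, hb⟩⟩
    obtain ⟨hp, hq⟩ := Finset.mem_product.1 hpq
    have hD : 0 < dist p q :=
      (dist_pos.2 hab).trans_le (hmax (a, b) (Finset.mem_product.2 ⟨ha, hb⟩))
    have hcov : ∀ x ∈ S, ∃ y ∈ htf.toFinset, dist ((dist p q)⁻¹ • (x - p)) y < η / 2 := by
      intro x hx
      have : (dist p q)⁻¹ • (x - p) ∈ Metric.closedBall (0 : E) 1 := by
        rw [mem_closedBall_zero_iff, norm_smul, norm_inv, Real.norm_of_nonneg hD.le,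
          inv_mul_le_iff₀ hD, mul_one, ← dist_eq_norm]
        exact hmax (x, p) (Finset.mem_product.2 ⟨hx, hp⟩)
      simpa using ht this
    choose! c hct hc using hcov
    obtain ⟨y, -, hy⟩ := Finset.exists_le_card_fiber_of_mul_le_card_of_maps_to (n := R) hct
      ⟨_, hct a ha⟩ (by omega)
    obtain ⟨p', q', hS', hd'⟩ := hR _ hy
    simp only [Finset.mem_filter] at hS'
    refine ⟨Fin.cons p p', Fin.cons q q', ?_, ?_⟩
    · refine Fin.cases ⟨hp, hq, dist_pos.1 hD⟩ fun i => ?_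
      exact ⟨(hS' i).1.1, (hS' i).2.1.1, (hS' i).2.2⟩
    · refine Fin.cases (Fin.cases (fun h => absurd h (lt_irrefl _)) fun j _ => ?_)
        fun i => Fin.cases (fun h => absurd h (Fin.not_lt_zero _)) fun j hij => ?_
      · simp only [Fin.cons_zero, Fin.cons_succ]
        obtain ⟨⟨hpj, hpy⟩, ⟨hqj, hqy⟩, -⟩ := hS' j
        have h1 := hc _ hpj
        have h2 := hc _ hqj
        rw [hpy] at h1
        rw [hqy] at h2
        have h3 := (dist_triangle_right ((dist p q)⁻¹ • (p' j - p))
          ((dist p q)⁻¹ • (q' j - p)) y).trans_lt (add_lt_add h1 h2)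
        rw [dist_smul₀, dist_sub_right, norm_inv, Real.norm_of_nonneg hD.le, add_halves,
          inv_mul_lt_iff₀ hD] at h3
        linarith
      · simpa using hd' i j (Fin.succ_lt_succ_iff.1 hij)

/-- A large finite set has two pairs of points, the second much closer together than the first,
spanning directions which are far from orthogonal. -/
lemma exists_short_long_pairs [FiniteDimensional ℝ E] {ε : ℝ} (hε : 0 < ε) :
    ∃ R : ℕ, ∀ S : Finset E, R ≤ S.card → ∃ x ∈ S, ∃ x' ∈ S, ∃ y ∈ S, ∃ y' ∈ S, y ≠ y' ∧
      ‖y' - y‖ ^ 2 ≤ ε * ⟪x' - x, y' - y⟫ := by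
  set n := Module.finrank ℝ E
  have hη : 0 < ε / (n + 1) := by positivity
  obtain ⟨R, hR⟩ := exists_multiscale_pairs (E := E) hη (n + 1)
  refine ⟨R, fun S hS => ?_⟩
  obtain ⟨p, q, hS, hd⟩ := hR S hS
  by_contra! hcon
  have hpos : ∀ a, 0 < ‖q a - p a‖ := fun a => norm_pos_iff.2 (sub_ne_zero.2 (hS a).2.2.symm)
  set g : Fin (n + 1) → E := fun a => ‖q a - p a‖⁻¹ • (q a - p a) with hg
  have hself : ∀ a, ⟪g a, g a⟫ = 1 := fun a => by
    rw [real_inner_self_eq_norm_sq, hg]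
    simp only [norm_smul, norm_inv, norm_norm, inv_mul_cancel₀ (hpos a).ne', one_pow]
  have hlt : ∀ a b, a < b → |⟪g a, g b⟫| < 1 / (n + 1) := by
    intro a b hab
    have h1 := hcon _ (hS a).1 _ (hS a).2.1 _ (hS b).1 _ (hS b).2.1 (hS b).2.2
    have h2 := hcon _ (hS a).2.1 _ (hS a).1 _ (hS b).1 _ (hS b).2.1 (hS b).2.2
    rw [← neg_sub, inner_neg_left] at h2
    have h3 : ‖q b - p b‖ ≤ ε / (n + 1) * ‖q a - p a‖ := by
      simpa [dist_eq_norm, norm_sub_rev] using hd a b hab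
    have h4 : ε * |⟪q a - p a, q b - p b⟫| < ‖q b - p b‖ ^ 2 := by
      rcases abs_cases ⟪q a - p a, q b - p b⟫ with h | h <;> rw [h.1] <;> linarith
    have h5 : ‖q b - p b‖ ^ 2 ≤ ε * (1 / (n + 1) * (‖q a - p a‖ * ‖q b - p b‖)) := by
      calc ‖q b - p b‖ ^ 2 = ‖q b - p b‖ * ‖q b - p b‖ := sq _
        _ ≤ (ε / (n + 1) * ‖q a - p a‖) * ‖q b - p b‖ := by gcongr
        _ = _ := by ring
    have h6 := lt_of_mul_lt_mul_left (h4.trans_le h5) hε.le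
    simp only [hg, inner_smul_left, inner_smul_right, abs_mul, map_inv₀, abs_inv,
      abs_norm, RCLike.conj_to_real]
    rw [← mul_assoc, ← mul_inv, inv_mul_lt_iff₀ (mul_pos (hpos b) (hpos a))]
    linarith
  have hne : ∀ a b, a ≠ b → |⟪g a, g b⟫| < 1 / (n + 1) := fun a b hab => by
    rcases lt_or_gt_of_ne hab with h | h
    · exact hlt a b h
    · rw [real_inner_comm]; exact hlt b a h
  have hdet : (Matrix.of fun a b => ⟪g a, g b⟫).det ≠ 0 := by
    refine det_ne_zero_of_sum_row_lt_diag fun a => ?_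
    simp only [Matrix.of_apply, hself, norm_one, Real.norm_eq_abs]
    calc ∑ b ∈ Finset.univ.erase a, |⟪g a, g b⟫|
        ≤ ∑ b ∈ Finset.univ.erase a, 1 / ((n : ℝ) + 1) :=
          Finset.sum_le_sum fun b hb => (hne a b (Finset.ne_of_mem_erase hb).symm).le
      _ = n / (n + 1) := by simp [Finset.card_erase_of_mem, div_eq_mul_inv]
      _ < 1 := by rw [div_lt_one (by positivity)]; linarith
  have := (linearIndependent_of_det_inner_ne_zero g g hdet).fintype_card_le_finrank
  rw [Fintype.card_fin] at this
  omega

open MeasureTheory Pointwise in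
/-- A stable form of the Danzer–Grünbaum bound on the size of antipodal sets. -/
lemma card_le_of_almost_antipodal [FiniteDimensional ℝ E] [Fintype ι] [Nonempty ι] (P : ι → E)
    (v : ι → ι → E) {η : ℝ} (hη : 0 < η)
    (hgap : ∀ i j, i ≠ j → 1 / 2 ≤ ⟪v i j, P i - P j⟫)
    (hlow : ∀ i j, i ≠ j → ∀ l, -η ≤ ⟪v i j, P l - P j⟫)
    (hupp : ∀ i j, i ≠ j → ∀ l, ⟪v i j, P l - P i⟫ ≤ η) :
    (Fintype.card ι : ℝ) ≤ (2 + 8 * η) ^ Module.finrank ℝ E := by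
  borelize E
  set B : ℝ := 1 + ∑ i, ∑ j, ‖v i j‖
  have hvB : ∀ i j, ‖v i j‖ ≤ B := fun i j => by
    have h1 : ‖v i j‖ ≤ ∑ j, ‖v i j‖ :=
      Finset.single_le_sum (f := fun j => ‖v i j‖) (fun _ _ => norm_nonneg _) (Finset.mem_univ j)
    have h2 : ∑ j, ‖v i j‖ ≤ ∑ i, ∑ j, ‖v i j‖ :=
      Finset.single_le_sum (f := fun i => ∑ j, ‖v i j‖)
        (fun _ _ => Finset.sum_nonneg fun _ _ => norm_nonneg _) (Finset.mem_univ i)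
    linarith
  have hBpos : 0 < B := by positivity
  set H := convexHull ℝ (Set.range P)
  set C := Metric.thickening (η / B) H
  have hρ : 0 < η / B := by positivity
  have hCconv : Convex ℝ C := (convex_convexHull ℝ _).thickening _
  have hPC : ∀ i, P i ∈ C := fun i =>
    Metric.self_subset_thickening hρ _ (subset_convexHull ℝ _ ⟨i, rfl⟩)
  have hbdd : Bornology.IsBounded C :=
    (((Set.finite_range P).isCompact_convexHull (𝕜 := ℝ)).isBounded).thickening
  have hopen : IsOpen C := Metric.isOpen_thickening
  -- the slab containing `C` in the direction `v i j`
  have hslab : ∀ i j, i ≠ j → ∀ c ∈ C,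
      ⟪v i j, P j⟫ - 2 * η < ⟪v i j, c⟫ ∧ ⟪v i j, c⟫ < ⟪v i j, P i⟫ + 2 * η := by
    intro i j hij c hc
    obtain ⟨h, hh, hch⟩ := Metric.mem_thickening_iff.1 hc
    have hsub : H ⊆ {x | ⟪v i j, P j⟫ - η ≤ ⟪v i j, x⟫} ∩ {x | ⟪v i j, x⟫ ≤ ⟪v i j, P i⟫ + η} := by
      refine convexHull_min ?_ ((convex_halfSpace_ge (innerₛₗ ℝ (v i j)).isLinear _).inter
        (convex_halfSpace_le (innerₛₗ ℝ (v i j)).isLinear _))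
      rintro _ ⟨l, rfl⟩
      have h1 := hlow i j hij l
      have h2 := hupp i j hij l
      rw [inner_sub_right] at h1 h2
      exact ⟨by simp only [Set.mem_ofPred_eq]; linarith, by simp only [Set.mem_ofPred_eq]; linarith⟩
    obtain ⟨h1, h2⟩ := hsub hh
    simp only [Set.mem_ofPred_eq] at h1 h2
    have h3 : |⟪v i j, c - h⟫| < η := by
      refine (abs_real_inner_le_norm _ _).trans_lt ?_
      rw [← dist_eq_norm]
      calc ‖v i j‖ * dist c h ≤ B * dist c h := by gcongr; exact hvB i j
        _ < B * (η / B) := by gcongr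
        _ = η := mul_div_cancel₀ _ hBpos.ne'
    rw [inner_sub_right, abs_lt] at h3
    constructor <;> linarith [h3.1, h3.2]
  set s : ℝ := 1 + 8 * η with hs
  have hspos : 0 < s := by positivity
  have hdisj : Pairwise (Function.onFun Disjoint fun i => (s • P i) +ᵥ C) := by
    intro i j hij
    refine Set.disjoint_left.2 ?_
    rintro _ ⟨c, hc, rfl⟩ ⟨c', hc', heq⟩
    have h1 := (hslab i j hij c hc).1
    have h2 := (hslab i j hij c' hc').2
    have h3 := hgap i j hij
    have h4 : ⟪v i j, s • P j + c'⟫ = ⟪v i j, s • P i + c⟫ := congrArg _ heq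
    simp only [inner_add_right, inner_smul_right, inner_sub_right] at h3 h4
    nlinarith
  have hsubset : (⋃ i, (s • P i) +ᵥ C) ⊆ (1 + s) • C := by
    refine Set.iUnion_subset fun i => ?_
    rintro _ ⟨c, hc, rfl⟩
    refine ⟨(1 + s)⁻¹ • c + (s / (1 + s)) • P i, ?_, ?_⟩
    · exact hCconv hc (hPC i) (by positivity) (by positivity) (by field_simp)
    · simp only [smul_add, smul_smul, vadd_eq_add]
      rw [mul_inv_cancel₀ (by positivity), mul_div_cancel₀ _ (by positivity), one_smul, add_comm]
  have hmeas := measure_mono (μ := (volume : Measure E)) hsubset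
  rw [measure_iUnion hdisj fun i => (hopen.vadd _).measurableSet,
    Measure.addHaar_smul, abs_of_pos (by positivity)] at hmeas
  simp only [measure_vadd, tsum_fintype, Finset.sum_const, Finset.card_univ, nsmul_eq_mul] at hmeas
  have hC0 : (volume : Measure E) C ≠ 0 :=
    (hopen.measure_pos _ ⟨_, hPC (Classical.arbitrary ι)⟩).ne'
  have hCtop : (volume : Measure E) C ≠ ⊤ := hbdd.measure_lt_top.ne
  rw [ENNReal.mul_le_mul_iff_left hC0 hCtop] at hmeas
  have := ENNReal.toReal_mono ENNReal.ofReal_ne_top hmeas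
  rw [ENNReal.toReal_ofReal (by positivity), ENNReal.toReal_natCast] at this
  convert this using 2
  rw [hs]; ring

end Auxiliary

/-- Subsets of the vertices of the cube form only non-obtuse angles. -/
lemma minNonObtuseDim_le {n k : ℕ} (h : k ≤ 2 ^ n) : minNonObtuseDim k ≤ n := by
  classical
  set φ : Finset (Fin n) → Euc n := fun s => WithLp.toLp 2 fun i => if i ∈ s then 1 else 0 with hφ
  have hinj : Function.Injective φ := by
    intro s t hst
    ext i
    have : φ s i = φ t i := by rw [hst]
    by_cases h1 : i ∈ s <;> by_cases h2 : i ∈ t <;> simp [hφ, h1, h2] at this ⊢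
  obtain ⟨T, -, hT⟩ := Finset.exists_subset_card_eq
    (s := (Finset.univ : Finset (Finset (Fin n)))) (n := k) (by simpa using h)
  refine Nat.sInf_le ⟨T.image φ, by rw [Finset.card_image_of_injective _ hinj, hT], ?_⟩
  intro x hx y hy z hz _ _ _
  obtain ⟨a, -, rfl⟩ := Finset.mem_image.1 hx
  obtain ⟨b, -, rfl⟩ := Finset.mem_image.1 hy
  obtain ⟨c, -, rfl⟩ := Finset.mem_image.1 hz
  rw [PiLp.inner_apply]
  refine Finset.sum_nonneg fun i _ => ?_
  by_cases h1 : i ∈ a <;> by_cases h2 : i ∈ b <;> by_cases h3 : i ∈ c <;> simp [hφ, h1, h2, h3]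

lemma IsDoubleNormalPair.inner_mem_Icc {d : ℕ} {V : Finset (Euc d)} {p q x : Euc d}
    (h : IsDoubleNormalPair V p q) (hx : x ∈ V) :
    ⟪x - q, p - q⟫ ∈ Set.Icc 0 (‖p - q‖ ^ 2) := by
  obtain ⟨-, -, -, h⟩ := h
  refine ⟨(h x hx).2, ?_⟩
  have h1 := (h x hx).1
  rw [← real_inner_self_eq_norm_sq]
  have : ⟪x - p, q - p⟫ = ⟪p - q, p - q⟫ - ⟪x - q, p - q⟫ := by
    rw [← inner_sub_left, ← neg_sub p q, inner_neg_right, ← inner_neg_left]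
    congr 1; abel
  linarith

lemma inner_mem_Icc_of_isDoubleNormalPair {d : ℕ} {V : Finset (Euc d)} {x y y' : Euc d}
    (h : IsDoubleNormalPair V y x) (h' : IsDoubleNormalPair V y' x) :
    ⟪y' - y, x - y⟫ ∈ Set.Icc 0 (‖y' - y‖ ^ 2) := by
  have h1 := (h.2.2.2 y' h'.2.1).1
  have h2 := (h'.2.2.2 y h.2.1).1
  refine ⟨h1, ?_⟩
  rw [← real_inner_self_eq_norm_sq]
  have : ⟪y - y', x - y'⟫ = ⟪y' - y, y' - y⟫ - ⟪y' - y, x - y⟫ := by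
    rw [← inner_sub_right, ← neg_sub y' y, inner_neg_left, ← inner_neg_right]
    congr 1; abel
  linarith

lemma abs_sub_le_of_mem_Icc_zero {a b c : ℝ} (ha : a ∈ Set.Icc 0 c) (hb : b ∈ Set.Icc 0 c) :
    |a - b| ≤ c := by
  rw [abs_le]; constructor <;> linarith [ha.1, ha.2, hb.1, hb.2]

/-- A linear system close to the identity is solvable, with control on the solution. -/
lemma exists_solution_of_near_one {k : ℕ} {ε : ℝ} (hε : 0 < ε) (hkε : k * ε ≤ 1 / 2)
    (M : Matrix (Fin k) (Fin k) ℝ) (hdiag : ∀ m, M m m = 1)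
    (hoff : ∀ m l, m ≠ l → |M m l| ≤ ε) :
    M.det ≠ 0 ∧ ∀ (b : Fin k → ℝ) (K : ℝ), (∀ m, |b m| ≤ K) →
      ∃ c : Fin k → ℝ, M.mulVec c = b ∧ ∀ m, |c m| ≤ 2 * K := by
  have hrow : ∀ m, ∑ l ∈ Finset.univ.erase m, |M m l| ≤ 1 / 2 := fun m =>
    calc ∑ l ∈ Finset.univ.erase m, |M m l| ≤ ∑ l ∈ Finset.univ.erase m, ε :=
          Finset.sum_le_sum fun l hl => hoff m l (Finset.ne_of_mem_erase hl).symm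
      _ ≤ ∑ l : Fin k, ε :=
          Finset.sum_le_sum_of_subset_of_nonneg (Finset.erase_subset _ _) fun _ _ _ => hε.le
      _ ≤ 1 / 2 := by simpa using hkε
  have hdet : M.det ≠ 0 := det_ne_zero_of_sum_row_lt_diag fun m => by
    simp only [hdiag, Real.norm_eq_abs, abs_one]
    linarith [hrow m]
  refine ⟨hdet, fun b K hb => ?_⟩
  refine ⟨M⁻¹.mulVec b, ?_, ?_⟩
  · rw [Matrix.mulVec_mulVec, Matrix.mul_nonsing_inv _ (isUnit_iff_ne_zero.2 hdet),
      Matrix.one_mulVec]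
  have hc : M.mulVec (M⁻¹.mulVec b) = b := by
    rw [Matrix.mulVec_mulVec, Matrix.mul_nonsing_inv _ (isUnit_iff_ne_zero.2 hdet),
      Matrix.one_mulVec]
  generalize M⁻¹.mulVec b = c at hc ⊢
  intro m
  obtain ⟨m₀, -, hm₀⟩ := Finset.exists_max_image Finset.univ (fun m => |c m|)
    ⟨m, Finset.mem_univ m⟩
  have h1 : c m₀ = b m₀ - ∑ l ∈ Finset.univ.erase m₀, M m₀ l * c l := by
    rw [← hc, Matrix.mulVec, dotProduct, ← Finset.add_sum_erase _ _ (Finset.mem_univ m₀), hdiag]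
    ring
  have h2 : |∑ l ∈ Finset.univ.erase m₀, M m₀ l * c l| ≤ 1 / 2 * |c m₀| :=
    calc _ ≤ ∑ l ∈ Finset.univ.erase m₀, |M m₀ l| * |c m₀| := by
          refine (Finset.abs_sum_le_sum_abs _ _).trans (Finset.sum_le_sum fun l _ => ?_)
          rw [abs_mul]
          exact mul_le_mul_of_nonneg_left (hm₀ l (Finset.mem_univ l)) (abs_nonneg _)
      _ ≤ 1 / 2 * |c m₀| := by
          rw [← Finset.sum_mul]
          exact mul_le_mul_of_nonneg_right (hrow m₀) (abs_nonneg _)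
  have h3 : |c m₀| ≤ |b m₀| + |∑ l ∈ Finset.univ.erase m₀, M m₀ l * c l| := by
    conv_lhs => rw [h1]
    exact abs_sub _ _
  linarith [hb m₀, hm₀ m (Finset.mem_univ m)]

lemma le_and_card_le_of_containsDNMultipartite {d k : ℕ} (hk : 0 < k)
    (h : ∀ r : ℕ, ContainsDNMultipartite d k r) {ε : ℝ} (hε : 0 < ε) (hkε : k * ε ≤ 1 / 4) :
    k ≤ d ∧ (k : ℝ) ≤ (2 + 8 * (2 * k * ε)) ^ (d - k) := by
  obtain ⟨R, hR⟩ := exists_short_long_pairs (E := Euc d) hε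
  obtain ⟨V, P, hPV, hcard, -, hDN⟩ := h R
  choose x hx x' hx' y hy y' hy' hne hle using fun m => hR (P m) (hcard m).ge
  set e : Fin k → Euc d := fun m => x' m - x m with he
  set f : Fin k → Euc d := fun m => y' m - y m with hf
  have hfpos : ∀ m, 0 < ‖f m‖ ^ 2 := fun m =>
    pow_pos (norm_pos_iff.2 (sub_ne_zero.2 (hne m).symm)) 2
  have hefpos : ∀ m, 0 < ⟪e m, f m⟫ := fun m =>
    pos_of_mul_pos_right ((hfpos m).trans_le (hle m)) hε.le
  set g : Fin k → Euc d := fun m => (⟪e m, f m⟫)⁻¹ • f m with hg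
  -- bounds for functionals `g m` on differences of points of `V`
  have hginner : ∀ m z, |⟪f m, z⟫| ≤ ‖f m‖ ^ 2 → |⟪g m, z⟫| ≤ ε := by
    intro m z hz
    rw [hg, inner_smul_left, RCLike.conj_to_real, abs_mul, abs_inv, abs_of_pos (hefpos m),
      inv_mul_le_iff₀ (hefpos m)]
    linarith [hle m]
  have hfIcc : ∀ m l, m ≠ l → ∀ p ∈ P l, ⟪f m, p - y m⟫ ∈ Set.Icc 0 (‖f m‖ ^ 2) :=
    fun m l hml p hp => inner_mem_Icc_of_isDoubleNormalPair
      (hDN m l hml _ (hy m) _ hp) (hDN m l hml _ (hy' m) _ hp)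
  have hfy : ∀ m l, ⟪f m, y l - y m⟫ ∈ Set.Icc 0 (‖f m‖ ^ 2) := by
    intro m l
    rcases eq_or_ne m l with rfl | hml
    · simp
    · exact hfIcc m l hml _ (hy l)
  have hgy : ∀ m l j, |⟪g m, y l - y j⟫| ≤ ε := by
    intro m l j
    refine hginner m _ ?_
    have := abs_sub_le_of_mem_Icc_zero (hfy m l) (hfy m j)
    rwa [← inner_sub_right, sub_sub_sub_cancel_right] at this
  have hge : ∀ m l, m ≠ l → |⟪g m, e l⟫| ≤ ε := by
    intro m l hml
    refine hginner m _ ?_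
    have := abs_sub_le_of_mem_Icc_zero (hfIcc m l hml _ (hx' l)) (hfIcc m l hml _ (hx l))
    rwa [← inner_sub_right, sub_sub_sub_cancel_right] at this
  obtain ⟨hdet, hsol⟩ := exists_solution_of_near_one hε (by linarith)
    (Matrix.of fun m l => ⟪e m, g l⟫)
    (fun m => by
      simp only [Matrix.of_apply, hg, inner_smul_right]
      exact inv_mul_cancel₀ (hefpos m).ne')
    (fun m l hml => by
      rw [Matrix.of_apply, real_inner_comm]
      exact hge l m hml.symm)
  have hind := linearIndependent_of_det_inner_ne_zero e g hdet
  set U := Submodule.span ℝ (Set.range e) with hU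
  have hUrank : Module.finrank ℝ U = k := by
    rw [hU, finrank_span_eq_card hind, Fintype.card_fin]
  have hsum := U.finrank_add_finrank_orthogonal
  rw [hUrank, finrank_euclideanSpace_fin] at hsum
  refine ⟨by omega, ?_⟩
  have hyIcc : ∀ i j, i ≠ j → ∀ p ∈ V, ⟪p - y j, y i - y j⟫ ∈ Set.Icc 0 (‖y i - y j‖ ^ 2) :=
    fun i j hij p hp => (hDN i j hij _ (hy i) _ (hy j)).inner_mem_Icc hp
  have hv : ∀ i j, i ≠ j → ∃ w : Uᗮ, ∀ l l',
      |⟪(w : Euc d), y l - y l'⟫ - ⟪y i - y j, y l - y l'⟫| ≤ 2 * k * ε * ‖y i - y j‖ ^ 2 := by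
    intro i j hij
    obtain ⟨c, hc, hcb⟩ := hsol (fun m => ⟪e m, y i - y j⟫) (‖y i - y j‖ ^ 2) fun m => by
      have := abs_sub_le_of_mem_Icc_zero (hyIcc i j hij _ (hPV m (hx' m)))
        (hyIcc i j hij _ (hPV m (hx m)))
      rwa [← inner_sub_left, sub_sub_sub_cancel_right] at this
    refine ⟨⟨y i - y j - ∑ m, c m • g m, ?_⟩, fun l l' => ?_⟩
    · rw [Submodule.mem_orthogonal]
      intro u hu
      induction hu using Submodule.span_induction with
      | mem u hu =>
        obtain ⟨m, rfl⟩ := hu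
        have := congrFun hc m
        simp only [Matrix.mulVec, dotProduct, Matrix.of_apply] at this
        simp only [inner_sub_right (e m) (y i - y j), inner_sum, inner_smul_right]
        rw [← this, sub_eq_zero]
        exact Finset.sum_congr rfl fun _ _ => mul_comm _ _
      | zero => simp
      | add u w _ _ hu hw => rw [inner_add_left, hu, hw, add_zero]
      | smul a u _ hu => rw [inner_smul_left, hu, mul_zero]
    · rw [inner_sub_left (y i - y j), sub_sub_cancel_left, abs_neg, sum_inner]
      calc |∑ m, ⟪c m • g m, y l - y l'⟫| ≤ ∑ m : Fin k, 2 * ‖y i - y j‖ ^ 2 * ε := by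
            refine (Finset.abs_sum_le_sum_abs _ _).trans (Finset.sum_le_sum fun m _ => ?_)
            rw [inner_smul_left, RCLike.conj_to_real, abs_mul]
            exact mul_le_mul (hcb m) (hgy m l l') (abs_nonneg _) (by positivity)
        _ = _ := by simp; ring
  choose! w hw using hv
  have : Nonempty (Fin k) := ⟨⟨0, hk⟩⟩
  have hD : ∀ i j, i ≠ j → 0 < ‖y i - y j‖ ^ 2 := fun i j hij =>
    pow_pos (norm_pos_iff.2 (sub_ne_zero.2 (hDN i j hij _ (hy i) _ (hy j)).1)) 2
  have hproj : ∀ i j l l',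
      ⟪(‖y i - y j‖ ^ 2)⁻¹ • w i j,
        Uᗮ.orthogonalProjectionOnto (y l) - Uᗮ.orthogonalProjectionOnto (y l')⟫
      = (‖y i - y j‖ ^ 2)⁻¹ * ⟪(w i j : Euc d), y l - y l'⟫ := by
    intro i j l l'
    rw [← map_sub, inner_smul_left, Submodule.inner_orthogonalProjectionOnto_eq_of_mem_left,
      RCLike.conj_to_real]
  have key := card_le_of_almost_antipodal (fun l => Uᗮ.orthogonalProjectionOnto (y l))
    (fun i j => (‖y i - y j‖ ^ 2)⁻¹ • w i j) (η := 2 * k * ε) (by positivity) ?_ ?_ ?_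
  · rwa [Fintype.card_fin, show Module.finrank ℝ Uᗮ = d - k by omega] at key
  · intro i j hij
    rw [hproj, le_inv_mul_iff₀ (hD i j hij)]
    have h1 := (abs_le.1 (hw i j hij i j)).1
    rw [real_inner_self_eq_norm_sq] at h1
    nlinarith [hD i j hij]
  · intro i j hij l
    rw [hproj, le_inv_mul_iff₀ (hD i j hij)]
    have h1 := (abs_le.1 (hw i j hij l j)).1
    have h2 := (hyIcc i j hij _ (hPV l (hy l))).1
    rw [real_inner_comm] at h2
    linarith
  · intro i j hij l
    rw [hproj, inv_mul_le_iff₀ (hD i j hij)]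
    have h1 := (abs_le.1 (hw i j hij l i)).2
    have h2 := (hyIcc j i hij.symm _ (hPV l (hy l))).1
    rw [real_inner_comm, ← neg_sub (y i), inner_neg_left] at h2
    linarith

theorem stmt0 (d k : ℕ) (hk : 2 ≤ k)
    (h : ∀ r : ℕ, ContainsDNMultipartite d k r) :
    k + minNonObtuseDim k ≤ d := by
  have hkpos : (0 : ℝ) < k := by positivity
  have hmain := fun (ε : ℝ) (h1 : 0 < ε) (h2 : k * ε ≤ 1 / 4) =>
    le_and_card_le_of_containsDNMultipartite (by omega) h h1 h2
  have hkd : k ≤ d := (hmain (1 / (4 * k)) (by positivity) (le_of_eq (by field_simp))).1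
  have hlim : Filter.Tendsto (fun ε : ℝ => (2 + 8 * (2 * k * ε)) ^ (d - k))
      (nhdsWithin 0 (Set.Ioi 0)) (nhds (2 ^ (d - k))) := by
    have : Continuous fun ε : ℝ => (2 + 8 * (2 * k * ε)) ^ (d - k) := by fun_prop
    simpa using (this.tendsto 0).mono_left nhdsWithin_le_nhds
  have hle : (k : ℝ) ≤ 2 ^ (d - k) := by
    refine ge_of_tendsto hlim ?_
    filter_upwards [Ioo_mem_nhdsGT (show (0 : ℝ) < 1 / (4 * k) by positivity)] with ε hε
    refine (hmain ε hε.1 ?_).2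
    have := mul_le_mul_of_nonneg_left hε.2.le hkpos.le
    refine this.trans (le_of_eq (by field_simp))
  have := minNonObtuseDim_le (show k ≤ 2 ^ (d - k) by exact_mod_cast hle)
  omega
end

section
/- Let d and k be natural numbers with k ≥ 2. Suppose that for every r ∈ ℕ there exists a finite set V of points in Euclidean space ℝ^d that contains the complete k-partite graph K_k(r) in its double-normal graph. Then (k : ℝ) + log₂ k ≤ d. -/
open scoped RealInnerProductSpace

section Packing

open scoped Pointwise

open MeasureTheory Metric

variable {E : Type*} [NormedAddCommGroup E] [InnerProductSpace ℝ E]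

/-- Strict bounds on the width of a set in some direction extend to its convex hull. -/
theorem inner_sub_lt_of_mem_convexHull {s : Set E} {w : E} {K : ℝ}
    (h : ∀ x ∈ s, ∀ y ∈ s, ⟪x - y, w⟫ < K) {x y : E}
    (hx : x ∈ convexHull ℝ s) (hy : y ∈ convexHull ℝ s) : ⟪x - y, w⟫ < K := by
  have hconv : Convex ℝ {z : E | ⟪z, w⟫ < K} :=
    convex_halfSpace_lt ⟨fun a b => inner_add_left a b w,
      fun c a => by simp [inner_smul_left]⟩ K
  have hsub : s - s ⊆ {z : E | ⟪z, w⟫ < K} := by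
    rintro _ ⟨a, ha, b, hb, rfl⟩
    exact h a ha b hb
  have hmem : x - y ∈ convexHull ℝ (s - s) := by
    rw [convexHull_sub]
    exact Set.sub_mem_sub hx hy
  exact convexHull_min hsub hconv hmem

/-- A volume bound of Danzer–Grünbaum type: if any two of the points `τ α` can be separated, after
scaling by `t`, in a direction in which the whole family is narrow, then there are at most
`(1 + t) ^ dim E` of them. -/
theorem card_le_one_add_pow_finrank [FiniteDimensional ℝ E] {ι : Type*} [Fintype ι] (τ : ι → E)
    {t : ℝ} (ht : 0 ≤ t)
    (h : ∀ α β, α ≠ β → ∃ w, ∀ γ δ, ⟪τ γ - τ δ, w⟫ < t * ⟪τ β - τ α, w⟫) :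
    (Fintype.card ι : ℝ) ≤ (1 + t) ^ Module.finrank ℝ E := by
  rcases isEmpty_or_nonempty ι with hι | hι
  · rw [Fintype.card_eq_zero, Nat.cast_zero]
    positivity
  let _ : MeasurableSpace E := borel E
  have : BorelSpace E := ⟨rfl⟩
  choose! w hw using h
  obtain ⟨η, hηpos, hη⟩ : ∃ η : ℝ, 0 < η ∧ ∀ α β, α ≠ β → ∀ γ δ,
      ⟪τ γ - τ δ, w α β⟫ < t * ⟪τ β - τ α, w α β⟫ - 2 * η * ‖w α β‖ := by
    have hev : ∀ᶠ η : ℝ in nhdsWithin 0 (Set.Ioi 0), ∀ α β, α ≠ β → ∀ γ δ,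
        ⟪τ γ - τ δ, w α β⟫ < t * ⟪τ β - τ α, w α β⟫ - 2 * η * ‖w α β‖ := by
      simp only [Filter.eventually_all]
      intro α β hne γ δ
      have hc : Continuous fun η : ℝ => t * ⟪τ β - τ α, w α β⟫ - 2 * η * ‖w α β‖ := by fun_prop
      refine nhdsWithin_le_nhds (hc.continuousAt.eventually_const_lt ?_)
      simpa using hw α β hne γ δ
    obtain ⟨η, h1, h2⟩ := (hev.and self_mem_nhdsWithin).exists
    exact ⟨η, h2, h1⟩
  set C : Set E := convexHull ℝ (Set.range τ) with hC
  set B : Set E := thickening η C with hB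
  have hBconv : Convex ℝ B := (convex_convexHull ℝ _).thickening η
  have hBopen : IsOpen B := isOpen_thickening
  have hτC : ∀ α, τ α ∈ C := fun α => subset_convexHull ℝ _ ⟨α, rfl⟩
  have hτB : ∀ α, τ α ∈ B := fun α => self_subset_thickening hηpos C (hτC α)
  have hBbdd : Bornology.IsBounded B :=
    (isBounded_convexHull.2 (Set.finite_range τ).isBounded).thickening
  have hBfin : volume B ≠ ⊤ := hBbdd.measure_lt_top.ne
  have hBpos : volume B ≠ 0 :=
    (hBopen.measure_pos volume ⟨_, hτB (Classical.arbitrary ι)⟩).ne'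
  let F : ι → Set E := fun α => (fun x => -(t • τ α) + x) ⁻¹' B
  have hFmeas : ∀ α, MeasurableSet (F α) := fun α =>
    (hBopen.preimage (continuous_const.add continuous_id)).measurableSet
  have hFvol : ∀ α, volume (F α) = volume B := fun α => measure_preimage_add volume _ B
  have hFsub : (⋃ α, F α) ⊆ (1 + t) • B := by
    refine Set.iUnion_subset fun α x hx => ?_
    rw [hBconv.add_smul zero_le_one ht, one_smul]
    exact ⟨_, hx, _, Set.smul_mem_smul_set (hτB α), by simp⟩
  have hdisj : Pairwise (Function.onFun Disjoint F) := by
    intro α β hne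
    refine Set.disjoint_left.2 fun x hxα hxβ => ?_
    obtain ⟨a, haC, ha⟩ := mem_thickening_iff.1 hxα
    obtain ⟨b, hbC, hb⟩ := mem_thickening_iff.1 hxβ
    rw [dist_eq_norm] at ha hb
    have hab := inner_sub_lt_of_mem_convexHull (s := Set.range τ) (w := w α β)
      (K := t * ⟪τ β - τ α, w α β⟫ - 2 * η * ‖w α β‖)
      (by rintro _ ⟨γ, rfl⟩ _ ⟨δ, rfl⟩; exact hη α β hne γ δ) haC hbC
    have hid : t * ⟪τ β - τ α, w α β⟫ = ⟪a - b, w α β⟫ + ⟪-(t • τ α) + x - a, w α β⟫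
        - ⟪-(t • τ β) + x - b, w α β⟫ := by
      simp only [inner_sub_left, inner_add_left, inner_neg_left, real_inner_smul_left]
      ring
    have h1 : ⟪-(t • τ α) + x - a, w α β⟫ ≤ η * ‖w α β‖ :=
      (real_inner_le_norm _ _).trans (by gcongr)
    have h2 : -(η * ‖w α β‖) ≤ ⟪-(t • τ β) + x - b, w α β⟫ :=
      (neg_le_neg (by gcongr)).trans (neg_le_of_abs_le (abs_real_inner_le_norm _ _))
    linarith
  have hvol : (Fintype.card ι : ENNReal) * volume B
      ≤ ENNReal.ofReal ((1 + t) ^ Module.finrank ℝ E) * volume B := by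
    calc (Fintype.card ι : ENNReal) * volume B = ∑ α, volume (F α) := by
          simp [hFvol]
      _ = volume (⋃ α, F α) := by rw [measure_iUnion hdisj hFmeas, tsum_fintype]
      _ ≤ volume ((1 + t) • B) := measure_mono hFsub
      _ = _ := by rw [Measure.addHaar_smul, abs_of_nonneg (by positivity)]
  have hle := (ENNReal.mul_le_mul_iff_left hBpos hBfin).1 hvol
  rwa [← ENNReal.ofReal_natCast, ENNReal.ofReal_le_ofReal_iff (by positivity)] at hle

theorem abs_boolToReal_sub_le (a b : Bool) :
    |(if a then (1 : ℝ) else 0) - (if b then 1 else 0)| ≤ 1 := by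
  cases a <;> cases b <;> norm_num

/-- The points `p i` together with all partial sums of the scaled vectors `c • u j`. -/
noncomputable def boxPoint {k : ℕ} (p u : Fin k → E) (c : ℝ) (γ : Fin k × (Fin k → Bool)) : E :=
  p γ.1 + c • ∑ j, (if γ.2 j then (1 : ℝ) else 0) • u j

theorem abs_inner_boxPoint_sub_le {k : ℕ} (p u : Fin k → E) {c : ℝ} (hc : 0 ≤ c) {w : E} {A : ℝ}
    (j : Fin k) (hp : ∀ a b, |⟪p a - p b, w⟫| ≤ A) (hu : ∀ l, l ≠ j → |⟪u l, w⟫| ≤ A)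
    (γ δ : Fin k × (Fin k → Bool)) :
    |⟪boxPoint p u c γ - boxPoint p u c δ, w⟫
      - c * (((if γ.2 j then (1 : ℝ) else 0) - (if δ.2 j then 1 else 0)) * ⟪u j, w⟫)|
      ≤ (1 + k * c) * A := by
  have hA : 0 ≤ A := (abs_nonneg _).trans (hp j j)
  have hid : ⟪boxPoint p u c γ - boxPoint p u c δ, w⟫
      - c * (((if γ.2 j then (1 : ℝ) else 0) - (if δ.2 j then 1 else 0)) * ⟪u j, w⟫)
      = ⟪p γ.1 - p δ.1, w⟫ + c * ∑ l ∈ Finset.univ.erase j,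
        (((if γ.2 l then (1 : ℝ) else 0) - (if δ.2 l then 1 else 0)) * ⟪u l, w⟫) := by
    rw [eq_comm, Finset.sum_erase_eq_sub (Finset.mem_univ j)]
    simp only [boxPoint, inner_sub_left, inner_add_left, real_inner_smul_left, sum_inner, sub_mul,
      Finset.sum_sub_distrib]
    ring
  have hsum : |∑ l ∈ Finset.univ.erase j,
      (((if γ.2 l then (1 : ℝ) else 0) - (if δ.2 l then 1 else 0)) * ⟪u l, w⟫)| ≤ k * A := by
    calc _ ≤ ∑ l ∈ Finset.univ.erase j, A := by
          refine (Finset.abs_sum_le_sum_abs _ _).trans (Finset.sum_le_sum fun l hl => ?_)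
          rw [abs_mul]
          exact (mul_le_of_le_one_left (abs_nonneg _) (abs_boolToReal_sub_le _ _)).trans
            (hu l (Finset.ne_of_mem_erase hl))
      _ ≤ ∑ l : Fin k, A :=
          Finset.sum_le_sum_of_subset_of_nonneg (Finset.subset_univ _) fun _ _ _ => hA
      _ = k * A := by simp
  rw [hid]
  calc _ ≤ |⟪p γ.1 - p δ.1, w⟫| + |c * _| := abs_add_le _ _
    _ ≤ A + c * (k * A) := by
      rw [abs_mul, abs_of_nonneg hc]
      exact add_le_add (hp _ _) (mul_le_mul_of_nonneg_left hsum hc)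
    _ = (1 + k * c) * A := by ring

/-- The packing bound for points `p i` with long vectors `u i` that are nearly aligned with much
shorter vectors `v i`. -/
theorem card_mul_two_pow_le [FiniteDimensional ℝ E] {k : ℕ} (p u v : Fin k → E) {t c M : ℝ}
    (ht : 0 ≤ t) (hc : 0 < c) (htc : 1 + (k + 1) * c < t)
    (hM : (1 + t) * (1 + k * c) < (t - 1) * c * M)
    (hpne : ∀ i j, i ≠ j → p i ≠ p j)
    (hpp : ∀ i j, i ≠ j → ∀ a b, |⟪p a - p b, p j - p i⟫| ≤ ‖p j - p i‖ ^ 2)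
    (hup : ∀ i j, i ≠ j → ∀ l, |⟪u l, p j - p i⟫| ≤ ‖p j - p i‖ ^ 2)
    (hpv : ∀ j a b, |⟪p a - p b, v j⟫| ≤ ‖v j‖ ^ 2)
    (huv : ∀ l j, l ≠ j → |⟪u l, v j⟫| ≤ ‖v j‖ ^ 2)
    (hv : ∀ j, v j ≠ 0) (huvM : ∀ j, M * ‖v j‖ ^ 2 ≤ ⟪u j, v j⟫) :
    (k : ℝ) * 2 ^ k ≤ (1 + t) ^ Module.finrank ℝ E := by
  have key := card_le_one_add_pow_finrank (boxPoint p u c) ht ?_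
  · simpa using key
  rintro ⟨i, e⟩ ⟨i', e'⟩ hne
  by_cases he : e = e'
  · subst he
    have hii : i ≠ i' := fun h => hne (by rw [h])
    refine ⟨p i' - p i, fun γ δ => ?_⟩
    have hpos : 0 < ‖p i' - p i‖ ^ 2 :=
      pow_pos (norm_pos_iff.2 (sub_ne_zero.2 (hpne i i' hii).symm)) 2
    have h1 := (abs_le.1 (abs_inner_boxPoint_sub_le p u hc.le i (hpp i i' hii)
      (fun l _ => hup i i' hii l) γ δ)).2
    have h2 : c * (((if γ.2 i then (1 : ℝ) else 0) - (if δ.2 i then 1 else 0))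
        * ⟪u i, p i' - p i⟫) ≤ c * ‖p i' - p i‖ ^ 2 := by
      refine mul_le_mul_of_nonneg_left ((le_abs_self _).trans ?_) hc.le
      rw [abs_mul]
      exact (mul_le_of_le_one_left (abs_nonneg _) (abs_boolToReal_sub_le _ _)).trans
        (hup i i' hii i)
    have h3 : boxPoint p u c (i', e) - boxPoint p u c (i, e) = p i' - p i := by
      simp [boxPoint]
    rw [h3, real_inner_self_eq_norm_sq]
    nlinarith
  · obtain ⟨j, hj⟩ := Function.ne_iff.1 he
    set s : ℝ := (if e' j then (1 : ℝ) else 0) - (if e j then 1 else 0) with hs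
    have hss : s * s = 1 := by
      rw [hs]
      revert hj
      cases e j <;> cases e' j <;> norm_num
    have hsabs : |s| = 1 := by
      rw [← abs_mul_abs_self] at hss
      nlinarith [abs_nonneg s]
    have hsabs_mul : ∀ x : ℝ, |s * x| = |x| := fun x => by rw [abs_mul, hsabs, one_mul]
    have hpos : 0 < ‖v j‖ ^ 2 := pow_pos (norm_pos_iff.2 (hv j)) 2
    have hbound := abs_inner_boxPoint_sub_le p u (w := s • v j) hc.le j
      (fun a b => by rw [real_inner_smul_right, hsabs_mul]; exact hpv j a b)
      (fun l hl => by rw [real_inner_smul_right, hsabs_mul]; exact huv l j hl)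
    refine ⟨s • v j, fun γ δ => ?_⟩
    have h1 := (abs_le.1 (hbound γ δ)).2
    have h2 := (abs_le.1 (hbound (i', e') (i, e))).1
    have huv' := huvM j
    have h0 : 0 ≤ ⟪u j, v j⟫ := by
      refine le_trans (mul_nonneg ?_ hpos.le) huv'
      have hk : (0 : ℝ) ≤ k := k.cast_nonneg
      have h3 : 0 < (t - 1) * c := mul_pos (by nlinarith) hc
      exact (pos_of_mul_pos_right (lt_trans (by positivity) hM) h3.le).le
    have h4 : c * (((if γ.2 j then (1 : ℝ) else 0) - (if δ.2 j then 1 else 0))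
        * ⟪u j, s • v j⟫) ≤ c * ⟪u j, v j⟫ := by
      refine mul_le_mul_of_nonneg_left ((le_abs_self _).trans ?_) hc.le
      rw [abs_mul, real_inner_smul_right, hsabs_mul, abs_of_nonneg h0]
      exact mul_le_of_le_one_left h0 (abs_boolToReal_sub_le _ _)
    have h5 : c * (s * ⟪u j, s • v j⟫) = c * ⟪u j, v j⟫ := by
      rw [real_inner_smul_right, ← mul_assoc s, hss, one_mul]
    simp only [← hs] at h2
    rw [h5] at h2
    have h6 := mul_le_mul_of_nonneg_left h2 ht
    have h7 : (t - 1) * c * (M * ‖v j‖ ^ 2) ≤ (t - 1) * c * ⟪u j, v j⟫ := by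
      refine mul_le_mul_of_nonneg_left huv' (mul_nonneg ?_ hc.le)
      have hk : (0 : ℝ) ≤ k := k.cast_nonneg
      nlinarith
    have h8 := mul_lt_mul_of_pos_right hM hpos
    nlinarith

end Packing

section Clusters

open Metric

variable {E : Type*} [NormedAddCommGroup E] [InnerProductSpace ℝ E] [FiniteDimensional ℝ E]

variable (E) in
theorem exists_finset_cover_unit_ball {ε : ℝ} (hε : 0 < ε) :
    ∃ T : Finset E, ∀ x : E, ‖x‖ ≤ 1 → ∃ y ∈ T, dist x y < ε := by
  obtain ⟨T, -, hT, hcov⟩ := (isCompact_closedBall (0 : E) 1).finite_cover_balls hε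
  refine ⟨hT.toFinset, fun x hx => ?_⟩
  simpa using hcov (mem_closedBall_zero_iff.2 hx)

variable (E) in
/-- A large finite set of diameter at most `D` has a large subset of diameter at most `ε * D`. -/
theorem exists_subset_dist_le (N : ℕ) {ε : ℝ} (hε : 0 < ε) :
    ∃ R : ℕ, ∀ S : Finset E, R ≤ S.card → ∀ D : ℝ, (∀ x ∈ S, ∀ y ∈ S, dist x y ≤ D) →
      ∃ S' ⊆ S, N ≤ S'.card ∧ ∀ x ∈ S', ∀ y ∈ S', dist x y ≤ ε * D := by
  classical
  obtain ⟨T, hT⟩ := exists_finset_cover_unit_ball E (half_pos hε)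
  refine ⟨T.card * N + N + 1, fun S hS D hD => ?_⟩
  obtain ⟨z, hz⟩ : S.Nonempty := Finset.card_pos.1 (by omega)
  have hD0 : 0 ≤ D := by simpa using hD z hz z hz
  rcases hD0.eq_or_lt with rfl | hDpos
  · exact ⟨S, Finset.Subset.refl S, by omega, by simpa using hD⟩
  have hcov : ∀ x : E, ∃ y, x ∈ S → y ∈ T ∧ dist (D⁻¹ • (x - z)) y < ε / 2 := by
    intro x
    by_cases hx : x ∈ S
    · obtain ⟨y, hy, hxy⟩ := hT (D⁻¹ • (x - z)) (by
        rw [norm_smul, norm_inv, Real.norm_of_nonneg hD0, ← dist_eq_norm, inv_mul_le_iff₀ hDpos,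
          mul_one]
        exact hD x hx z hz)
      exact ⟨y, fun _ => ⟨hy, hxy⟩⟩
    · exact ⟨0, fun h => absurd h hx⟩
  choose f hf using hcov
  obtain ⟨y, -, hy⟩ := Finset.exists_lt_card_fiber_of_mul_lt_card_of_maps_to (n := N)
    (fun x hx => (hf x hx).1) (by omega)
  refine ⟨_, Finset.filter_subset _ _, hy.le, fun a ha b hb => ?_⟩
  rw [Finset.mem_filter] at ha hb
  have ha' := (hf a ha.1).2
  have hb' := (hf b hb.1).2
  rw [ha.2] at ha'
  rw [hb.2] at hb'
  have hlt : dist (D⁻¹ • (a - z)) (D⁻¹ • (b - z)) < ε := by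
    linarith [dist_triangle_right (D⁻¹ • (a - z)) (D⁻¹ • (b - z)) y]
  rw [dist_smul₀, dist_sub_right, norm_inv, Real.norm_of_nonneg hD0, inv_mul_lt_iff₀ hDpos] at hlt
  linarith

variable (E) in
/-- A large finite set contains a point `p` and a sequence of other points whose distances to `p`
decrease rapidly. -/
theorem exists_rapidly_approaching (n : ℕ) {ε : ℝ} (hε : 0 < ε) :
    ∃ R : ℕ, ∀ S : Finset E, R ≤ S.card → ∃ p ∈ S, ∃ a : ℕ → E, ∀ t < n,
      a t ∈ S ∧ a t ≠ p ∧ ∀ s < t, dist (a t) p ≤ ε * dist (a s) p := by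
  induction n with
  | zero =>
    refine ⟨1, fun S hS => ?_⟩
    obtain ⟨p, hp⟩ := Finset.card_pos.1 hS
    exact ⟨p, hp, fun _ => p, by simp⟩
  | succ n ih =>
    obtain ⟨R, hR⟩ := ih
    obtain ⟨R', hR'⟩ := exists_subset_dist_le E R (half_pos hε)
    refine ⟨R' + 2, fun S hS => ?_⟩
    obtain ⟨y, hy, z, hz, hyz⟩ := Finset.one_lt_card.1 (show 1 < S.card by omega)
    obtain ⟨⟨x, x'⟩, hx, hmax⟩ := (S ×ˢ S).exists_max_image (fun q => dist q.1 q.2)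
      ⟨(y, z), Finset.mk_mem_product hy hz⟩
    rw [Finset.mem_product] at hx
    have hD : ∀ a ∈ S, ∀ b ∈ S, dist a b ≤ dist x x' := fun a ha b hb =>
      hmax (a, b) (Finset.mk_mem_product ha hb)
    have hDpos : 0 < dist x x' := (dist_pos.2 hyz).trans_le (hD y hy z hz)
    obtain ⟨S', hS'S, hS'card, hS'⟩ := hR' S (by omega) _ hD
    obtain ⟨p, hp, a, ha⟩ := hR S' hS'card
    obtain ⟨b, hbS, hb⟩ : ∃ b ∈ S, dist x x' / 2 ≤ dist b p := by
      by_contra! hcon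
      linarith [dist_triangle_right x x' p, hcon x hx.1, hcon x' hx.2]
    refine ⟨p, hS'S hp, fun t => Nat.casesOn t b a, ?_⟩
    rintro (_ | t) ht
    · exact ⟨hbS, dist_pos.1 (lt_of_lt_of_le (by positivity) hb), fun s hs => by omega⟩
    · obtain ⟨h1, h2, h3⟩ := ha t (by omega)
      refine ⟨hS'S h1, h2, ?_⟩
      rintro (_ | s) hs
      · calc dist (a t) p ≤ ε / 2 * dist x x' := hS' _ h1 _ hp
          _ = ε * (dist x x' / 2) := by ring
          _ ≤ ε * dist b p := by gcongr
      · exact h3 s (by omega)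

variable (E) in
/-- A large finite set contains points `p`, `a`, `b` such that `b - p` is much longer than `a - p`
and forms an angle with it that is bounded away from a right angle. -/
theorem exists_aligned_triple {M : ℝ} (hM : 0 < M) :
    ∃ R : ℕ, ∀ S : Finset E, R ≤ S.card → ∃ p ∈ S, ∃ a ∈ S, ∃ b ∈ S,
      a ≠ p ∧ M * ‖a - p‖ ^ 2 ≤ ⟪b - p, a - p⟫ := by
  obtain ⟨T, hT⟩ := exists_finset_cover_unit_ball E (half_pos (zero_lt_one (α := ℝ)))
  have hε : 0 < 1 / (2 * M) := by positivity
  obtain ⟨R, hR⟩ := exists_rapidly_approaching E (T.card + 1) hε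
  refine ⟨R, fun S hS => ?_⟩
  obtain ⟨p, hp, a, ha⟩ := hR S hS
  have hdir : ∀ t, ∃ y ∈ T, dist (‖a t - p‖⁻¹ • (a t - p)) y < 1 / 2 := fun t => by
    refine hT _ ?_
    rw [norm_smul, norm_inv, norm_norm]
    exact inv_mul_le_one
  choose f hfT hf using hdir
  obtain ⟨s, t, hst, htn, hfst⟩ : ∃ s t, s < t ∧ t < T.card + 1 ∧ f s = f t := by
    obtain ⟨s, hs, t, ht, hne, hfst⟩ := Finset.exists_ne_map_eq_of_card_lt_of_maps_to
      (s := Finset.range (T.card + 1)) (t := T) (by simp) (f := f) (fun t _ => hfT t)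
    rw [Finset.mem_range] at hs ht
    rcases hne.lt_or_gt with h | h
    · exact ⟨s, t, h, ht, hfst⟩
    · exact ⟨t, s, h, hs, hfst.symm⟩
  obtain ⟨hsS, hsp, -⟩ := ha s (hst.trans htn)
  obtain ⟨htS, htp, hdist⟩ := ha t htn
  refine ⟨p, hp, a t, htS, a s, hsS, htp, ?_⟩
  have hs0 : 0 < ‖a s - p‖ := norm_pos_iff.2 (sub_ne_zero.2 hsp)
  have ht0 : 0 < ‖a t - p‖ := norm_pos_iff.2 (sub_ne_zero.2 htp)
  set g := ‖a s - p‖⁻¹ • (a s - p) with hg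
  set g' := ‖a t - p‖⁻¹ • (a t - p) with hg'
  have hgn : ‖g‖ = 1 := norm_smul_inv_norm (𝕜 := ℝ) (sub_ne_zero.2 hsp)
  have hgn' : ‖g'‖ = 1 := norm_smul_inv_norm (𝕜 := ℝ) (sub_ne_zero.2 htp)
  have hlt : ‖g - g'‖ < 1 := by
    have h1 := hf s
    have h2 := hf t
    rw [← hfst] at h2
    rw [← dist_eq_norm]
    linarith [dist_triangle_right g g' (f s)]
  have hinner : 1 / 2 ≤ ⟪g, g'⟫ := by
    have h1 := norm_sub_sq_real g g'
    rw [hgn, hgn'] at h1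
    nlinarith [norm_nonneg (g - g')]
  rw [hg, hg', real_inner_smul_left, real_inner_smul_right, ← mul_assoc, ← mul_inv,
    ← div_eq_inv_mul, le_div_iff₀ (by positivity)] at hinner
  have hd := hdist s hst
  rw [dist_eq_norm, dist_eq_norm, one_div, ← div_eq_inv_mul, le_div_iff₀ (by positivity)] at hd
  nlinarith

end Clusters

section DoubleNormal

variable {d : ℕ} {V : Finset (Euc d)}

theorem abs_sub_le_of_mem_Icc {x y K : ℝ} (hx : 0 ≤ x ∧ x ≤ K) (hy : 0 ≤ y ∧ y ≤ K) :
    |x - y| ≤ K :=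
  abs_le.2 ⟨by linarith, by linarith⟩

theorem IsDoubleNormalPair.abs_inner_sub_le {p q : Euc d} (h : IsDoubleNormalPair V p q)
    {x y : Euc d} (hx : x ∈ V) (hy : y ∈ V) : |⟪x - y, q - p⟫| ≤ ‖q - p‖ ^ 2 := by
  have hmem : ∀ z ∈ V, 0 ≤ ⟪z - p, q - p⟫ ∧ ⟪z - p, q - p⟫ ≤ ‖q - p‖ ^ 2 := by
    intro z hz
    obtain ⟨h1, h2⟩ := h.2.2.2 z hz
    refine ⟨h1, ?_⟩
    have hid : ⟪z - q, p - q⟫ = ‖q - p‖ ^ 2 - ⟪z - p, q - p⟫ := by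
      rw [← real_inner_self_eq_norm_sq]
      simp only [inner_sub_left, inner_sub_right]
      ring
    linarith
  have := abs_sub_le_of_mem_Icc (hmem x hx) (hmem y hy)
  rwa [← inner_sub_left, sub_sub_sub_cancel_right] at this

/-- The strip orthogonal to the segment between two points `p`, `a` contains all points that form
double-normal pairs with both of them. -/
theorem inner_mem_Icc_of_isDoubleNormalPair_s1 {p a q : Euc d} (hp : IsDoubleNormalPair V p q)
    (ha : IsDoubleNormalPair V a q) :
    0 ≤ ⟪q - p, a - p⟫ ∧ ⟪q - p, a - p⟫ ≤ ‖a - p‖ ^ 2 := by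
  have h1 := (hp.2.2.2 a ha.2.1).1
  have h2 := (ha.2.2.2 p hp.2.1).1
  rw [real_inner_comm] at h1
  refine ⟨h1, ?_⟩
  have hid : ⟪p - a, q - a⟫ = ‖a - p‖ ^ 2 - ⟪q - p, a - p⟫ := by
    rw [← real_inner_self_eq_norm_sq]
    simp only [inner_sub_left, inner_sub_right, real_inner_comm]
    ring
  linarith

theorem card_mul_two_pow_le_of_containsDNMultipartite {k : ℕ}
    (h : ∀ r : ℕ, ContainsDNMultipartite d k r) {t : ℝ} (ht : 1 < t) :
    (k : ℝ) * 2 ^ k ≤ (1 + t) ^ d := by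
  have hk : (0 : ℝ) ≤ k := k.cast_nonneg
  obtain ⟨c, hc, htc⟩ : ∃ c : ℝ, 0 < c ∧ 1 + (k + 1) * c < t := by
    refine ⟨(t - 1) / (2 * (k + 1)), div_pos (by linarith) (by positivity), ?_⟩
    rw [show ((k : ℝ) + 1) * ((t - 1) / (2 * (k + 1))) = (t - 1) / 2 by field_simp]
    linarith
  have htc' : 0 < (t - 1) * c := mul_pos (by linarith) hc
  obtain ⟨M, hMpos, hM⟩ : ∃ M : ℝ, 0 < M ∧ (1 + t) * (1 + k * c) < (t - 1) * c * M := by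
    refine ⟨((1 + t) * (1 + k * c) + 1) / ((t - 1) * c), by positivity, ?_⟩
    rw [mul_div_cancel₀ _ htc'.ne']
    linarith
  obtain ⟨R, hR⟩ := exists_aligned_triple (Euc d) hMpos
  obtain ⟨V, P, hPV, hcard, -, hdn⟩ := h R
  choose p hp a ha b hb hap hM' using fun i => hR (P i) (hcard i).ge
  have hstrip : ∀ j l, ∀ q ∈ P l, q = p j ∨ l ≠ j →
      0 ≤ ⟪q - p j, a j - p j⟫ ∧ ⟪q - p j, a j - p j⟫ ≤ ‖a j - p j‖ ^ 2 := by
    rintro j l q hq (rfl | hlj)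
    · simp
    · exact inner_mem_Icc_of_isDoubleNormalPair_s1 (hdn j l hlj.symm _ (hp j) q hq)
        (hdn j l hlj.symm _ (ha j) q hq)
  have hstrip_p : ∀ j l, 0 ≤ ⟪p l - p j, a j - p j⟫ ∧ ⟪p l - p j, a j - p j⟫ ≤ ‖a j - p j‖ ^ 2 :=
    fun j l => hstrip j l _ (hp l) (by
      rcases eq_or_ne l j with rfl | hne
      exacts [Or.inl rfl, Or.inr hne])
  have key := card_mul_two_pow_le p (fun i => b i - p i) (fun i => a i - p i)
    (by linarith) hc htc hM
    (fun i j hij => (hdn i j hij _ (hp i) _ (hp j)).1)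
    (fun i j hij x y => (hdn i j hij _ (hp i) _ (hp j)).abs_inner_sub_le
      (hPV _ (hp x)) (hPV _ (hp y)))
    (fun i j hij l => (hdn i j hij _ (hp i) _ (hp j)).abs_inner_sub_le
      (hPV _ (hb l)) (hPV _ (hp l)))
    (fun j x y => by
      have := abs_sub_le_of_mem_Icc (hstrip_p j x) (hstrip_p j y)
      rwa [← inner_sub_left, sub_sub_sub_cancel_right] at this)
    (fun l j hlj => by
      have := abs_sub_le_of_mem_Icc (hstrip j l _ (hb l) (Or.inr hlj)) (hstrip_p j l)
      rwa [← inner_sub_left, sub_sub_sub_cancel_right] at this)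
    (fun j => sub_ne_zero.2 (hap j)) hM'
  rwa [finrank_euclideanSpace_fin] at key

end DoubleNormal

theorem stmt1 (d k : ℕ) (hk : 2 ≤ k)
    (h : ∀ r : ℕ, ContainsDNMultipartite d k r) :
    (k : ℝ) + Real.logb 2 k ≤ d := by
  have hlim : (k : ℝ) * 2 ^ k ≤ (1 + 1) ^ d := by
    have hcont : Continuous fun t : ℝ => (1 + t) ^ d := by fun_prop
    refine ge_of_tendsto (hcont.continuousWithinAt (s := Set.Ioi 1) (x := 1)) ?_
    filter_upwards [self_mem_nhdsWithin] with t ht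
    exact card_mul_two_pow_le_of_containsDNMultipartite h ht
  have hk0 : (0 : ℝ) < k := by exact_mod_cast (show 0 < k by omega)
  have hlog := Real.logb_le_logb_of_le one_lt_two (by positivity) hlim
  rw [one_add_one_eq_two, Real.logb_mul hk0.ne' (by positivity), Real.logb_pow, Real.logb_pow,
    Real.logb_self_eq_one one_lt_two] at hlog
  linarith
end

section
/- k'(4) = k(4) = 2; concretely: (i) for every r ∈ ℕ there exists a finite set V of points in Euclidean space ℝ⁴ containing two pairwise disjoint subsets of cardinality r such that any two points lying in different subsets form a strict double-normal pair of V; and (ii) there exists r ∈ ℕ such that no finite set V of points in ℝ⁴ contains three pairwise disjoint subsets of cardinality r with any two points lying in different subsets forming a double-normal pair of V. -/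
open scoped RealInnerProductSpace

/-- If any two distinct points of `P` are related by one of finitely many relations, then a large
`P` contains a long path whose steps all belong to a single relation. -/
theorem exists_long_chain {α κ : Type*} [Fintype κ] (m : ℕ) (P : Finset α)
    (R : κ → α → α → Prop)
    (hR : ∀ p ∈ P, ∀ q ∈ P, p ≠ q → ∃ c, R c p q)
    (hcard : (m + 1) ^ Fintype.card κ < P.card) :
    ∃ c, ∃ g : ℕ → α, (∀ i ≤ m, g i ∈ P) ∧ ∀ i < m, R c (g i) (g (i + 1)) := by
  classical
  let H : κ → ℕ → α → Prop := fun c n p =>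
    ∃ g : ℕ → α, g 0 = p ∧ (∀ i ≤ n, g i ∈ P) ∧ ∀ i < n, R c (g i) (g (i + 1))
  by_contra hno
  have hH : ∀ c p, ¬ H c m p := by
    rintro c p ⟨g, -, h1, h2⟩
    exact hno ⟨c, g, h1, h2⟩
  have hzero : ∀ c, ∀ p ∈ P, H c 0 p := fun c p hp =>
    ⟨fun _ => p, rfl, fun _ _ => hp, fun i hi => absurd hi (Nat.not_lt_zero i)⟩
  have hsucc : ∀ c n, ∀ p ∈ P, ∀ q, R c p q → H c n q → H c (n + 1) p := by
    rintro c n p hp q hpq ⟨g, rfl, h1, h2⟩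
    refine ⟨fun i => Nat.casesOn i p g, rfl, ?_, ?_⟩
    · rintro (_ | i) hi
      · exact hp
      · exact h1 i (by omega)
    · rintro (_ | i) hi
      · exact hpq
      · exact h2 i (by omega)
  let f : α → κ → Fin (m + 1) := fun p c =>
    ⟨Nat.findGreatest (fun n => H c n p) m, Nat.lt_succ_of_le (Nat.findGreatest_le m)⟩
  obtain ⟨p, hp, q, hq, hpq, hf⟩ :=
    Finset.exists_ne_map_eq_of_card_lt_of_maps_to (s := P) (t := Finset.univ) (f := f)
      (by simpa using hcard) (fun _ _ => Finset.mem_coe.2 (Finset.mem_univ _))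
  obtain ⟨c, hc⟩ := hR p hp q hq hpq
  have hfc : Nat.findGreatest (fun n => H c n p) m = Nat.findGreatest (fun n => H c n q) m :=
    congrArg Fin.val (congrFun hf c)
  have hspec : H c (Nat.findGreatest (fun n => H c n q) m) q :=
    Nat.findGreatest_spec (P := fun n => H c n q) (Nat.zero_le m) (hzero c q hq)
  have hlt : Nat.findGreatest (fun n => H c n q) m < m :=
    lt_of_le_of_ne (Nat.findGreatest_le m) fun h => hH c q (h ▸ hspec)
  have := Nat.le_findGreatest (P := fun n => H c n p) (Nat.succ_le_of_lt hlt)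
    (hsucc c _ p hp q hc hspec)
  omega

theorem mul_abs_inner_le {d : ℕ} {u v w : Euc d} {t δ B : ℝ} (ht : 0 < t)
    (hv : ‖v - t • u‖ ≤ δ * t) (hB : |⟪v, w⟫| ≤ B) :
    t * |⟪u, w⟫| ≤ B + δ * t * ‖w‖ := by
  have h1 : t * ⟪u, w⟫ = ⟪v, w⟫ - ⟪v - t • u, w⟫ := by
    rw [inner_sub_left, real_inner_smul_left]; ring
  have h2 : |⟪v - t • u, w⟫| ≤ δ * t * ‖w‖ :=
    (abs_real_inner_le_norm _ _).trans (mul_le_mul_of_nonneg_right hv (norm_nonneg _))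
  calc t * |⟪u, w⟫| = |t * ⟪u, w⟫| := by rw [abs_mul, abs_of_pos ht]
    _ ≤ |⟪v, w⟫| + |⟪v - t • u, w⟫| := by rw [h1]; exact abs_sub _ _
    _ ≤ _ := add_le_add hB h2

/-- A large finite set has three nearly collinear points `a, b, c`, in this order, such that their
common direction `u` is nearly orthogonal to every vector `w` whose inner products with the
differences of points of the set are dominated by the squared lengths. -/
theorem exists_nearly_collinear (d : ℕ) :
    ∃ r : ℕ, ∀ P : Finset (Euc d), P.card = r →
      ∃ u a b c : Euc d, ‖u‖ = 1 ∧ a ∈ P ∧ b ∈ P ∧ c ∈ P ∧ a ≠ b ∧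
        ‖(b - a) - ‖b - a‖ • u‖ ≤ 1 / 20 * ‖b - a‖ ∧
        (∀ z, 0 ≤ ⟪a - b, z⟫ → 0 ≤ ⟪c - b, z⟫ → |⟪u, z⟫| ≤ 1 / 20 * ‖z‖) ∧
        (∀ w, (∀ p ∈ P, ∀ p' ∈ P, |⟪p' - p, w⟫| ≤ ‖p' - p‖ ^ 2 ∧ |⟪p' - p, w⟫| ≤ ‖w‖ ^ 2) →
          |⟪u, w⟫| ≤ 1 / 20 * ‖w‖) := by
  classical
  obtain ⟨s, hs, hfin, hcover⟩ :=
    (isCompact_sphere (0 : Euc d) 1).finite_cover_balls (e := 1 / 40) (by norm_num)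
  have := hfin.fintype
  obtain ⟨m, hm⟩ : ∃ m : ℕ, m = 6400 := ⟨_, rfl⟩
  have hmR : (m : ℝ) = 6400 := by rw [hm]; norm_num
  refine ⟨(m + 1) ^ Fintype.card s + 1, fun P hP => ?_⟩
  obtain ⟨⟨u, hu⟩, g, hg, hstep⟩ := exists_long_chain m P
    (fun (c : s) p q => p ≠ q ∧ ‖(q - p) - ‖q - p‖ • (c : Euc d)‖ ≤ 1 / 40 * ‖q - p‖)
    (by
      intro p _ q _ hpq
      have hpos : 0 < ‖q - p‖ := norm_pos_iff.2 (sub_ne_zero.2 hpq.symm)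
      have hmem : ‖q - p‖⁻¹ • (q - p) ∈ Metric.sphere (0 : Euc d) 1 := by
        rw [mem_sphere_zero_iff_norm, norm_smul, norm_inv, norm_norm, inv_mul_cancel₀ hpos.ne']
      obtain ⟨c, hc, hcb⟩ := Set.mem_iUnion₂.1 (hcover hmem)
      refine ⟨⟨c, hc⟩, hpq, ?_⟩
      rw [Metric.mem_ball, dist_eq_norm] at hcb
      have : (q - p) - ‖q - p‖ • c = ‖q - p‖ • (‖q - p‖⁻¹ • (q - p) - c) := by
        rw [smul_sub, smul_smul, mul_inv_cancel₀ hpos.ne', one_smul]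
      rw [this, norm_smul, norm_norm, mul_comm]
      exact mul_le_mul_of_nonneg_right hcb.le hpos.le)
    (by omega)
  have hu1 : ‖u‖ = 1 := mem_sphere_zero_iff_norm.1 (hs hu)
  have hpos : ∀ i < m, 0 < ‖g (i + 1) - g i‖ := fun i hi =>
    norm_pos_iff.2 (sub_ne_zero.2 (hstep i hi).1.symm)
  refine ⟨u, g 0, g 1, g 2, hu1, hg 0 (by omega), hg 1 (by omega), hg 2 (by omega),
    (hstep 0 (by omega)).1, ?_, ?_, ?_⟩
  · refine ((hstep 0 (by omega)).2).trans ?_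
    exact mul_le_mul_of_nonneg_right (by norm_num) (norm_nonneg _)
  · intro z h0 h2
    have key : ∀ i < m, 0 ≤ ⟪g (i + 1) - g i, z⟫ → -(1 / 40 * ‖z‖) ≤ ⟪u, z⟫ := by
      intro i hi h
      have hb : |⟪g (i + 1) - g i - ‖g (i + 1) - g i‖ • u, z⟫| ≤
          1 / 40 * ‖g (i + 1) - g i‖ * ‖z‖ :=
        (abs_real_inner_le_norm _ _).trans
          (mul_le_mul_of_nonneg_right (hstep i hi).2 (norm_nonneg _))
      rw [inner_sub_left, real_inner_smul_left] at hb
      have := (abs_le.1 hb).2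
      refine le_of_mul_le_mul_left ?_ (hpos i hi)
      linarith
    have key' : ∀ i < m, ⟪g (i + 1) - g i, z⟫ ≤ 0 → ⟪u, z⟫ ≤ 1 / 40 * ‖z‖ := by
      intro i hi h
      have hb : |⟪g (i + 1) - g i - ‖g (i + 1) - g i‖ • u, z⟫| ≤
          1 / 40 * ‖g (i + 1) - g i‖ * ‖z‖ :=
        (abs_real_inner_le_norm _ _).trans
          (mul_le_mul_of_nonneg_right (hstep i hi).2 (norm_nonneg _))
      rw [inner_sub_left, real_inner_smul_left] at hb
      have := (abs_le.1 hb).1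
      refine le_of_mul_le_mul_left ?_ (hpos i hi)
      linarith
    have h1 := key 1 (by omega) h2
    have h0' : ⟪g (0 + 1) - g 0, z⟫ ≤ 0 := by
      rw [← neg_sub, inner_neg_left]
      exact neg_nonpos.2 h0
    have h3 := key' 0 (by omega) h0'
    have := norm_nonneg z
    rw [abs_le]
    constructor <;> linarith
  · intro w hw
    obtain ⟨k, hk, hmin⟩ := Finset.exists_min_image (Finset.range m)
      (fun i => ‖g (i + 1) - g i‖) ⟨0, by simp [hm]⟩
    rw [Finset.mem_range] at hk
    have hw0 := norm_nonneg w
    rcases le_or_gt (80 * ‖g (k + 1) - g k‖) ‖w‖ with h | h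
    · have h1 := mul_abs_inner_le (hpos k hk) (hstep k hk).2
        (hw _ (hg k hk.le) _ (hg (k + 1) hk)).1
      refine le_of_mul_le_mul_left (h1.trans ?_) (hpos k hk)
      nlinarith [hpos k hk]
    · set T := ∑ i ∈ Finset.range m, ‖g (i + 1) - g i‖ with hT
      have hTge : 6400 * ‖g (k + 1) - g k‖ ≤ T := by
        have := Finset.card_nsmul_le_sum (Finset.range m) (fun i => ‖g (i + 1) - g i‖) _ hmin
        simpa [hmR] using this
      have hTpos : 0 < T := by linarith [hpos k hk]
      have htot : ‖(g m - g 0) - T • u‖ ≤ 1 / 40 * T := by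
        rw [← Finset.sum_range_sub g m, hT, Finset.sum_smul, ← Finset.sum_sub_distrib,
          Finset.mul_sum]
        exact norm_sum_le_of_le _ fun i hi => (hstep i (Finset.mem_range.1 hi)).2
      have h1 := mul_abs_inner_le hTpos htot (hw _ (hg 0 (by omega)) _ (hg m le_rfl)).2
      refine le_of_mul_le_mul_left (h1.trans ?_) hTpos
      nlinarith

/-- Nearly orthonormal vectors are no more numerous than the dimension. -/
theorem card_le_of_sum_abs_inner_lt {d n : ℕ} (v : Fin n → Euc d)
    (hdom : ∀ i, ∑ j ∈ Finset.univ.erase i, |⟪v i, v j⟫| < |⟪v i, v i⟫|) : n ≤ d := by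
  have hdet : (Matrix.gram ℝ v).det ≠ 0 :=
    det_ne_zero_of_sum_row_lt_diag fun i => by
      simpa [Matrix.gram_apply, Real.norm_eq_abs] using hdom i
  have hli : LinearIndependent ℝ v := by
    rw [Fintype.linearIndependent_iff]
    intro c hc
    have hmul : (Matrix.gram ℝ v).mulVec c = 0 := by
      funext i
      have : ⟪v i, ∑ j, c j • v j⟫ = 0 := by rw [hc, inner_zero_right]
      rw [inner_sum] at this
      simpa [Matrix.mulVec, dotProduct, Matrix.gram_apply, real_inner_smul_right, mul_comm]
        using this
    exact congrFun (Matrix.eq_zero_of_mulVec_eq_zero hdet hmul)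
  simpa using hli.fintype_card_le_finrank

theorem five_le_of_nearly_orthogonal {d : ℕ} {u₁ u₂ u₃ w₁ w₂ : Euc d}
    (h₁ : ‖u₁‖ = 1) (h₂ : ‖u₂‖ = 1) (h₃ : ‖u₃‖ = 1) (hw₁ : w₁ ≠ 0) (hw₂ : w₂ ≠ 0)
    (h₁₂ : |⟪u₁, u₂⟫| ≤ 1 / 10) (h₁₃ : |⟪u₁, u₃⟫| ≤ 1 / 10) (h₂₃ : |⟪u₂, u₃⟫| ≤ 1 / 10)
    (hu₁w₁ : |⟪u₁, w₁⟫| ≤ 1 / 20 * ‖w₁‖) (hu₁w₂ : |⟪u₁, w₂⟫| ≤ 1 / 20 * ‖w₂‖)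
    (hu₂w₁ : |⟪u₂, w₁⟫| ≤ 1 / 20 * ‖w₁‖) (hu₂w₂ : |⟪u₂, w₂⟫| ≤ 1 / 20 * ‖w₂‖)
    (hu₃w₁ : |⟪u₃, w₁⟫| ≤ 1 / 20 * ‖w₁‖) (hu₃w₂ : |⟪u₃, w₂⟫| ≤ 1 / 20 * ‖w₂‖)
    (hw : |⟪w₁, w₂⟫| ≤ 1 / 2 * (‖w₁‖ * ‖w₂‖)) : 5 ≤ d := by
  have hn : ∀ w : Euc d, w ≠ 0 → ‖‖w‖⁻¹ • w‖ = 1 := fun w hw0 => by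
    rw [norm_smul, norm_inv, norm_norm, inv_mul_cancel₀ (norm_ne_zero_iff.2 hw0)]
  have hs : ∀ u w : Euc d, w ≠ 0 → |⟪u, w⟫| ≤ 1 / 20 * ‖w‖ → |⟪u, ‖w‖⁻¹ • w⟫| ≤ 1 / 20 := by
    intro u w hw0 h
    have hp : 0 < ‖w‖ := norm_pos_iff.2 hw0
    rw [real_inner_smul_right, abs_mul, abs_of_pos (inv_pos.2 hp), inv_mul_le_iff₀ hp]
    linarith
  have hww : |⟪‖w₁‖⁻¹ • w₁, ‖w₂‖⁻¹ • w₂⟫| ≤ 1 / 2 := by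
    have hp₁ : 0 < ‖w₁‖ := norm_pos_iff.2 hw₁
    have hp₂ : 0 < ‖w₂‖ := norm_pos_iff.2 hw₂
    rw [real_inner_smul_right, real_inner_smul_left, abs_mul, abs_mul,
      abs_of_pos (inv_pos.2 hp₁), abs_of_pos (inv_pos.2 hp₂), inv_mul_le_iff₀ hp₂,
      inv_mul_le_iff₀ hp₁]
    linarith
  have e₁ := hn _ hw₁
  have e₂ := hn _ hw₂
  have a₁ := hs _ _ hw₁ hu₁w₁
  have a₂ := hs _ _ hw₁ hu₂w₁
  have a₃ := hs _ _ hw₁ hu₃w₁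
  have b₁ := hs _ _ hw₂ hu₁w₂
  have b₂ := hs _ _ hw₂ hu₂w₂
  have b₃ := hs _ _ hw₂ hu₃w₂
  generalize ‖w₁‖⁻¹ • w₁ = x at *
  generalize ‖w₂‖⁻¹ • w₂ = y at *
  refine card_le_of_sum_abs_inner_lt ![u₁, u₂, u₃, x, y] fun i => ?_
  have hsum : ∀ f : Fin 5 → ℝ,
      ∑ j ∈ Finset.univ.erase i, f j = f 0 + f 1 + f 2 + f 3 + f 4 - f i := fun f => by
    have := Finset.sum_erase_add Finset.univ f (Finset.mem_univ i)
    rw [Fin.sum_univ_five] at this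
    linarith
  rw [hsum]
  fin_cases i <;>
    simp [h₁, h₂, h₃, e₁, e₂] <;>
    simp only [real_inner_comm u₁ u₂, real_inner_comm u₁ u₃, real_inner_comm u₂ u₃,
      real_inner_comm u₁ x, real_inner_comm u₂ x, real_inner_comm u₃ x,
      real_inner_comm u₁ y, real_inner_comm u₂ y, real_inner_comm u₃ y, real_inner_comm x y] at * <;>
    linarith

theorem abs_inner_sub_le_norm_sq {d : ℕ} {p q x y : Euc d}
    (hx : 0 ≤ ⟪q - p, x - p⟫) (hx' : 0 ≤ ⟪p - q, x - q⟫)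
    (hy : 0 ≤ ⟪q - p, y - p⟫) (hy' : 0 ≤ ⟪p - q, y - q⟫) :
    |⟪q - p, y - x⟫| ≤ ‖q - p‖ ^ 2 := by
  have key : ∀ z, ⟪p - q, z - q⟫ = ‖q - p‖ ^ 2 - ⟪q - p, z - p⟫ := fun z => by
    rw [← real_inner_self_eq_norm_sq, ← inner_sub_right, ← neg_sub q p, inner_neg_left,
      ← inner_neg_right]
    congr 1
    abel
  have h : ⟪q - p, y - x⟫ = ⟪q - p, y - p⟫ - ⟪q - p, x - p⟫ := by
    rw [← inner_sub_right, sub_sub_sub_cancel_right]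
  rw [key] at hx' hy'
  rw [h, abs_le]
  constructor <;> linarith

theorem abs_inner_le_half_of_longest {d : ℕ} {w₁ w₂ : Euc d} (h : 0 ≤ ⟪w₁, w₂⟫)
    (h₁ : ‖w₁‖ ≤ ‖w₁ - w₂‖) (h₂ : ‖w₂‖ ≤ ‖w₁ - w₂‖) :
    |⟪w₁, w₂⟫| ≤ 1 / 2 * (‖w₁‖ * ‖w₂‖) := by
  have := norm_sub_sq_real w₁ w₂
  rw [abs_of_nonneg h]
  rcases le_total ‖w₁‖ ‖w₂‖ with hle | hle <;>
    nlinarith [norm_nonneg w₁, norm_nonneg w₂]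

theorem exists_longest_side {d : ℕ} (b : Fin 3 → Euc d) :
    ∃ i j k : Fin 3, j ≠ i ∧ k ≠ i ∧ j ≠ k ∧
      ‖b j - b i‖ ≤ ‖b j - b k‖ ∧ ‖b k - b i‖ ≤ ‖b j - b k‖ := by
  have e₁ := norm_sub_rev (b 1) (b 0)
  have e₂ := norm_sub_rev (b 2) (b 0)
  have e₃ := norm_sub_rev (b 2) (b 1)
  rcases le_total ‖b 0 - b 1‖ ‖b 0 - b 2‖ with h₁ | h₁ <;>
  rcases le_total ‖b 0 - b 2‖ ‖b 1 - b 2‖ with h₂ | h₂ <;>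
  rcases le_total ‖b 0 - b 1‖ ‖b 1 - b 2‖ with h₃ | h₃ <;>
  first
  | exact ⟨0, 1, 2, by decide, by decide, by decide, by linarith, by linarith⟩
  | exact ⟨1, 0, 2, by decide, by decide, by decide, by linarith, by linarith⟩
  | exact ⟨2, 0, 1, by decide, by decide, by decide, by linarith, by linarith⟩

theorem five_le_of_containsDNMultipartite_three {d : ℕ}
    (h : ∀ r, ContainsDNMultipartite d 3 r) : 5 ≤ d := by
  obtain ⟨r, hr⟩ := exists_nearly_collinear d
  obtain ⟨V, P, hsub, hcard, -, hDN⟩ := h r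
  choose u a b c hu ha hb hc hab hdir hmid htame using fun i => hr (P i) (hcard i)
  have hfst : ∀ i j, i ≠ j → ∀ p ∈ P i, ∀ q ∈ P j, ∀ x ∈ V, 0 ≤ ⟪x - p, q - p⟫ :=
    fun i j hij p hp q hq x hx => ((hDN i j hij p hp q hq).2.2.2 x hx).1
  have hfst' : ∀ i j, i ≠ j → ∀ p ∈ P i, ∀ q ∈ P j, ∀ x ∈ V, 0 ≤ ⟪q - p, x - p⟫ :=
    fun i j hij p hp q hq x hx => real_inner_comm (q - p) (x - p) ▸ hfst i j hij p hp q hq x hx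
  have hdiff : ∀ i j k, i ≠ j → i ≠ k → ∀ p ∈ P i, ∀ p' ∈ P i, ∀ x ∈ P j, ∀ y ∈ P k,
      |⟪p' - p, y - x⟫| ≤ ‖p' - p‖ ^ 2 := by
    intro i j k hij hik p hp p' hp' x hx y hy
    exact abs_inner_sub_le_norm_sq (hfst i j hij p hp x hx p' (hsub i hp'))
      (hfst i j hij p' hp' x hx p (hsub i hp)) (hfst i k hik p hp y hy p' (hsub i hp'))
      (hfst i k hik p' hp' y hy p (hsub i hp))
  have hcross : ∀ i j, i ≠ j → |⟪u i, u j⟫| ≤ 1 / 10 := by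
    intro i j hij
    have hp : 0 < ‖b j - a j‖ := norm_pos_iff.2 (sub_ne_zero.2 (hab j).symm)
    have h1 : |⟪u i, b j - a j⟫| ≤ 1 / 20 * ‖b j - a j‖ := by
      refine htame i _ fun p hp p' hp' => ⟨hdiff i j j hij hij p hp p' hp' _ (ha j) _ (hb j), ?_⟩
      rw [real_inner_comm]
      exact hdiff j i i hij.symm hij.symm _ (ha j) _ (hb j) p hp p' hp'
    have h2 := mul_abs_inner_le (w := u i) hp (hdir j) (real_inner_comm (b j - a j) (u i) ▸ h1)
    rw [real_inner_comm, hu i] at h2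
    refine le_of_mul_le_mul_left (h2.trans ?_) hp
    linarith
  have hnear : ∀ i j, i ≠ j → |⟪u i, b j - b i⟫| ≤ 1 / 20 * ‖b j - b i‖ := fun i j hij =>
    hmid i _ (hfst i j hij _ (hb i) _ (hb j) _ (hsub i (ha i)))
      (hfst i j hij _ (hb i) _ (hb j) _ (hsub i (hc i)))
  have hside : ∀ i j k, j ≠ k → |⟪u i, b j - b k⟫| ≤ 1 / 20 * ‖b j - b k‖ := by
    intro i j k hjk
    rcases eq_or_ne i k with rfl | hik
    · exact hnear i j hjk.symm
    rcases eq_or_ne i j with rfl | hij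
    · rw [← neg_sub, inner_neg_right, abs_neg, norm_neg]
      exact hnear i k hik
    refine htame i _ fun p hp p' hp' => ⟨hdiff i k j hik hij p hp p' hp' _ (hb k) _ (hb j), ?_⟩
    rw [real_inner_comm]
    exact abs_inner_sub_le_norm_sq (hfst' k j hjk.symm _ (hb k) _ (hb j) _ (hsub i hp))
      (hfst' j k hjk _ (hb j) _ (hb k) _ (hsub i hp))
      (hfst' k j hjk.symm _ (hb k) _ (hb j) _ (hsub i hp'))
      (hfst' j k hjk _ (hb j) _ (hb k) _ (hsub i hp'))
  have hbne : ∀ i j, i ≠ j → b i - b j ≠ 0 := fun i j hij =>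
    sub_ne_zero.2 (hDN i j hij _ (hb i) _ (hb j)).1
  obtain ⟨i, j, k, hji, hki, hjk, h₁, h₂⟩ := exists_longest_side b
  rw [← sub_sub_sub_cancel_right (b j) (b k) (b i)] at h₁ h₂
  exact five_le_of_nearly_orthogonal (hu i) (hu j) (hu k) (hbne j i hji) (hbne k i hki)
    (hcross i j hji.symm) (hcross i k hki.symm) (hcross j k hjk)
    (hside i j i hji) (hside i k i hki) (hside j j i hji) (hside j k i hki)
    (hside k j i hji) (hside k k i hki)
    (abs_inner_le_half_of_longest (hfst i k hki.symm _ (hb i) _ (hb k) _ (hsub j (hb j))) h₁ h₂)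

/-- Points on two short arcs of unit circles in orthogonal planes. -/
theorem containsStrictDNMultipartite_two (r : ℕ) : ContainsStrictDNMultipartite 4 2 r := by
  classical
  let θ : ℕ → ℝ := fun n => 1 / ((n : ℝ) + 1)
  let f : Fin 2 → ℕ → Euc 4 :=
    ![fun n => !₂[Real.cos (θ n), Real.sin (θ n), 0, 0],
      fun n => !₂[0, 0, Real.cos (θ n), Real.sin (θ n)]]
  have hθ : ∀ n, 0 ≤ θ n ∧ θ n ≤ 1 := fun n => by
    have : (0 : ℝ) ≤ n := n.cast_nonneg
    refine ⟨by positivity, ?_⟩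
    rw [div_le_one (by positivity)]
    linarith
  have hθinj : Function.Injective θ := fun m n hmn => by
    have : (m : ℝ) + 1 = n + 1 := by simpa [θ] using hmn
    exact_mod_cast add_right_cancel this
  have hsame : ∀ i m n, ⟪f i m, f i n⟫ = Real.cos (θ m - θ n) := by
    intro i m n
    rw [Real.cos_sub]
    fin_cases i <;> simp [f, PiLp.inner_apply, Fin.sum_univ_four] <;> ring
  have hdiff : ∀ i j m n, i ≠ j → ⟪f i m, f j n⟫ = 0 := by
    intro i j m n hij
    fin_cases i <;> fin_cases j <;>
      first
      | exact absurd rfl hij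
      | simp [f, PiLp.inner_apply, Fin.sum_univ_four]
  have hself : ∀ i m, ⟪f i m, f i m⟫ = 1 := fun i m => by rw [hsame, sub_self, Real.cos_zero]
  have hcos_pos : ∀ m n, 0 < Real.cos (θ m - θ n) := fun m n =>
    Real.cos_pos_of_mem_Ioo ⟨by linarith [hθ m, hθ n, Real.pi_gt_three],
      by linarith [hθ m, hθ n, Real.pi_gt_three]⟩
  have hcos_lt : ∀ m n, m ≠ n → Real.cos (θ m - θ n) < 1 := fun m n hmn => by
    refine lt_of_le_of_ne (Real.cos_le_one _) fun h => hmn (hθinj ?_)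
    rw [Real.cos_eq_one_iff_of_lt_of_lt (by linarith [hθ m, hθ n, Real.pi_gt_three])
      (by linarith [hθ m, hθ n, Real.pi_gt_three])] at h
    linarith
  have hfne : ∀ i j m n, i ≠ j → f i m ≠ f j n := fun i j m n hij h => by
    have h1 := hdiff i j m n hij
    rw [← h, hself] at h1
    exact one_ne_zero h1
  have hfinj : ∀ i, Function.Injective (f i) := fun i m n h => by
    by_contra hmn
    have h1 := hcos_lt m n hmn
    rw [← hsame i, h, hself] at h1
    exact lt_irrefl _ h1
  have hmain : ∀ i j m n, i ≠ j → ∀ k l, f k l ≠ f i m → f k l ≠ f j n →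
      0 < ⟪f k l - f i m, f j n - f i m⟫ := by
    intro i j m n hij k l h1 h2
    rw [inner_sub_left, inner_sub_right, inner_sub_right, hself, hdiff i j m n hij]
    rcases eq_or_ne k i with rfl | hki
    · rw [hdiff k j l n hij, hsame]
      have := hcos_lt l m fun h => h1 (by rw [h])
      linarith
    · have hkj : k = j := by omega
      subst hkj
      rw [hsame, hdiff k i l m hki]
      have := hcos_pos l n
      linarith
  refine ⟨Finset.univ.biUnion fun i => (Finset.range r).image (f i),
    fun i => (Finset.range r).image (f i),
    fun i => Finset.subset_biUnion_of_mem (fun i => (Finset.range r).image (f i))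
      (Finset.mem_univ i),
    fun i => by rw [Finset.card_image_of_injective _ (hfinj i), Finset.card_range], ?_, ?_⟩
  · intro i j hij
    rw [Finset.disjoint_left]
    intro p hp hq
    obtain ⟨m, -, rfl⟩ := Finset.mem_image.1 hp
    obtain ⟨n, -, h⟩ := Finset.mem_image.1 hq
    exact hfne i j m n hij h.symm
  · intro i j hij p hp q hq
    have hpV := Finset.subset_biUnion_of_mem (fun i => (Finset.range r).image (f i))
      (Finset.mem_univ i) hp
    have hqV := Finset.subset_biUnion_of_mem (fun i => (Finset.range r).image (f i))
      (Finset.mem_univ j) hq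
    obtain ⟨m, -, rfl⟩ := Finset.mem_image.1 hp
    obtain ⟨n, -, rfl⟩ := Finset.mem_image.1 hq
    refine ⟨hfne i j m n hij, hpV, hqV, fun x hx h1 h2 => ?_⟩
    obtain ⟨k, -, hk⟩ := Finset.mem_biUnion.1 hx
    obtain ⟨l, -, rfl⟩ := Finset.mem_image.1 hk
    exact ⟨hmain i j m n hij k l h1 h2, hmain j i n m hij.symm k l h2 h1⟩

theorem stmt3 :
    (∀ r : ℕ, ContainsStrictDNMultipartite 4 2 r) ∧
    (∃ r : ℕ, ¬ ContainsDNMultipartite 4 3 r) := by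
  refine ⟨containsStrictDNMultipartite_two, ?_⟩
  by_contra! h
  exact absurd (five_le_of_containsDNMultipartite_three h) (by norm_num)
end

section
/- k'(5) = k(5) = 3; concretely: (i) for every r ∈ ℕ there exists a finite set V of points in Euclidean space ℝ⁵ containing three pairwise disjoint subsets of cardinality r such that any two points lying in different subsets form a strict double-normal pair of V; and (ii) there exists r ∈ ℕ such that no finite set V of points in ℝ⁵ contains four pairwise disjoint subsets of cardinality r with any two points lying in different subsets forming a double-normal pair of V. -/
open scoped RealInnerProductSpace

section Construction

/-- The point at parameter `t` on an arc near the `i`-th vertex of an equilateral triangle, each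
arc bending into a direction of its own. -/
noncomputable def arcPoint (i : Fin 3) (t : ℝ) : Euc 5 :=
  ![!₂[1 - t ^ 2 / 3, 0, t, 0, 0],
    !₂[-(1 - t ^ 2 / 3) / 2, √3 / 2 * (1 - t ^ 2 / 3), 0, t, 0],
    !₂[-(1 - t ^ 2 / 3) / 2, -(√3 / 2 * (1 - t ^ 2 / 3)), 0, 0, t]] i

theorem inner_arcPoint_self (i : Fin 3) (t s : ℝ) :
    ⟪arcPoint i t, arcPoint i s⟫ = (1 - t ^ 2 / 3) * (1 - s ^ 2 / 3) + t * s := by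
  have h3 : √3 ^ 2 = 3 := Real.sq_sqrt (by norm_num)
  fin_cases i <;> simp [arcPoint, PiLp.inner_apply, Fin.sum_univ_succ] <;> ring_nf <;>
    simp only [h3] <;> ring

theorem inner_arcPoint_of_ne {i j : Fin 3} (hij : i ≠ j) (t s : ℝ) :
    ⟪arcPoint i t, arcPoint j s⟫ = -((1 - t ^ 2 / 3) * (1 - s ^ 2 / 3)) / 2 := by
  have h3 : √3 ^ 2 = 3 := Real.sq_sqrt (by norm_num)
  fin_cases i <;> fin_cases j <;> first
    | exact absurd rfl hij
    | (simp [arcPoint, PiLp.inner_apply, Fin.sum_univ_succ]; ring_nf; try (simp only [h3]; ring))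

theorem inner_arcPoint_sub_pos {i j k : Fin 3} (hij : i ≠ j) {t s u δ B : ℝ}
    (hB : B ≤ 1 / 4) (hδ : B ^ 3 ≤ δ) (ht : 0 ≤ t) (htB : t ≤ B) (hs : 0 ≤ s) (hsB : s ≤ B)
    (hu : 0 ≤ u) (huB : u ≤ B) (hδ0 : 0 < δ) (hut : k = i → δ ≤ |u - t|) :
    0 < ⟪arcPoint k u - arcPoint i t, arcPoint j s - arcPoint i t⟫ := by
  have hB0 : 0 ≤ B := ht.trans htB
  have ht2 : t ^ 2 ≤ B ^ 2 := by gcongr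
  have hs2 : s ^ 2 ≤ B ^ 2 := by gcongr
  have hu2 : u ^ 2 ≤ B ^ 2 := by gcongr
  have hB2 : B ^ 2 ≤ 1 / 16 := by nlinarith
  simp only [inner_sub_left, inner_sub_right]
  obtain ⟨α, hα⟩ : ∃ α, α = 1 - t ^ 2 / 3 := ⟨_, rfl⟩
  obtain ⟨β, hβ⟩ : ∃ β, β = 1 - s ^ 2 / 3 := ⟨_, rfl⟩
  obtain ⟨γ, hγ⟩ : ∃ γ, γ = 1 - u ^ 2 / 3 := ⟨_, rfl⟩
  have hα0 : 47 / 48 ≤ α := by linarith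
  have hα1 : α ≤ 1 := by linarith [sq_nonneg t]
  have hβ0 : 47 / 48 ≤ β := by linarith
  have hβ1 : β ≤ 1 := by linarith [sq_nonneg s]
  have hγ0 : 47 / 48 ≤ γ := by linarith
  have hγ1 : γ ≤ 1 := by linarith [sq_nonneg u]
  by_cases hki : k = i
  · subst hki
    have hd := hut rfl
    rw [inner_arcPoint_of_ne hij, inner_arcPoint_of_ne hij, inner_arcPoint_self,
      inner_arcPoint_self]
    have key : (u + t) * (t ^ 2 + s ^ 2 / 2) / 9 ≤ δ / 3 := by
      have h1 : (u + t) * (t ^ 2 + s ^ 2 / 2) ≤ (B + B) * (B ^ 2 + B ^ 2 / 2) := by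
        gcongr
      nlinarith
    have hk0 : 0 ≤ (u + t) * (t ^ 2 + s ^ 2 / 2) / 9 := by positivity
    have hsq : |u - t| ^ 2 = (u - t) ^ 2 := sq_abs _
    have hlow : -(|u - t| * (δ / 3)) ≤ -((u - t) * ((u + t) * (t ^ 2 + s ^ 2 / 2) / 9)) := by
      have := mul_le_mul (le_abs_self (u - t)) key hk0 (abs_nonneg _)
      linarith
    have hpos : 0 < |u - t| := hδ0.trans_le hd
    have : 0 < (u - t) ^ 2 / 2 - (u - t) * ((u + t) * (t ^ 2 + s ^ 2 / 2) / 9) := by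
      nlinarith [mul_le_mul_of_nonneg_left hd hpos.le, mul_pos hpos hδ0]
    convert this using 1
    ring
  · by_cases hkj : k = j
    · subst hkj
      rw [inner_arcPoint_of_ne hki, inner_arcPoint_of_ne hij, inner_arcPoint_self,
        inner_arcPoint_self, ← hα, ← hβ, ← hγ]
      nlinarith [mul_nonneg hu hs, sq_nonneg t]
    · rw [inner_arcPoint_of_ne hki, inner_arcPoint_of_ne hij, inner_arcPoint_of_ne hkj,
        inner_arcPoint_self, ← hα, ← hβ, ← hγ]
      nlinarith [sq_nonneg t]

theorem containsStrictDNMultipartite_five_three (r : ℕ) : ContainsStrictDNMultipartite 5 3 r := by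
  classical
  obtain ⟨δ, hδ⟩ : ∃ δ : ℝ, δ = 1 / ((r : ℝ) + 1) ^ 2 := ⟨_, rfl⟩
  have hδ0 : 0 < δ := by rw [hδ]; positivity
  have hr : (0 : ℝ) ≤ r := r.cast_nonneg
  have hB : (r : ℝ) * δ ≤ 1 / 4 := by
    rw [hδ, mul_one_div, div_le_div_iff₀ (by positivity) (by norm_num)]
    nlinarith [sq_nonneg ((r : ℝ) - 1)]
  have hB3 : ((r : ℝ) * δ) ^ 3 ≤ δ := by
    have h1 : (r : ℝ) ^ 2 * δ ≤ 1 := by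
      rw [hδ, mul_one_div, div_le_one (by positivity)]
      nlinarith
    have h2 : ((r : ℝ) * δ) ^ 3 = δ * (r ^ 2 * δ) * (r * δ) := by ring
    rw [h2]
    have h3 : 0 ≤ δ * (r ^ 2 * δ) := by positivity
    nlinarith
  have hmem : ∀ m ∈ Finset.range r, 0 ≤ (m : ℝ) * δ ∧ (m : ℝ) * δ ≤ r * δ := by
    intro m hm
    have : (m : ℝ) ≤ r := by exact_mod_cast (Finset.mem_range.1 hm).le
    exact ⟨by positivity, by gcongr⟩
  have hgap : ∀ m n : ℕ, m ≠ n → δ ≤ |(m : ℝ) * δ - n * δ| := by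
    intro m n hmn
    have h1 : (1 : ℝ) ≤ |(m : ℝ) - n| := by
      have : (1 : ℤ) ≤ |(m : ℤ) - n| := Int.one_le_abs (by omega)
      exact_mod_cast this
    rw [← sub_mul, abs_mul, abs_of_pos hδ0]
    nlinarith
  have hpos : ∀ (i j k : Fin 3), i ≠ j → ∀ m ∈ Finset.range r, ∀ n ∈ Finset.range r,
      ∀ l ∈ Finset.range r, (k = i → l ≠ m) →
      0 < ⟪arcPoint k (l * δ) - arcPoint i (m * δ), arcPoint j (n * δ) - arcPoint i (m * δ)⟫ := by
    intro i j k hij m hm n hn l hl h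
    exact inner_arcPoint_sub_pos hij hB hB3 (hmem m hm).1 (hmem m hm).2 (hmem n hn).1
      (hmem n hn).2 (hmem l hl).1 (hmem l hl).2 hδ0 fun hk => hgap l m (h hk)
  have hne : ∀ (i j : Fin 3), i ≠ j → ∀ m ∈ Finset.range r, ∀ n ∈ Finset.range r,
      arcPoint i (m * δ) ≠ arcPoint j (n * δ) := by
    intro i j hij m hm n hn h
    have := hpos i j j hij m hm n hn n hn fun h' => absurd h'.symm hij
    rw [h, sub_self, inner_zero_left] at this
    exact lt_irrefl _ this
  let P : Fin 3 → Finset (Euc 5) := fun i => (Finset.range r).image fun m : ℕ => arcPoint i (m * δ)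
  refine ⟨Finset.univ.biUnion P, P, fun i => Finset.subset_biUnion_of_mem P (Finset.mem_univ i),
    fun i => ?_, fun i j hij => ?_, fun i j hij p hp q hq => ?_⟩
  · rw [Finset.card_image_of_injOn, Finset.card_range]
    intro m hm n hn hmn
    by_contra hne'
    have := hpos i (i + 1) i (by fin_cases i <;> decide) m hm m hm n hn fun _ => Ne.symm hne'
    rw [show arcPoint i (n * δ) = arcPoint i (m * δ) from hmn.symm, sub_self,
      inner_zero_left] at this
    exact lt_irrefl _ this
  · rw [Finset.disjoint_left]
    intro x hx hy
    obtain ⟨m, hm, rfl⟩ := Finset.mem_image.1 hx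
    obtain ⟨n, hn, h⟩ := Finset.mem_image.1 hy
    exact hne i j hij m hm n hn h.symm
  · refine ⟨?_, Finset.mem_biUnion.2 ⟨i, Finset.mem_univ i, hp⟩,
      Finset.mem_biUnion.2 ⟨j, Finset.mem_univ j, hq⟩, fun x hx hxp hxq => ?_⟩
    · obtain ⟨m, hm, rfl⟩ := Finset.mem_image.1 hp
      obtain ⟨n, hn, rfl⟩ := Finset.mem_image.1 hq
      exact hne i j hij m hm n hn
    · obtain ⟨m, hm, rfl⟩ := Finset.mem_image.1 hp
      obtain ⟨n, hn, rfl⟩ := Finset.mem_image.1 hq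
      obtain ⟨k, -, hk⟩ := Finset.mem_biUnion.1 hx
      obtain ⟨l, hl, rfl⟩ := Finset.mem_image.1 hk
      refine ⟨hpos i j k hij m hm n hn l hl ?_, hpos j i k hij.symm n hn m hm l hl ?_⟩
      · rintro rfl rfl
        exact hxp rfl
      · rintro rfl rfl
        exact hxq rfl

end Construction

section Separation

variable {E : Type*} [NormedAddCommGroup E] [InnerProductSpace ℝ E]

/-- Vectors whose pairwise cosines are dominated by a matrix with small off-diagonal row sums
number at most the dimension. -/
theorem card_le_finrank_of_sum_cos_lt_one [FiniteDimensional ℝ E] {ι : Type*} [Fintype ι]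
    [DecidableEq ι] (w : ι → E) (c : ι → ι → ℝ) (hw : ∀ i, w i ≠ 0)
    (hc : ∀ i j, i ≠ j → |⟪w i, w j⟫| ≤ c i j * (‖w i‖ * ‖w j‖))
    (hsum : ∀ i, ∑ j ∈ Finset.univ.erase i, c i j < 1) :
    Fintype.card ι ≤ Module.finrank ℝ E := by
  set v : ι → E := fun i => ‖w i‖⁻¹ • w i with hv
  have hpos : ∀ i, 0 < ‖w i‖ := fun i => norm_pos_iff.2 (hw i)
  have hvij : ∀ i j, ⟪v i, v j⟫ = ⟪w i, w j⟫ / (‖w i‖ * ‖w j‖) := by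
    intro i j
    simp only [hv, real_inner_smul_left, real_inner_smul_right]
    field_simp
  have hdet : (Matrix.of fun i j => ⟪v i, v j⟫).det ≠ 0 := by
    apply det_ne_zero_of_sum_row_lt_diag
    intro i
    have hii : ⟪v i, v i⟫ = 1 := by
      rw [hvij, real_inner_self_eq_norm_mul_norm]
      exact div_self (mul_pos (hpos i) (hpos i)).ne'
    simp only [Matrix.of_apply, hii, norm_one]
    refine lt_of_le_of_lt (Finset.sum_le_sum fun j hj => ?_) (hsum i)
    have hp := mul_pos (hpos i) (hpos j)
    rw [hvij, Real.norm_eq_abs, abs_div, abs_of_pos hp, div_le_iff₀ hp]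
    exact hc i j (Finset.ne_of_mem_erase hj).symm
  have hli : LinearIndependent ℝ v := by
    rw [Fintype.linearIndependent_iff]
    intro g hg
    have : Matrix.mulVec (Matrix.of fun i j => ⟪v i, v j⟫) g = 0 := by
      ext i
      have h0 : ⟪v i, ∑ j, g j • v j⟫ = 0 := by rw [hg, inner_zero_right]
      rw [inner_sum] at h0
      simpa [Matrix.mulVec, dotProduct, real_inner_smul_right, mul_comm] using h0
    exact fun i => congrFun (Matrix.eq_zero_of_mulVec_eq_zero hdet this) i
  exact hli.fintype_card_le_finrank

/-- The real numbers `s` and `t` differ by a factor of at least `c`. -/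
def ScaleSeparated (c s t : ℝ) : Prop := c * s ≤ t ∨ c * t ≤ s

theorem abs_inner_le_of_scaleSeparated {c : ℝ} (hc : 0 < c) {x y : E}
    (hx : |⟪x, y⟫| ≤ ‖x‖ ^ 2) (hy : |⟪x, y⟫| ≤ ‖y‖ ^ 2)
    (h : ScaleSeparated c ‖x‖ ‖y‖) : |⟪x, y⟫| ≤ c⁻¹ * (‖x‖ * ‖y‖) := by
  rw [inv_mul_eq_div, le_div_iff₀ hc]
  rcases h with h | h
  · nlinarith [norm_nonneg x, mul_le_mul_of_nonneg_right hx hc.le,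
      mul_le_mul_of_nonneg_left h (norm_nonneg x)]
  · nlinarith [norm_nonneg y, mul_le_mul_of_nonneg_right hy hc.le,
      mul_le_mul_of_nonneg_left h (norm_nonneg y)]

/-- A positive proportion of any finite set is clustered, relative to its diameter. -/
theorem exists_cluster [FiniteDimensional ℝ E] {ε : ℝ} (hε : 0 < ε) :
    ∃ C : ℕ, ∀ (S : Finset E) (D : ℝ) (n : ℕ), 0 < D → (∀ x ∈ S, ∀ y ∈ S, ‖x - y‖ ≤ D) →
      C * n < S.card →
      ∃ T ⊆ S, n < T.card ∧ ∀ x ∈ T, ∀ y ∈ T, ‖x - y‖ ≤ ε * D := by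
  classical
  obtain ⟨t, -, ht⟩ := (isCompact_closedBall (0 : E) 1).elim_nhds_subcover
    (fun x => Metric.ball x (ε / 2)) (fun x _ => Metric.ball_mem_nhds x (by positivity))
  refine ⟨t.card, fun S D n hD hS hn => ?_⟩
  obtain ⟨x₀, hx₀⟩ : S.Nonempty := Finset.card_pos.1 (by omega)
  have hcov : ∀ x ∈ S, ∃ c ∈ t, ‖D⁻¹ • (x - x₀) - c‖ < ε / 2 := by
    intro x hx
    have hmem : D⁻¹ • (x - x₀) ∈ Metric.closedBall (0 : E) 1 := by
      rw [mem_closedBall_zero_iff, norm_smul, norm_inv, Real.norm_of_nonneg hD.le,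
        inv_mul_le_iff₀ hD, mul_one]
      exact hS x hx x₀ hx₀
    obtain ⟨c, hc, hxc⟩ := Set.mem_iUnion₂.1 (ht hmem)
    exact ⟨c, hc, by simpa [dist_eq_norm] using hxc⟩
  choose! f hft hf using hcov
  obtain ⟨c, -, hcard⟩ := Finset.exists_lt_card_fiber_of_mul_lt_card_of_maps_to hft hn
  refine ⟨_, Finset.filter_subset _ _, hcard, fun x hx y hy => ?_⟩
  rw [Finset.mem_filter] at hx hy
  have h1 := hf x hx.1
  have h2 := hf y hy.1
  rw [hx.2] at h1
  rw [hy.2] at h2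
  have h3 : ‖D⁻¹ • (x - y)‖ ≤ ε := by
    have : D⁻¹ • (x - y) = (D⁻¹ • (x - x₀) - c) - (D⁻¹ • (y - x₀) - c) := by
      simp only [smul_sub]; abel
    rw [this]
    linarith [norm_sub_le (D⁻¹ • (x - x₀) - c) (D⁻¹ • (y - x₀) - c)]
  rw [norm_smul, norm_inv, Real.norm_of_nonneg hD.le, inv_mul_le_iff₀ hD] at h3
  linarith

/-- A large finite set has a point seeing many other points at pairwise separated distances. -/
theorem exists_scaleSeparated_star [FiniteDimensional ℝ E] {c : ℝ} (hc : 0 < c) (m : ℕ) :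
    ∃ N : ℕ, ∀ S : Finset E, N ≤ S.card → ∃ p ∈ S, ∃ X ⊆ S, X.card = m ∧ p ∉ X ∧
      ∀ x ∈ X, ∀ y ∈ X, x ≠ y → ScaleSeparated c ‖x - p‖ ‖y - p‖ := by
  classical
  induction m with
  | zero =>
    refine ⟨1, fun S hS => ?_⟩
    obtain ⟨p, hp⟩ := Finset.card_pos.1 (by omega : 0 < S.card)
    exact ⟨p, hp, ∅, by simp⟩
  | succ m ih =>
    obtain ⟨N, hN⟩ := ih
    obtain ⟨C, hC⟩ := exists_cluster (E := E) (ε := min (1 / 4) ((2 * c)⁻¹)) (by positivity)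
    refine ⟨C * N + 2, fun S hS => ?_⟩
    have hne : S.Nonempty := Finset.card_pos.1 (by omega)
    obtain ⟨⟨a, b⟩, hab, hmax⟩ :=
      (S ×ˢ S).exists_max_image (fun z => ‖z.1 - z.2‖) (hne.product hne)
    rw [Finset.mem_product] at hab
    have hle : ∀ x ∈ S, ∀ y ∈ S, ‖x - y‖ ≤ ‖a - b‖ := fun x hx y hy =>
      hmax (x, y) (Finset.mem_product.2 ⟨hx, hy⟩)
    obtain ⟨x, hx, y, hy, hxy⟩ := Finset.one_lt_card.1 (by omega : 1 < S.card)
    have hD : 0 < ‖a - b‖ := (norm_pos_iff.2 (sub_ne_zero.2 hxy)).trans_le (hle x hx y hy)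
    obtain ⟨T, hTS, hTcard, hT⟩ := hC S ‖a - b‖ N hD hle (by omega)
    obtain ⟨p, hp, X, hXT, hX, hpX, hsep⟩ := hN T hTcard.le
    obtain ⟨z, hz, hzp⟩ : ∃ z ∈ S, ‖a - b‖ / 2 ≤ ‖z - p‖ := by
      by_contra! h
      have h1 := h a hab.1
      have h2 := h b hab.2
      have h3 := norm_sub_le (a - p) (b - p)
      rw [sub_sub_sub_cancel_right] at h3
      linarith
    have hsmall : ∀ x ∈ T, ‖x - p‖ ≤ ‖a - b‖ / 4 ∧ c * ‖x - p‖ ≤ ‖z - p‖ := by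
      intro x hx
      have h1 := hT x hx p hp
      have h2 := mul_le_mul_of_nonneg_right (min_le_left (1 / 4) ((2 * c)⁻¹)) hD.le
      have h3 := mul_le_mul_of_nonneg_right (min_le_right (1 / 4) ((2 * c)⁻¹)) hD.le
      refine ⟨by linarith, ?_⟩
      have h4 := mul_le_mul_of_nonneg_left (h1.trans h3) hc.le
      have h5 : c * ((2 * c)⁻¹ * ‖a - b‖) = ‖a - b‖ / 2 := by field_simp
      linarith
    have hzT : z ∉ T := fun h => by linarith [(hsmall z h).1]
    refine ⟨p, hTS hp, insert z X, ?_, ?_, ?_, ?_⟩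
    · exact Finset.insert_subset hz (hXT.trans hTS)
    · rw [Finset.card_insert_of_notMem fun h => hzT (hXT h), hX]
    · rw [Finset.mem_insert, not_or]
      exact ⟨fun h => hzT (h ▸ hp), hpX⟩
    · intro x hx y hy hxy
      rcases Finset.mem_insert.1 hx with rfl | hx' <;>
        rcases Finset.mem_insert.1 hy with rfl | hy'
      · exact absurd rfl hxy
      · exact Or.inr (hsmall y (hXT hy')).2
      · exact Or.inl (hsmall x (hXT hx')).2
      · exact hsep x hx' y hy' hxy

/-- Among sufficiently many separated scales, one is separated from all scales of a
given finite set. -/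
theorem exists_scaleSeparated_of_card_lt {α : Type*} {c : ℝ} (hc : 1 < c) (X : Finset α)
    (f : α → ℝ)
    (hX : ∀ x ∈ X, ∀ y ∈ X, x ≠ y → ScaleSeparated (c ^ 2) (f x) (f y))
    (L : Finset ℝ) (hL : L.card < X.card) :
    ∃ x ∈ X, ∀ l ∈ L, ScaleSeparated c (f x) l := by
  by_contra! h
  choose! g hgL hg using h
  obtain ⟨x, hx, y, hy, hxy, hgxy⟩ := Finset.exists_ne_map_eq_of_card_lt_of_maps_to hL hgL
  have h1 := hg x hx
  have h2 := hg y hy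
  rw [← hgxy] at h2
  simp only [ScaleSeparated, not_or, not_le] at h1 h2
  rcases hX x hx y hy hxy with h | h
  · nlinarith
  · nlinarith

end Separation

section UpperBound

/-- The pair `a, b` bounds a slab, orthogonal to `b - a`, that contains `x` and `y`. -/
theorem abs_inner_sub_le_of_slab {E : Type*} [NormedAddCommGroup E] [InnerProductSpace ℝ E]
    {a b x y : E} (hxa : 0 ≤ ⟪x - a, b - a⟫) (hxb : 0 ≤ ⟪x - b, a - b⟫)
    (hya : 0 ≤ ⟪y - a, b - a⟫) (hyb : 0 ≤ ⟪y - b, a - b⟫) :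
    |⟪x - y, b - a⟫| ≤ ‖b - a‖ ^ 2 := by
  have key : ∀ z : E, ⟪z - b, a - b⟫ = ‖b - a‖ ^ 2 - ⟪z - a, b - a⟫ := by
    intro z
    rw [← real_inner_self_eq_norm_sq, ← inner_sub_left, ← neg_sub b a, inner_neg_right,
      ← inner_neg_left]
    congr 1
    abel
  have hsub : ⟪x - y, b - a⟫ = ⟪x - a, b - a⟫ - ⟪y - a, b - a⟫ := by
    rw [← inner_sub_left, sub_sub_sub_cancel_right]
  rw [key] at hxb hyb
  rw [hsub, abs_le]
  constructor <;> linarith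

variable {V : Finset (Euc 5)} {P : Fin 4 → Finset (Euc 5)}

theorem abs_inner_sub_le_of_part (hP : ∀ i, P i ⊆ V)
    (hDN : ∀ i j, i ≠ j → ∀ p ∈ P i, ∀ q ∈ P j, IsDoubleNormalPair V p q)
    {i : Fin 4} {a b x y : Euc 5} (ha : a ∈ P i) (hb : b ∈ P i)
    (hx : x = a ∨ ∃ j, i ≠ j ∧ x ∈ P j) (hy : y = a ∨ ∃ j, i ≠ j ∧ y ∈ P j) :
    |⟪x - y, b - a⟫| ≤ ‖b - a‖ ^ 2 := by
  have key : ∀ z, (z = a ∨ ∃ j, i ≠ j ∧ z ∈ P j) →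
      0 ≤ ⟪z - a, b - a⟫ ∧ 0 ≤ ⟪z - b, a - b⟫ := by
    rintro z (rfl | ⟨j, hij, hz⟩)
    · simp only [sub_self, inner_zero_left, le_refl, true_and]
      exact real_inner_self_nonneg
    · rw [real_inner_comm, real_inner_comm (a - b)]
      exact ⟨((hDN i j hij a ha z hz).2.2.2 b (hP i hb)).1,
        ((hDN i j hij b hb z hz).2.2.2 a (hP i ha)).1⟩
  exact abs_inner_sub_le_of_slab (key x hx).1 (key x hx).2 (key y hy).1 (key y hy).2

theorem abs_inner_sub_le_of_isDoubleNormalPair {a b x y : Euc 5} (h : IsDoubleNormalPair V a b)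
    (hx : x ∈ V) (hy : y ∈ V) : |⟪x - y, b - a⟫| ≤ ‖b - a‖ ^ 2 :=
  abs_inner_sub_le_of_slab (h.2.2.2 x hx).1 (h.2.2.2 x hx).2 (h.2.2.2 y hy).1 (h.2.2.2 y hy).2

/-- The sides at the vertex of a largest angle of a triangle without obtuse angles have cosine
between `0` and `1 / 2`. -/
theorem abs_inner_le_of_longest_side {E : Type*} [NormedAddCommGroup E] [InnerProductSpace ℝ E]
    {a b c : E} (h0 : 0 ≤ ⟪b - a, c - a⟫) (hb : ‖b - a‖ ≤ ‖b - c‖) (hc : ‖c - a‖ ≤ ‖b - c‖) :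
    |⟪b - a, c - a⟫| ≤ 1 / 2 * (‖b - a‖ * ‖c - a‖) := by
  have h := norm_sub_sq_real (b - a) (c - a)
  rw [sub_sub_sub_cancel_right] at h
  rw [abs_of_nonneg h0]
  have h1 : ‖b - a‖ ^ 2 ≤ ‖b - c‖ ^ 2 := by gcongr
  have h2 : ‖c - a‖ ^ 2 ≤ ‖b - c‖ ^ 2 := by gcongr
  rcases le_total ‖b - a‖ ‖c - a‖ with h3 | h3
  · nlinarith [norm_nonneg (b - a)]
  · nlinarith [norm_nonneg (c - a)]

theorem exists_longest_side_s4 {E : Type*} [NormedAddCommGroup E] (p : Fin 4 → E) :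
    ∃ a b c : Fin 4, a ≠ b ∧ a ≠ c ∧ b ≠ c ∧
      ‖p b - p a‖ ≤ ‖p b - p c‖ ∧ ‖p c - p a‖ ≤ ‖p b - p c‖ := by
  rcases le_total ‖p 1 - p 0‖ ‖p 1 - p 2‖ with h1 | h1 <;>
  rcases le_total ‖p 2 - p 0‖ ‖p 1 - p 2‖ with h2 | h2 <;>
  rcases le_total ‖p 1 - p 0‖ ‖p 2 - p 0‖ with h3 | h3 <;> first
    | exact ⟨0, 1, 2, by decide, by decide, by decide, by linarith, by linarith⟩
    | exact ⟨1, 2, 0, by decide, by decide, by decide, by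
        rw [norm_sub_rev (p 2) (p 1)]; linarith, by rw [norm_sub_rev (p 0) (p 1)]; linarith⟩
    | exact ⟨2, 1, 0, by decide, by decide, by decide, by linarith, by
        rw [norm_sub_rev (p 0) (p 2)]; linarith⟩

/-- Each part may be given a second point at a distance separated from all the others. -/
theorem exists_second_points {E : Type*} [NormedAddCommGroup E] {c : ℝ} (hc : 1 < c)
    (p : Fin 4 → E) (X : Fin 4 → Finset E) (hX : ∀ i, (X i).card = 7)
    (hsep : ∀ i, ∀ x ∈ X i, ∀ y ∈ X i, x ≠ y → ScaleSeparated (c ^ 2) ‖x - p i‖ ‖y - p i‖)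
    (e : Fin 2 → ℝ) :
    ∃ q : Fin 4 → E, (∀ i, q i ∈ X i) ∧ (∀ i k, ScaleSeparated c ‖q i - p i‖ (e k)) ∧
      ∀ i j, i ≠ j → ScaleSeparated c ‖q i - p i‖ ‖q j - p j‖ := by
  classical
  have step : ∀ (i : Fin 4) (L : Finset ℝ), L.card < 7 →
      ∃ x ∈ X i, ∀ l ∈ L, ScaleSeparated c ‖x - p i‖ l := fun i L hL =>
    exists_scaleSeparated_of_card_lt hc (X i) (fun x => ‖x - p i‖) (hsep i) L (by rwa [hX])
  have sym : ∀ {s t : ℝ}, ScaleSeparated c s t → ScaleSeparated c t s := Or.symm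
  obtain ⟨q₀, m₀, s₀⟩ := step 0 {e 0, e 1} (Finset.card_le_two.trans_lt (by norm_num))
  obtain ⟨q₁, m₁, s₁⟩ := step 1 {e 0, e 1, ‖q₀ - p 0‖} (Finset.card_le_three.trans_lt (by norm_num))
  obtain ⟨q₂, m₂, s₂⟩ := step 2 {e 0, e 1, ‖q₀ - p 0‖, ‖q₁ - p 1‖}
    (Finset.card_le_four.trans_lt (by norm_num))
  obtain ⟨q₃, m₃, s₃⟩ := step 3 {e 0, e 1, ‖q₀ - p 0‖, ‖q₁ - p 1‖, ‖q₂ - p 2‖}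
    (Finset.card_le_five.trans_lt (by norm_num))
  simp only [Finset.mem_insert, Finset.mem_singleton, forall_eq_or_imp, forall_eq] at s₀ s₁ s₂ s₃
  refine ⟨![q₀, q₁, q₂, q₃], fun i => ?_, fun i k => ?_, fun i j hij => ?_⟩
  · fin_cases i <;> simpa
  · fin_cases i <;> fin_cases k <;> simp [s₀, s₁, s₂, s₃]
  · fin_cases i <;> fin_cases j <;> first
      | exact absurd rfl hij
      | (simp [s₁, s₂, s₃]; done)
      | (apply sym; simp [s₁, s₂, s₃])

theorem exists_not_containsDNMultipartite_five_four :
    ∃ r : ℕ, ¬ ContainsDNMultipartite 5 4 r := by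
  classical
  obtain ⟨N, hN⟩ := exists_scaleSeparated_star (E := Euc 5) (c := 10 ^ 2) (by norm_num) 7
  refine ⟨N, ?_⟩
  rintro ⟨V, P, hP, hcard, -, hDN⟩
  choose p hp X hXP hX hpX hsep using fun i => hN (P i) (hcard i).ge
  obtain ⟨a, b, c, hab, hac, hbc, hlb, hlc⟩ := exists_longest_side_s4 p
  let d : Fin 2 → Fin 4 := ![b, c]
  have had : ∀ k, a ≠ d k := by
    intro k
    fin_cases k <;> assumption
  obtain ⟨q, hqX, hqe, hqq⟩ := exists_second_points (c := 10) (by norm_num) p X hX hsep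
    fun k => ‖p (d k) - p a‖
  have hq : ∀ i, q i ∈ P i := fun i => hXP i (hqX i)
  have hpe : ∀ i j, p j = p i ∨ ∃ k, i ≠ k ∧ p j ∈ P k := by
    intro i j
    by_cases h : i = j
    · exact Or.inl (by rw [h])
    · exact Or.inr ⟨j, h, hp j⟩
  have huu : ∀ i j, i ≠ j → |⟪q i - p i, q j - p j⟫| ≤ ‖q j - p j‖ ^ 2 := fun i j hij =>
    abs_inner_sub_le_of_part hP hDN (hp j) (hq j) (Or.inr ⟨i, hij.symm, hq i⟩) (hpe j i)
  have hue : ∀ i k, |⟪q i - p i, p (d k) - p a⟫| ≤ 10⁻¹ * (‖q i - p i‖ * ‖p (d k) - p a‖) := by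
    intro i k
    refine abs_inner_le_of_scaleSeparated (by norm_num) ?_ ?_ (hqe i k)
    · rw [real_inner_comm]
      exact abs_inner_sub_le_of_part hP hDN (hp i) (hq i) (hpe i _) (hpe i a)
    · exact abs_inner_sub_le_of_isDoubleNormalPair (hDN a (d k) (had k) _ (hp a) _ (hp _))
        (hP i (hq i)) (hP i (hp i))
  have hbac : |⟪p b - p a, p c - p a⟫| ≤ 1 / 2 * (‖p b - p a‖ * ‖p c - p a‖) :=
    abs_inner_le_of_longest_side
      ((hDN a c hac _ (hp a) _ (hp c)).2.2.2 _ (hP b (hp b))).1 hlb hlc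
  have hle := card_le_finrank_of_sum_cos_lt_one
    (Sum.elim (fun i => q i - p i) fun k => p (d k) - p a)
    (Sum.elim (fun _ _ => 10⁻¹) fun _ => Sum.elim (fun _ => 10⁻¹) fun _ => 1 / 2) ?_ ?_ ?_
  · simp at hle
  · rintro (i | k)
    · exact sub_ne_zero.2 fun h => hpX i (h ▸ hqX i)
    · exact sub_ne_zero.2 (hDN a (d k) (had k) _ (hp a) _ (hp _)).1.symm
  · rintro (i | k) (j | l) hne
    · have hij : i ≠ j := fun h => hne (by rw [h])
      refine abs_inner_le_of_scaleSeparated (by norm_num) ?_ (huu i j hij) (hqq i j hij)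
      simpa only [Sum.elim_inl, real_inner_comm] using huu j i hij.symm
    · exact hue i l
    · simpa only [Sum.elim_inl, Sum.elim_inr, real_inner_comm,
        mul_comm ‖q j - p j‖] using hue j k
    · have h' := hbac
      rw [real_inner_comm, mul_comm ‖p b - p a‖] at h'
      fin_cases k <;> fin_cases l
      · exact absurd rfl hne
      · exact hbac
      · exact h'
      · exact absurd rfl hne
  · rintro (i | k) <;> rw [Finset.sum_erase_eq_sub (Finset.mem_univ _), Fintype.sum_sum_type] <;>
      norm_num

end UpperBound

theorem stmt4 :
    (∀ r : ℕ, ContainsStrictDNMultipartite 5 3 r) ∧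
    (∃ r : ℕ, ¬ ContainsDNMultipartite 5 4 r) :=
  ⟨containsStrictDNMultipartite_five_three, exists_not_containsDNMultipartite_five_four⟩
end

section
/- k'(7) = k(7) = 4; concretely: (i) for every r ∈ ℕ there exists a finite set V of points in Euclidean space ℝ⁷ containing four pairwise disjoint subsets of cardinality r such that any two points lying in different subsets form a strict double-normal pair of V; and (ii) there exists r ∈ ℕ such that no finite set V of points in ℝ⁷ contains five pairwise disjoint subsets of cardinality r with any two points lying in different subsets forming a double-normal pair of V. -/
open scoped RealInnerProductSpace

section Construction

/-- A point over the `i`-th vertex of a regular tetrahedron in the first three coordinates,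
displaced by `s` along the `i`-th of the four remaining coordinates. -/
noncomputable def tetraPoint (i : Fin 4) (s : ℝ) : Euc 7 :=
  WithLp.toLp 2
    ![(![1, 1, -1, -1] : Fin 4 → ℝ) i * (1 - s ^ 2 / 8),
      (![1, -1, 1, -1] : Fin 4 → ℝ) i * (1 - s ^ 2 / 8),
      (![1, -1, -1, 1] : Fin 4 → ℝ) i * (1 - s ^ 2 / 8),
      (![1, 0, 0, 0] : Fin 4 → ℝ) i * s, (![0, 1, 0, 0] : Fin 4 → ℝ) i * s,
      (![0, 0, 1, 0] : Fin 4 → ℝ) i * s, (![0, 0, 0, 1] : Fin 4 → ℝ) i * s]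

lemma inner_tetraPoint_same (i : Fin 4) (s t : ℝ) :
    ⟪tetraPoint i s, tetraPoint i t⟫ = 3 * (1 - s ^ 2 / 8) * (1 - t ^ 2 / 8) + s * t := by
  fin_cases i <;>
    simp [tetraPoint, PiLp.inner_apply, Fin.sum_univ_succ] <;> ring

lemma inner_tetraPoint_ne {i j : Fin 4} (h : i ≠ j) (s t : ℝ) :
    ⟪tetraPoint i s, tetraPoint j t⟫ = -((1 - s ^ 2 / 8) * (1 - t ^ 2 / 8)) := by
  fin_cases i <;> fin_cases j <;> first
    | exact absurd rfl h
    | (simp [tetraPoint, PiLp.inner_apply, Fin.sum_univ_succ]; try ring)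

lemma tetraPoint_ne {i j : Fin 4} (h : i ≠ j) {s t : ℝ} (hs : 0 < s) (hs' : s ≤ 1 / 2)
    (ht : 0 < t) (ht' : t ≤ 1 / 2) : tetraPoint i s ≠ tetraPoint j t := by
  intro he
  have h1 := inner_tetraPoint_ne h s t
  rw [← he, inner_tetraPoint_same] at h1
  have a1 : 0 < 1 - s ^ 2 / 8 := by nlinarith
  have a2 : 0 < 1 - t ^ 2 / 8 := by nlinarith
  have := mul_pos a1 a2
  have := mul_pos a1 a1
  nlinarith [sq_nonneg s]

lemma inner_tetraPoint_pos {i j l : Fin 4} (h : i ≠ j) {s t w : ℝ} (hs : 0 < s)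
    (hs' : s ≤ 1 / 2) (ht : 0 < t) (ht' : t ≤ 1 / 2) (hw : 0 < w) (hw' : w ≤ 1 / 2)
    (hsep : l = i → 2 * s ≤ w ∨ 2 * w ≤ s) :
    0 < ⟪tetraPoint l w - tetraPoint i s, tetraPoint j t - tetraPoint i s⟫ := by
  simp only [inner_sub_left, inner_sub_right]
  have s2 : s ^ 2 ≤ 1 / 4 := by nlinarith
  have t2 : t ^ 2 ≤ 1 / 4 := by nlinarith
  have w2 : w ^ 2 ≤ 1 / 4 := by nlinarith
  have s0 := sq_nonneg s
  have t0 := sq_nonneg t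
  have w0 := sq_nonneg w
  by_cases hli : l = i
  · subst hli
    rw [inner_tetraPoint_ne h, inner_tetraPoint_same, inner_tetraPoint_ne h,
      inner_tetraPoint_same]
    set A := (4 - t ^ 2 / 8 - 3 * (s ^ 2 / 8)) / 8 with hA
    have hA1 : A ≤ 1 / 2 := by rw [hA]; linarith
    have hA2 : 9 / 20 ≤ A := by rw [hA]; linarith
    have key : 0 < (s - w) * (s - A * (s + w)) := by
      rcases hsep rfl with h' | h'
      · exact mul_pos_of_neg_of_neg (by linarith) (by nlinarith)
      · exact mul_pos (by linarith) (by nlinarith)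
    rw [hA] at key
    linarith
  · by_cases hlj : l = j
    · subst hlj
      rw [inner_tetraPoint_same, inner_tetraPoint_ne hli, inner_tetraPoint_ne h,
        inner_tetraPoint_same]
      have a1 : 0 < 1 - s ^ 2 / 8 := by linarith
      have a2 : 0 < 1 - t ^ 2 / 8 := by linarith
      have a3 : 0 < 1 - w ^ 2 / 8 := by linarith
      have := mul_pos a1 a2
      have := mul_pos a3 a1
      have := mul_pos a3 a2
      have := mul_pos a1 a1
      have := mul_pos hw ht
      nlinarith
    · rw [inner_tetraPoint_ne hlj, inner_tetraPoint_ne hli, inner_tetraPoint_ne h,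
        inner_tetraPoint_same]
      have a1 : 31 / 32 ≤ 1 - s ^ 2 / 8 := by linarith
      have a2 : 31 / 32 ≤ 1 - t ^ 2 / 8 := by linarith
      have a3 : 31 / 32 ≤ 1 - w ^ 2 / 8 := by linarith
      have b2 : 1 - t ^ 2 / 8 ≤ 1 := by linarith
      have b3 : 1 - w ^ 2 / 8 ≤ 1 := by linarith
      have c1 : (1 - w ^ 2 / 8) * (1 - t ^ 2 / 8) ≤ 1 := by nlinarith
      have c2 : 0 ≤ (1 - w ^ 2 / 8) * (1 - s ^ 2 / 8) := by nlinarith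
      have c3 : 0 ≤ (1 - s ^ 2 / 8) * (1 - t ^ 2 / 8) := by nlinarith
      have c4 : 2 / 3 ≤ (1 - s ^ 2 / 8) * (1 - s ^ 2 / 8) := by nlinarith
      nlinarith [mul_pos hs hs]

lemma containsStrictDNMultipartite_seven_four (r : ℕ) : ContainsStrictDNMultipartite 7 4 r := by
  classical
  set σ : ℕ → ℝ := fun m => (1 / 2) ^ (m + 1) with hσ
  have σpos : ∀ m, 0 < σ m := fun m => by positivity
  have σle : ∀ m, σ m ≤ 1 / 2 := fun m =>
    pow_le_of_le_one (by norm_num) (by norm_num) (Nat.succ_ne_zero m)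
  have σlt : ∀ {m n}, m < n → 2 * σ n ≤ σ m := fun {m n} h => by
    have : σ n ≤ (1 / 2) ^ (m + 1 + 1) :=
      pow_le_pow_of_le_one (by norm_num) (by norm_num) (by omega)
    rw [pow_succ] at this
    simp only [hσ] at this ⊢
    linarith
  have σsep : ∀ {m n}, m ≠ n → 2 * σ m ≤ σ n ∨ 2 * σ n ≤ σ m := fun h =>
    (lt_or_gt_of_ne h).elim (fun h => .inr (σlt h)) (fun h => .inl (σlt h))
  let P : Fin 4 → Finset (Euc 7) := fun i => (Finset.range r).image fun m => tetraPoint i (σ m)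
  have hP : ∀ {i x}, x ∈ P i → ∃ m, x = tetraPoint i (σ m) := fun {i x} h => by
    obtain ⟨m, -, rfl⟩ := Finset.mem_image.1 h
    exact ⟨m, rfl⟩
  have hsub : ∀ i, P i ⊆ Finset.univ.biUnion P :=
    fun i => Finset.subset_biUnion_of_mem P (Finset.mem_univ i)
  have hne : ∀ {i j}, i ≠ j → ∀ m n, tetraPoint i (σ m) ≠ tetraPoint j (σ n) :=
    fun h m n => tetraPoint_ne h (σpos m) (σle m) (σpos n) (σle n)
  have hpos : ∀ {i j} l, i ≠ j → ∀ m n k, tetraPoint l (σ k) ≠ tetraPoint i (σ m) →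
      0 < ⟪tetraPoint l (σ k) - tetraPoint i (σ m), tetraPoint j (σ n) - tetraPoint i (σ m)⟫ := by
    intro i j l h m n k hx
    refine inner_tetraPoint_pos h (σpos m) (σle m) (σpos n) (σle n) (σpos k) (σle k) ?_
    rintro rfl
    exact σsep fun e => hx (by rw [e])
  refine ⟨Finset.univ.biUnion P, P, hsub, fun i => ?_, fun i j hij => ?_,
    fun i j hij p hp q hq => ?_⟩
  · rw [Finset.card_image_of_injective, Finset.card_range]
    intro m n hmn
    by_contra hne'
    obtain ⟨j, hj⟩ := exists_ne i
    have h1 := inner_tetraPoint_pos (l := i) hj.symm (σpos m) (σle m) (σpos m) (σle m) (σpos n) (σle n)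
      fun _ => σsep hne'
    simp only at hmn
    rw [← hmn, sub_self, inner_zero_left] at h1
    exact lt_irrefl _ h1
  · refine Finset.disjoint_left.2 fun x hi hj => ?_
    obtain ⟨m, rfl⟩ := hP hi
    obtain ⟨n, hn⟩ := hP hj
    exact hne hij m n hn
  · have hpV := hsub i hp
    have hqV := hsub j hq
    obtain ⟨m, rfl⟩ := hP hp
    obtain ⟨n, rfl⟩ := hP hq
    refine ⟨hne hij m n, hpV, hqV, fun x hx hxp hxq => ?_⟩
    obtain ⟨l, -, hl⟩ := Finset.mem_biUnion.1 hx
    obtain ⟨k, rfl⟩ := hP hl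
    exact ⟨hpos l hij m n k hxp, hpos l hij.symm n m k hxq⟩

end Construction

section Scales

variable {E : Type*} [NormedAddCommGroup E] [InnerProductSpace ℝ E]

lemma exists_finset_cover_unitBall [FiniteDimensional ℝ E] {ε : ℝ} (hε : 0 < ε) :
    ∃ t : Finset E, ∀ x : E, ‖x‖ ≤ 1 → ∃ c ∈ t, ‖x - c‖ < ε := by
  have : ProperSpace E := FiniteDimensional.proper ℝ E
  obtain ⟨t, -, ht, hcover⟩ := (isCompact_closedBall (0 : E) 1).finite_cover_balls hε
  refine ⟨ht.toFinset, fun x hx => ?_⟩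
  have := hcover (mem_closedBall_zero_iff.2 hx)
  simpa [dist_eq_norm] using this

/-- A large finite set determines distances at many different scales. -/
lemma exists_scales [FiniteDimensional ℝ E] {ε : ℝ} (hε : 0 < ε) (C : ℕ) :
    ∃ N : ℕ, ∀ S : Finset E, N ≤ S.card → ∃ f g : ℕ → E,
      (∀ i < C, f i ∈ S ∧ g i ∈ S ∧ f i ≠ g i) ∧
      ∀ i j, i < j → j < C → ‖f j - g j‖ ≤ ε * ‖f i - g i‖ := by
  classical
  induction C with
  | zero => exact ⟨0, fun S _ => ⟨0, 0, by simp, by simp⟩⟩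
  | succ C ih =>
    obtain ⟨N, hN⟩ := ih
    obtain ⟨t, ht⟩ := exists_finset_cover_unitBall (E := E) (half_pos hε)
    refine ⟨t.card * N + 2, fun S hS => ?_⟩
    obtain ⟨a, ha, b, hb, hab⟩ := Finset.one_lt_card.1 (show 1 < S.card by omega)
    obtain ⟨⟨x, y⟩, hxy, hmax⟩ := (S ×ˢ S).exists_max_image (fun p => ‖p.1 - p.2‖)
      ⟨(a, b), Finset.mk_mem_product ha hb⟩
    obtain ⟨hx, hy⟩ := Finset.mem_product.1 hxy
    have hmax' : ∀ p ∈ S, ∀ q ∈ S, ‖p - q‖ ≤ ‖x - y‖ := fun p hp q hq =>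
      hmax (p, q) (Finset.mk_mem_product hp hq)
    have hD : 0 < ‖x - y‖ := (norm_pos_iff.2 (sub_ne_zero.2 hab)).trans_le (hmax' a ha b hb)
    have hcov : ∀ p ∈ S, ∃ c ∈ t, ‖‖x - y‖⁻¹ • (p - x) - c‖ < ε / 2 := fun p hp => by
      refine ht _ ?_
      rw [norm_smul, norm_inv, norm_norm, inv_mul_le_one₀ hD]
      exact hmax' p hp x hx
    choose! c hct hc using hcov
    obtain ⟨d, -, hd⟩ := Finset.exists_lt_card_fiber_of_mul_lt_card_of_maps_to hct
      (show t.card * N < S.card by omega)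
    obtain ⟨f, g, hfg, hscale⟩ := hN _ hd.le
    have hclose : ∀ p ∈ S.filter (fun p => c p = d), ∀ q ∈ S.filter (fun p => c p = d),
        ‖p - q‖ ≤ ε * ‖x - y‖ := by
      intro p hp q hq
      obtain ⟨hp, hpd⟩ := Finset.mem_filter.1 hp
      obtain ⟨hq, hqd⟩ := Finset.mem_filter.1 hq
      have h1 := hc p hp
      have h2 := hc q hq
      rw [hpd] at h1
      rw [hqd, norm_sub_rev] at h2
      have h3 := norm_add_le (‖x - y‖⁻¹ • (p - x) - d) (d - ‖x - y‖⁻¹ • (q - x))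
      have h4 : ‖x - y‖⁻¹ • (p - x) - d + (d - ‖x - y‖⁻¹ • (q - x)) = ‖x - y‖⁻¹ • (p - q) := by
        module
      rw [h4, norm_smul, norm_inv, norm_norm] at h3
      rw [← div_le_iff₀ hD, div_eq_inv_mul]
      linarith
    refine ⟨fun n => n.casesOn x f, fun n => n.casesOn y g, ?_, ?_⟩
    · rintro (_ | i) hi
      · exact ⟨hx, hy, sub_ne_zero.1 (norm_pos_iff.1 hD)⟩
      · obtain ⟨h1, h2, h3⟩ := hfg i (by omega)
        exact ⟨(Finset.mem_filter.1 h1).1, (Finset.mem_filter.1 h2).1, h3⟩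
    · rintro (_ | i) (_ | j) hij hj
      · omega
      · obtain ⟨h1, h2, -⟩ := hfg j (by omega)
        exact hclose _ h1 _ h2
      · omega
      · exact hscale i j (by omega) (by omega)

/-- A large finite set contains two pairs of points with nearly parallel differences whose
lengths are very different. -/
lemma exists_parallel_pairs [FiniteDimensional ℝ E] {ε : ℝ} (hε : 0 < ε) :
    ∃ N : ℕ, ∀ S : Finset E, N ≤ S.card → ∃ a ∈ S, ∃ b ∈ S, ∃ a' ∈ S, ∃ b' ∈ S,
      a ≠ b ∧ a' ≠ b' ∧ ‖a - b‖ ≤ ε * ‖a' - b'‖ ∧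
      ‖‖a - b‖⁻¹ • (a - b) - ‖a' - b'‖⁻¹ • (a' - b')‖ ≤ ε := by
  classical
  obtain ⟨t, ht⟩ := exists_finset_cover_unitBall (E := E) (half_pos hε)
  obtain ⟨N, hN⟩ := exists_scales (E := E) hε (t.card + 1)
  refine ⟨N, fun S hS => ?_⟩
  obtain ⟨f, g, hfg, hscale⟩ := hN S hS
  have hcov : ∀ i ∈ Finset.range (t.card + 1),
      ∃ c ∈ t, ‖‖f i - g i‖⁻¹ • (f i - g i) - c‖ < ε / 2 := fun i hi => by
    refine ht _ ?_
    rw [norm_smul, norm_inv, norm_norm]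
    exact inv_mul_le_one
  choose! c hct hc using hcov
  obtain ⟨i, hi, j, hj, hij, hcij⟩ := Finset.exists_ne_map_eq_of_card_lt_of_maps_to
    (by simp) hct
  wlog hlt : i < j generalizing i j
  · exact this j hj i hi hij.symm hcij.symm (by omega)
  obtain ⟨h1, h2, h3⟩ := hfg j (Finset.mem_range.1 hj)
  obtain ⟨h1', h2', h3'⟩ := hfg i (Finset.mem_range.1 hi)
  refine ⟨_, h1, _, h2, _, h1', _, h2', h3, h3', hscale i j hlt (Finset.mem_range.1 hj), ?_⟩
  have e1 := hc i hi
  have e2 := hc j hj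
  rw [hcij, norm_sub_rev] at e1
  have := norm_add_le (‖f j - g j‖⁻¹ • (f j - g j) - c j) (c j - ‖f i - g i‖⁻¹ • (f i - g i))
  rw [sub_add_sub_cancel] at this
  linarith

end Scales

section Config

variable {E : Type*} [NormedAddCommGroup E] [InnerProductSpace ℝ E]

/-- Points `b i` spanning no obtuse angle, together with unit vectors `u k` that are, up to `η`,
orthogonal to each other and to all directions between the points. -/
structure NearlyOrthogonalConfig {ι : Type*} (η : ℝ) (u b : ι → E) : Prop where
  norm_eq_one : ∀ k, ‖u k‖ = 1
  injective : Function.Injective b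
  nonobtuse : ∀ i j k, i ≠ j → 0 ≤ ⟪b k - b i, b j - b i⟫
  abs_inner_le : ∀ k i j, |⟪u k, b j - b i⟫| ≤ η * ‖b j - b i‖
  abs_inner_le_of_ne : ∀ i j, i ≠ j → |⟪u i, u j⟫| ≤ η

lemma abs_inner_le_of_close {u u' w : E} {ε δ : ℝ} (h : ‖u - u'‖ ≤ ε)
    (h' : |⟪u', w⟫| ≤ δ * ‖w‖) : |⟪u, w⟫| ≤ (δ + ε) * ‖w‖ := by
  have h1 : ⟪u, w⟫ = ⟪u', w⟫ + ⟪u - u', w⟫ := by rw [inner_sub_left]; ring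
  rw [h1]
  refine (abs_add_le _ _).trans ?_
  have := abs_real_inner_le_norm (u - u') w
  nlinarith [norm_nonneg w]

lemma abs_inner_unit (x y : E) : |⟪‖x‖⁻¹ • x, y⟫| = ‖x‖⁻¹ * |⟪x, y⟫| := by
  rw [real_inner_smul_left, abs_mul, abs_inv, abs_norm]

end Config

lemma IsDoubleNormalPair.inner_nonneg {d : ℕ} {V : Finset (Euc d)} {p q x : Euc d}
    (h : IsDoubleNormalPair V p q) (hx : x ∈ V) : 0 ≤ ⟪x - p, q - p⟫ :=
  (h.2.2.2 x hx).1

lemma IsDoubleNormalPair.inner_le {d : ℕ} {V : Finset (Euc d)} {p q x : Euc d}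
    (h : IsDoubleNormalPair V p q) (hx : x ∈ V) : ⟪x - p, q - p⟫ ≤ ‖q - p‖ ^ 2 := by
  have h1 := (h.2.2.2 x hx).2
  have h2 : ⟪x - q, p - q⟫ = ‖q - p‖ ^ 2 - ⟪x - p, q - p⟫ := by
    rw [← real_inner_self_eq_norm_sq, show x - q = (x - p) - (q - p) by abel,
      show p - q = -(q - p) by abel, inner_neg_right, inner_sub_left]
    ring
  linarith

lemma IsDoubleNormalPair.abs_inner_le {d : ℕ} {V : Finset (Euc d)} {p q x y : Euc d}
    (h : IsDoubleNormalPair V p q) (hx : x ∈ V) (hy : y ∈ V) :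
    |⟪x - y, q - p⟫| ≤ ‖q - p‖ ^ 2 := by
  have h1 : ⟪x - y, q - p⟫ = ⟪x - p, q - p⟫ - ⟪y - p, q - p⟫ := by
    rw [← inner_sub_left, sub_sub_sub_cancel_right]
  rw [h1, abs_le]
  constructor <;> linarith [h.inner_nonneg hx, h.inner_nonneg hy, h.inner_le hx, h.inner_le hy]

/-- If `q` forms double-normal pairs with both `a` and `b`, then the projection of `q` to the line
`ab` lies on the segment `ab`. -/
lemma IsDoubleNormalPair.inner_mem {d : ℕ} {V : Finset (Euc d)} {a b q : Euc d}
    (ha : IsDoubleNormalPair V a q) (hb : IsDoubleNormalPair V b q) :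
    0 ≤ ⟪a - b, q - b⟫ ∧ ⟪a - b, q - b⟫ ≤ ‖a - b‖ ^ 2 := by
  refine ⟨hb.inner_nonneg ha.2.1, ?_⟩
  have h := ha.inner_nonneg hb.2.1
  have h2 : ⟪b - a, q - a⟫ = ‖a - b‖ ^ 2 - ⟪a - b, q - b⟫ := by
    rw [← real_inner_self_eq_norm_sq, show q - a = (q - b) - (a - b) by abel,
      show b - a = -(a - b) by abel, inner_neg_left, inner_sub_right]
    ring
  linarith

lemma exists_nearlyOrthogonalConfig {d k : ℕ} (h : ∀ r, ContainsDNMultipartite d k r) {ε : ℝ}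
    (hε : 0 < ε) (hε1 : ε ≤ 1) :
    ∃ u b : Fin k → Euc d, NearlyOrthogonalConfig (2 * ε) u b := by
  obtain ⟨N, hN⟩ := exists_parallel_pairs (E := Euc d) (pow_pos hε 2)
  obtain ⟨V, P, hPV, hcard, -, hdn⟩ := h N
  choose a ha b hb a' ha' b' hb' hab hab' hscale hclose using fun i => hN (P i) (hcard i).ge
  have hεε : ε ^ 2 ≤ ε := by nlinarith
  have hm : ∀ i, 0 < ‖a i - b i‖ := fun i => norm_pos_iff.2 (sub_ne_zero.2 (hab i))
  have hM : ∀ i, 0 < ‖a' i - b' i‖ := fun i => norm_pos_iff.2 (sub_ne_zero.2 (hab' i))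
  have hbb : ∀ i j, i ≠ j → IsDoubleNormalPair V (b i) (b j) :=
    fun i j hij => hdn i j hij _ (hb i) _ (hb j)
  have hu : ∀ i, ‖‖a i - b i‖⁻¹ • (a i - b i)‖ = 1 := fun i => by
    rw [norm_smul, norm_inv, norm_norm, inv_mul_cancel₀ (hm i).ne']
  refine ⟨fun i => ‖a i - b i‖⁻¹ • (a i - b i), b, hu,
    fun i j hij => ?_, fun i j k hij => (hbb i j hij).inner_nonneg (hPV k (hb k)),
    fun k i j => ?_, fun i j hij => ?_⟩
  · by_contra hne
    exact (hbb i j hne).1 hij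
  · by_cases hij : i = j
    · subst hij; simp
    have hD : 0 < ‖b j - b i‖ := norm_pos_iff.2 (sub_ne_zero.2 (hbb i j hij).1.symm)
    rcases le_total ‖a k - b k‖ (ε * ‖b j - b i‖) with hle | hle
    · have hmem : ∀ l, 0 ≤ ⟪a k - b k, b l - b k⟫ ∧
          ⟪a k - b k, b l - b k⟫ ≤ ‖a k - b k‖ ^ 2 := fun l => by
        by_cases hl : k = l
        · subst hl; simp
        · exact (hdn k l hl _ (ha k) _ (hb l)).inner_mem (hbb k l hl)
      have h1 : |⟪a k - b k, b j - b i⟫| ≤ ‖a k - b k‖ ^ 2 := by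
        rw [show b j - b i = (b j - b k) - (b i - b k) by abel, inner_sub_right, abs_le]
        constructor <;> linarith [hmem i, hmem j, (hmem i).1, (hmem j).1, (hmem i).2, (hmem j).2]
      rw [abs_inner_unit, inv_mul_le_iff₀ (hm k)]
      nlinarith [hm k]
    · have h1 := (hbb i j hij).abs_inner_le (hPV k (ha' k)) (hPV k (hb' k))
      have h2 : ‖b j - b i‖ ≤ ε * ‖a' k - b' k‖ := by
        have := hle.trans (hscale k)
        rw [pow_two, mul_assoc] at this
        exact le_of_mul_le_mul_left this hε
      rw [two_mul]
      refine abs_inner_le_of_close ((hclose k).trans hεε) ?_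
      rw [abs_inner_unit, inv_mul_le_iff₀ (hM k)]
      nlinarith [hM k]
  · wlog hle : ‖a' j - b' j‖ ≤ ‖a' i - b' i‖ generalizing i j
    · rw [real_inner_comm]
      exact this j i (Ne.symm hij) (le_of_not_ge hle)
    have hmem : ∀ q ∈ P i, 0 ≤ ⟪a j - b j, q - b j⟫ ∧
        ⟪a j - b j, q - b j⟫ ≤ ‖a j - b j‖ ^ 2 := fun q hq =>
      (hdn j i (Ne.symm hij) _ (ha j) _ hq).inner_mem (hdn j i (Ne.symm hij) _ (hb j) _ hq)
    have h1 : |⟪a' i - b' i, a j - b j⟫| ≤ ‖a j - b j‖ ^ 2 := by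
      rw [real_inner_comm, show a' i - b' i = (a' i - b j) - (b' i - b j) by abel,
        inner_sub_right, abs_le]
      have h2 := hmem _ (ha' i)
      have h3 := hmem _ (hb' i)
      constructor <;> linarith [h2.1, h2.2, h3.1, h3.2]
    have h2 : |⟪‖a i - b i‖⁻¹ • (a i - b i), a j - b j⟫| ≤ (ε + ε) * ‖a j - b j‖ := by
      refine abs_inner_le_of_close ((hclose i).trans hεε) ?_
      rw [abs_inner_unit, inv_mul_le_iff₀ (hM i)]
      have h4 : ‖a j - b j‖ ≤ ε * ‖a' i - b' i‖ :=
        (hscale j).trans (mul_le_mul hεε hle (norm_nonneg _) hε.le)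
      nlinarith [hm j]
    rw [real_inner_comm, abs_inner_unit, inv_mul_le_iff₀ (hm j), real_inner_comm]
    linarith

/-- Among five points of the plane in general position with respect to the axes, some three are
monotone, and the angle at the middle one is then obtuse. -/
lemma exists_monotone_triple (x y : Fin 5 → ℝ) (hx : Function.Injective x)
    (hy : Function.Injective y) : ∃ i j k, i ≠ j ∧ k ≠ j ∧
      (x i - x j) * (x k - x j) < 0 ∧ (y i - y j) * (y k - y j) < 0 := by
  classical
  let F : Fin 5 → Bool × Bool := fun i =>
    (decide (∃ j, x j < x i ∧ y j < y i), decide (∃ j, x j < x i ∧ y i < y j))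
  obtain ⟨j, k, hjk, hF⟩ := Fintype.exists_ne_map_eq_of_card_lt F (by simp)
  wlog hlt : x j < x k generalizing j k
  · exact this k j hjk.symm hF.symm (lt_of_le_of_ne (not_lt.1 hlt) (hx.ne hjk.symm))
  obtain ⟨h1, h2⟩ := Prod.mk.inj hF
  rw [decide_eq_decide] at h1 h2
  rcases lt_or_gt_of_ne (hy.ne hjk) with hylt | hygt
  · obtain ⟨i, hi, hi'⟩ := h1.2 ⟨j, hlt, hylt⟩
    exact ⟨i, j, k, fun e => by simp [e] at hi, hjk.symm,
      mul_neg_of_neg_of_pos (by linarith) (by linarith),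
      mul_neg_of_neg_of_pos (by linarith) (by linarith)⟩
  · obtain ⟨i, hi, hi'⟩ := h2.2 ⟨j, hlt, hygt⟩
    exact ⟨i, j, k, fun e => by simp [e] at hi, hjk.symm,
      mul_neg_of_neg_of_pos (by linarith) (by linarith),
      mul_neg_of_pos_of_neg (by linarith) (by linarith)⟩

/-- The orthogonal complement of five orthonormal vectors of `ℝ⁷` is a plane; it has orthogonal
coordinates of equal scale vanishing at none of finitely many prescribed nonzero vectors. -/
lemma exists_plane_coordinates {U : Fin 5 → Euc 7} (hU : Orthonormal ℝ U) {ι : Type*} [Finite ι]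
    (w : ι → Euc 7) (hw : ∀ i, w i ≠ 0) (hwU : ∀ i k, ⟪U k, w i⟫ = 0) :
    ∃ (f g : Euc 7) (c : ℝ), 0 < c ∧
      (∀ i j, c * ⟪w i, w j⟫ = ⟪w i, f⟫ * ⟪w j, f⟫ + ⟪w i, g⟫ * ⟪w j, g⟫) ∧
      ∀ i, ⟪w i, f⟫ ≠ 0 ∧ ⟪w i, g⟫ ≠ 0 := by
  set K := (Submodule.span ℝ (Set.range U))ᗮ with hK
  have hKrank : Module.finrank ℝ K = 2 := by
    have h1 := Submodule.finrank_add_finrank_orthogonal (Submodule.span ℝ (Set.range U))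
    rw [finrank_span_eq_card hU.linearIndependent, finrank_euclideanSpace_fin] at h1
    simp only [Fintype.card_fin] at h1
    rw [hK]
    omega
  have hwK : ∀ i, w i ∈ K := fun i => by
    rw [hK, Submodule.mem_orthogonal]
    intro v hv
    induction hv using Submodule.span_induction with
    | mem v hv => obtain ⟨k, rfl⟩ := hv; exact hwU i k
    | zero => simp
    | add v v' _ _ h h' => rw [inner_add_left, h, h', add_zero]
    | smul r v _ h => rw [real_inner_smul_left, h, mul_zero]
  let e : OrthonormalBasis (Fin 2) ℝ K :=
    (stdOrthonormalBasis ℝ K).reindex (finCongr hKrank)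
  have he : ∀ i j, ⟪w i, w j⟫ = ⟪w i, e 0⟫ * ⟪w j, e 0⟫ + ⟪w i, e 1⟫ * ⟪w j, e 1⟫ := by
    intro i j
    have := e.sum_inner_mul_inner (⟨w i, hwK i⟩ : K) ⟨w j, hwK j⟩
    simp only [Fin.sum_univ_two, Submodule.coe_inner] at this
    rw [← this, real_inner_comm (w j), real_inner_comm (w j)]
  obtain ⟨t, ht⟩ := ((Set.finite_range fun i => -⟪w i, (e 0 : Euc 7)⟫ / ⟪w i, (e 1 : Euc 7)⟫).union
    (Set.finite_range fun i => ⟪w i, (e 1 : Euc 7)⟫ / ⟪w i, (e 0 : Euc 7)⟫)).exists_notMem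
  simp only [Set.mem_union, Set.mem_range, not_or, not_exists] at ht
  have hne : ∀ i, ¬ (⟪w i, (e 0 : Euc 7)⟫ = 0 ∧ ⟪w i, (e 1 : Euc 7)⟫ = 0) := fun i ⟨h0, h1⟩ => by
    have := he i i
    rw [h0, h1, mul_zero, add_zero] at this
    exact hw i (inner_self_eq_zero.1 this)
  refine ⟨(e 0 : Euc 7) + t • (e 1 : Euc 7), (e 1 : Euc 7) - t • (e 0 : Euc 7), 1 + t ^ 2,
    by positivity, fun i j => ?_, fun i => ?_⟩
  · rw [he]
    simp only [inner_add_right, inner_sub_right, real_inner_smul_right]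
    ring
  · simp only [inner_add_right, inner_sub_right, real_inner_smul_right]
    have h0 := ht.1 i
    have h1 := ht.2 i
    constructor
    · intro h
      by_cases hz : ⟪w i, (e 1 : Euc 7)⟫ = 0
      · exact hne i ⟨by rw [hz] at h; linarith, hz⟩
      · exact h0 (by rw [div_eq_iff hz]; linarith)
    · intro h
      by_cases hz : ⟪w i, (e 0 : Euc 7)⟫ = 0
      · exact hne i ⟨hz, by rw [hz] at h; linarith⟩
      · exact h1 (by rw [div_eq_iff hz]; linarith)

lemma exists_ultrafilter_limit {E : Type*} [NormedAddCommGroup E] [ProperSpace E]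
    (𝒰 : Ultrafilter ℕ) (s : ℕ → E) (hs : ∀ n, ‖s n‖ ≤ 1) :
    ∃ x, Filter.Tendsto s 𝒰 (nhds x) := by
  obtain ⟨x, -, hx⟩ := (isCompact_closedBall (0 : E) 1).ultrafilter_le_nhds (𝒰.map s) (by
    rw [Filter.le_principal_iff, Ultrafilter.coe_map]
    exact Filter.mem_map.2 (Filter.univ_mem' fun n => mem_closedBall_zero_iff.2 (hs n)))
  exact ⟨x, hx⟩

lemma not_forall_containsDNMultipartite_seven_five :
    ¬ ∀ r, ContainsDNMultipartite 7 5 r := by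
  intro h
  choose u b hub using fun n : ℕ => exists_nearlyOrthogonalConfig h
    (show (0 : ℝ) < 1 / ((n : ℝ) + 1) by positivity)
    (by rw [div_le_one (by positivity)]; linarith [Nat.cast_nonneg (α := ℝ) n])
  let 𝒰 : Ultrafilter ℕ := Filter.hyperfilter ℕ
  have hη : Filter.Tendsto (fun n : ℕ => 2 * (1 / ((n : ℝ) + 1))) 𝒰 (nhds 0) := by
    have := (tendsto_one_div_add_atTop_nhds_zero_nat (𝕜 := ℝ)).const_mul 2
    rw [mul_zero] at this
    exact this.mono_left Nat.hyperfilter_le_atTop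
  let v : Fin 5 → Fin 5 → ℕ → Euc 7 := fun i j n => ‖b n j - b n i‖⁻¹ • (b n j - b n i)
  have hpos : ∀ n {i j}, i ≠ j → 0 < ‖b n j - b n i‖ := fun n i j hij =>
    norm_pos_iff.2 (sub_ne_zero.2 ((hub n).injective.ne hij.symm))
  have hv : ∀ n {i j}, i ≠ j → ‖v i j n‖ = 1 := fun n i j hij => by
    simp only [v]
    rw [norm_smul, norm_inv, norm_norm, inv_mul_cancel₀ (hpos n hij).ne']
  choose U hUlim using fun k => exists_ultrafilter_limit 𝒰 (fun n => u n k)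
    fun n => ((hub n).norm_eq_one k).le
  choose W hWlim using fun i j => exists_ultrafilter_limit 𝒰 (v i j) fun n => by
    simp only [v]
    rw [norm_smul, norm_inv, norm_norm]
    exact inv_mul_le_one
  have hU : Orthonormal ℝ U := by
    refine ⟨fun k => ?_, fun i j hij => ?_⟩
    · refine tendsto_nhds_unique (hUlim k).norm ?_
      simp only [(hub _).norm_eq_one]
      exact tendsto_const_nhds
    · have h1 := ((hUlim i).inner (𝕜 := ℝ) (hUlim j)).abs
      exact abs_nonpos_iff.1 (le_of_tendsto_of_tendsto' h1 hη fun n => (hub n).abs_inner_le_of_ne i j hij)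
  have hW : ∀ {i j}, i ≠ j → ‖W i j‖ = 1 := fun {i j} hij => by
    refine tendsto_nhds_unique (hWlim i j).norm ?_
    simp only [hv _ hij]
    exact tendsto_const_nhds
  have hWU : ∀ {i j} k, i ≠ j → ⟪U k, W i j⟫ = 0 := fun {i j} k hij => by
    have h1 := ((hUlim k).inner (𝕜 := ℝ) (hWlim i j)).abs
    refine abs_nonpos_iff.1 (le_of_tendsto_of_tendsto' h1 hη fun n => ?_)
    simp only [v]
    rw [real_inner_comm, abs_inner_unit, real_inner_comm, inv_mul_le_iff₀ (hpos n hij), mul_comm]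
    exact (hub n).abs_inner_le k i j
  have hWW : ∀ {i j} k, i ≠ j → 0 ≤ ⟪W i k, W i j⟫ := fun {i j} k hij => by
    refine ge_of_tendsto' ((hWlim i k).inner (𝕜 := ℝ) (hWlim i j)) fun n => ?_
    simp only [v]
    rw [real_inner_smul_left, real_inner_smul_right]
    have := (hub n).nonobtuse i j k hij
    positivity
  obtain ⟨f, g, c, hc, hfg, hne⟩ := exists_plane_coordinates hU
    (fun p : {p : Fin 5 × Fin 5 // p.1 ≠ p.2} => W p.1.1 p.1.2)
    (fun p => norm_ne_zero_iff.1 (by rw [hW p.2]; exact one_ne_zero))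
    (fun p k => hWU k p.2)
  have hsign : ∀ e : Euc 7, (∀ p : {p : Fin 5 × Fin 5 // p.1 ≠ p.2}, ⟪W p.1.1 p.1.2, e⟫ ≠ 0) →
      ∀ᶠ n in (𝒰 : Filter ℕ), ∀ p : {p : Fin 5 × Fin 5 // p.1 ≠ p.2},
        0 < ⟪b n p.1.2 - b n p.1.1, e⟫ * ⟪W p.1.1 p.1.2, e⟫ := by
    intro e he
    refine Filter.eventually_all.2 fun p => ?_
    have h1 := ((hWlim p.1.1 p.1.2).inner (𝕜 := ℝ) (tendsto_const_nhds (x := e))).mul_const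
      ⟪W p.1.1 p.1.2, e⟫
    filter_upwards [h1.eventually (lt_mem_nhds (mul_self_pos.2 (he p)))] with n hn
    simp only [v] at hn
    rw [real_inner_smul_left, mul_assoc] at hn
    exact pos_of_mul_pos_right hn (by positivity)
  obtain ⟨n, hnf, hng⟩ :=
    ((hsign f fun p => (hne p).1).and (hsign g fun p => (hne p).2)).exists
  have hinj : ∀ e : Euc 7, (∀ p : {p : Fin 5 × Fin 5 // p.1 ≠ p.2},
      0 < ⟪b n p.1.2 - b n p.1.1, e⟫ * ⟪W p.1.1 p.1.2, e⟫) →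
      Function.Injective fun i => ⟪b n i, e⟫ := by
    intro e he i j hij
    by_contra hne'
    have := he ⟨(i, j), hne'⟩
    simp only at hij
    simp [inner_sub_left, hij] at this
  obtain ⟨i, j, k, hij, hkj, hx, hy⟩ := exists_monotone_triple _ _ (hinj f hnf) (hinj g hng)
  have hneg : ∀ {α β A B : ℝ}, α * β < 0 → 0 < α * A → 0 < β * B → A * B < 0 := by
    intro α β A B h1 h2 h3
    by_contra hAB
    nlinarith [mul_pos h2 h3, mul_nonneg (not_lt.1 hAB) (neg_pos.2 h1).le]
  simp only [← inner_sub_left] at hx hy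
  have h1 := hneg hx (hnf ⟨(j, i), hij.symm⟩) (hnf ⟨(j, k), hkj.symm⟩)
  have h2 := hneg hy (hng ⟨(j, i), hij.symm⟩) (hng ⟨(j, k), hkj.symm⟩)
  have h3 := hfg ⟨(j, i), hij.symm⟩ ⟨(j, k), hkj.symm⟩
  have h4 := hWW i hkj.symm
  simp only at h1 h2 h3
  nlinarith [mul_nonneg hc.le h4]

theorem stmt5 :
    (∀ r : ℕ, ContainsStrictDNMultipartite 7 4 r) ∧
    (∃ r : ℕ, ¬ ContainsDNMultipartite 7 5 r) := by
  refine ⟨containsStrictDNMultipartite_seven_four, ?_⟩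
  by_contra h
  push Not at h
  exact not_forall_containsDNMultipartite_seven_five h
end

section
/- Let d and k be natural numbers with k ≥ 2, and suppose that for every r ∈ ℕ there exists a finite set V of points in Euclidean space ℝ^d that contains the complete k-partite graph K_k(r) in its double-normal graph. Then there exists a family of unit vectors u_{ij} ∈ ℝ^d, indexed by i, j ∈ {1, …, k}, such that: (1) the vectors u_{11}, …, u_{kk} are pairwise orthogonal; (2) ⟪u_{ii}, u_{jl}⟫ = 0 for all i, j, l ∈ {1, …, k} with j ≠ l; and (3) the dimension of the linear span of U₂ := {u_{jl} : j, l ∈ {1, …, k}, j ≠ l} satisfies k ≤ 2^(dim span U₂) (i.e., dim span U₂ ≥ log₂ k). -/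
open scoped RealInnerProductSpace

section

variable {E : Type*} [NormedAddCommGroup E] [InnerProductSpace ℝ E]

theorem convexHull_interior_inner_lt {s : Set E} {x v : E} (hv : v ≠ 0)
    (hs : ∀ y ∈ s, ⟪y, v⟫ ≤ ⟪x, v⟫) {a : E} (ha : a ∈ interior (convexHull ℝ s)) :
    ⟪a, v⟫ < ⟪x, v⟫ := by
  have hsub : convexHull ℝ s ⊆ {y | ⟪y, v⟫ ≤ ⟪x, v⟫} := by
    refine convexHull_min hs ?_
    have := convex_halfSpace_le (𝕜 := ℝ) (f := fun y : E => ⟪y, v⟫)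
      ⟨fun a b => inner_add_left a b v, fun c a => by simp [inner_smul_left]⟩ ⟪x, v⟫
    exact this
  have hnhds : convexHull ℝ s ∈ nhds a := mem_interior_iff_mem_nhds.1 ha
  have hlim : Filter.Tendsto (fun t : ℝ => a + t • v) (nhdsWithin 0 (Set.Ioi 0)) (nhds a) := by
    have : Continuous fun t : ℝ => a + t • v := by fun_prop
    simpa using (this.tendsto 0).mono_left nhdsWithin_le_nhds
  obtain ⟨t, ht, ht0⟩ := ((hlim.eventually hnhds).and self_mem_nhdsWithin).exists
  have h1 : ⟪a + t • v, v⟫ ≤ ⟪x, v⟫ := hsub ht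
  rw [inner_add_left, real_inner_smul_left] at h1
  have h2 : 0 < t * ⟪v, v⟫ := mul_pos ht0 (real_inner_self_pos.2 hv)
  linarith

theorem card_le_two_pow_finrank_of_affineSpan_eq_top [FiniteDimensional ℝ E] (X : Finset E)
    (hX : ∀ a ∈ X, ∀ b ∈ X, ∀ c ∈ X, 0 ≤ ⟪b - a, c - a⟫)
    (hspan : affineSpan ℝ (X : Set E) = ⊤) : X.card ≤ 2 ^ Module.finrank ℝ E := by
  let _ : MeasurableSpace E := borel E
  have _ : BorelSpace E := ⟨rfl⟩
  let μ : MeasureTheory.Measure E := MeasureTheory.Measure.addHaar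
  set P := convexHull ℝ (X : Set E) with hP
  have hne : (interior P).Nonempty := interior_convexHull_nonempty_iff_affineSpan_eq_top.2 hspan
  have hpos : 0 < μ (interior P) := isOpen_interior.measure_pos μ hne
  have hfin : μ (interior P) ≠ ⊤ :=
    ((isBounded_convexHull.2 X.finite_toSet.isBounded).subset interior_subset).measure_lt_top.ne
  let C : E → Set E := fun x => AffineMap.homothety x (1 / 2 : ℝ) '' interior P
  have hopen : ∀ x, IsOpen (C x) := fun x =>
    AffineMap.homothety_isOpenMap x _ (by norm_num) _ isOpen_interior
  have hsub : ∀ x ∈ X, C x ⊆ interior P := by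
    intro x hx
    refine interior_maximal ?_ (hopen x)
    rintro _ ⟨a, ha, rfl⟩
    rw [AffineMap.homothety_eq_lineMap]
    exact (convex_convexHull ℝ _).lineMap_mem (subset_convexHull ℝ _ hx) (interior_subset ha)
      ⟨by norm_num, by norm_num⟩
  have hdisj : (X : Set E).PairwiseDisjoint C := by
    intro x hx y hy hxy
    rw [Function.onFun, Set.disjoint_left]
    rintro _ ⟨a, ha, rfl⟩ ⟨b, hb, hab⟩
    have h1 : ⟪a, y - x⟫ < ⟪y, y - x⟫ := by
      refine convexHull_interior_inner_lt (sub_ne_zero.2 hxy.symm) (fun z hz => ?_) ha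
      have := hX y hy z hz x hx
      rw [← neg_sub y x, inner_neg_right, inner_sub_left] at this
      linarith
    have h2 : ⟪b, x - y⟫ < ⟪x, x - y⟫ := by
      refine convexHull_interior_inner_lt (sub_ne_zero.2 hxy) (fun z hz => ?_) hb
      have := hX x hx z hz y hy
      rw [← neg_sub x y, inner_neg_right, inner_sub_left] at this
      linarith
    have h3 : x + a = y + b := by
      simp only [AffineMap.homothety_apply, vsub_eq_sub, vadd_eq_add] at hab
      have h4 : (2 : ℝ) • ((1 / 2 : ℝ) • (b - y) + y) = (2 : ℝ) • ((1 / 2 : ℝ) • (a - x) + x) := by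
        rw [hab]
      simp only [smul_add, smul_smul] at h4
      norm_num [two_smul] at h4
      rw [add_comm x, add_comm y, h4]
    have h6 : ⟪x + a, y - x⟫ = ⟪y + b, y - x⟫ := by rw [h3]
    rw [← neg_sub y x, inner_neg_right, inner_neg_right] at h2
    rw [inner_add_left, inner_add_left] at h6
    linarith
  have hsum : ∑ x ∈ X, μ (C x) ≤ μ (interior P) := by
    rw [← MeasureTheory.measure_biUnion_finset hdisj fun x _ => (hopen x).measurableSet]
    exact MeasureTheory.measure_mono (Set.iUnion₂_subset hsub)
  have hreal : (X.card : ℝ) * ((1 / 2) ^ Module.finrank ℝ E * μ.real (interior P)) ≤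
      μ.real (interior P) := by
    have h1 := ENNReal.toReal_mono hfin hsum
    simp only [C, μ, MeasureTheory.Measure.addHaar_image_homothety, Finset.sum_const,
      nsmul_eq_mul, ENNReal.toReal_mul, ENNReal.toReal_natCast] at h1
    rwa [ENNReal.toReal_ofReal (abs_nonneg _), abs_of_pos (by positivity)] at h1
  have hpos' : 0 < μ.real (interior P) := ENNReal.toReal_pos hpos.ne' hfin
  have : (X.card : ℝ) ≤ 2 ^ Module.finrank ℝ E := by
    have h2 : (X.card : ℝ) * (1 / 2) ^ Module.finrank ℝ E ≤ 1 := by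
      by_contra! h
      nlinarith
    rw [one_div, inv_pow] at h2
    exact (div_le_one (by positivity)).1 (by simpa [div_eq_mul_inv] using h2)
  exact_mod_cast this

theorem card_le_two_pow_finrank_span [FiniteDimensional ℝ E] (X : Finset E) (h0 : (0 : E) ∈ X)
    (hX : ∀ a ∈ X, ∀ b ∈ X, ∀ c ∈ X, 0 ≤ ⟪b - a, c - a⟫) :
    X.card ≤ 2 ^ Module.finrank ℝ (Submodule.span ℝ (X : Set E)) := by
  classical
  set W := Submodule.span ℝ (X : Set E) with hW
  let Y : Finset W := X.preimage (fun w : W => (w : E)) Subtype.val_injective.injOn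
  have hcard : X.card = Y.card := by
    rw [← Finset.card_image_of_injective Y Subtype.val_injective]
    congr 1
    ext x
    simp only [Y, Finset.mem_image, Finset.mem_preimage]
    exact ⟨fun hx => ⟨⟨x, Submodule.subset_span hx⟩, hx, rfl⟩, by rintro ⟨w, hw, rfl⟩; exact hw⟩
  rw [hcard]
  have hY0 : (0 : W) ∈ (Y : Set W) := by simpa [Y] using h0
  refine card_le_two_pow_finrank_of_affineSpan_eq_top Y (fun a ha b hb c hc => ?_) ?_
  · simp only [Y, Finset.mem_preimage] at ha hb hc
    simpa using hX _ ha _ hb _ hc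
  · rw [AffineSubspace.affineSpan_eq_top_iff_vectorSpan_eq_top_of_nonempty _ _ _ ⟨0, hY0⟩,
      vectorSpan_eq_span_vsub_set_right ℝ hY0]
    simp only [Y, vsub_eq_sub, sub_zero, Set.image_id', Finset.coe_preimage]
    exact Submodule.span_span_coe_preimage (R := ℝ) (s := (X : Set E))

theorem inner_sub_le_of_nonneg {x a b : E} (h : 0 ≤ ⟪x - b, a - b⟫) :
    ⟪x - a, b - a⟫ ≤ ‖b - a‖ ^ 2 := by
  rw [← real_inner_self_eq_norm_sq]
  have : ⟪x - b, a - b⟫ = ⟪b - a, b - a⟫ - ⟪x - a, b - a⟫ := by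
    rw [← inner_sub_left, ← neg_sub b a, inner_neg_right, ← inner_neg_left]
    congr 1
    abel
  linarith

theorem abs_inner_sub_le_of_nonneg {x y a b : E} (hx : 0 ≤ ⟪x - a, b - a⟫)
    (hx' : 0 ≤ ⟪x - b, a - b⟫) (hy : 0 ≤ ⟪y - a, b - a⟫) (hy' : 0 ≤ ⟪y - b, a - b⟫) :
    |⟪x - y, b - a⟫| ≤ ‖b - a‖ ^ 2 := by
  have h1 := inner_sub_le_of_nonneg hx'
  have h2 := inner_sub_le_of_nonneg hy'
  have h3 : ⟪x - y, b - a⟫ = ⟪x - a, b - a⟫ - ⟪y - a, b - a⟫ := by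
    rw [← inner_sub_left, sub_sub_sub_cancel_right]
  rw [h3, abs_le]
  constructor <;> linarith

open Filter Topology in
/-- If the angles determined by the points `q n i` are never obtuse, the limiting directions
of their differences span a space of dimension at least `log₂` of the number of points. -/
theorem card_le_two_pow_finrank_of_tendsto [FiniteDimensional ℝ E] {κ ι : Type*}
    (F : Ultrafilter κ) (q : κ → ι → E) (u : ι → ι → E)
    (hq : ∀ n i j, i ≠ j → q n i ≠ q n j)
    (hnonneg : ∀ n i j l, 0 ≤ ⟪q n l - q n i, q n j - q n i⟫)
    (hu : ∀ i j, i ≠ j →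
      Tendsto (fun n => ‖q n j - q n i‖⁻¹ • (q n j - q n i)) F (𝓝 (u i j)))
    (I : Finset ι) :
    I.card ≤ 2 ^ Module.finrank ℝ
      (Submodule.span ℝ {v : E | ∃ i ∈ I, ∃ j ∈ I, i ≠ j ∧ v = u i j}) := by
  classical
  induction I using Finset.strongInduction with
  | H I ih =>
  rcases le_or_gt I.card 1 with hI | hI
  · exact hI.trans Nat.one_le_two_pow
  obtain ⟨i₀, hi₀, i₁, hi₁, hne⟩ := Finset.one_lt_card.1 hI
  let D : κ → ℝ := fun n => ∑ i ∈ I, ‖q n i - q n i₀‖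
  have hD : ∀ n, 0 < D n := fun n =>
    Finset.sum_pos' (fun _ _ => norm_nonneg _)
      ⟨i₁, hi₁, norm_pos_iff.2 (sub_ne_zero.2 (hq n _ _ hne.symm))⟩
  let y : κ → ι → E := fun n i => (D n)⁻¹ • (q n i - q n i₀)
  have hy_norm : ∀ n i, ‖y n i‖ = (D n)⁻¹ * ‖q n i - q n i₀‖ := fun n i => by
    rw [norm_smul, norm_inv, Real.norm_of_nonneg (hD n).le]
  have hy_sub : ∀ n i j, y n j - y n i = (D n)⁻¹ • (q n j - q n i) := fun n i j => by
    rw [← smul_sub, sub_sub_sub_cancel_right]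
  have hlim : ∀ i, ∃ x, i ∈ I → Tendsto (fun n => y n i) F (𝓝 x) := by
    intro i
    by_cases hi : i ∈ I
    · have hmem : ∀ n, y n i ∈ Metric.closedBall (0 : E) 1 := by
        intro n
        rw [mem_closedBall_zero_iff, hy_norm, inv_mul_le_one₀ (hD n)]
        exact Finset.single_le_sum (f := fun i => ‖q n i - q n i₀‖)
          (fun _ _ => norm_nonneg _) hi
      obtain ⟨x, -, hx⟩ := (isCompact_closedBall (0 : E) 1).ultrafilter_le_nhds
        (F.map fun n => y n i) (by
          rw [Ultrafilter.coe_map, le_principal_iff]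
          exact Filter.mem_map.2 (Filter.univ_mem' hmem))
      exact ⟨x, fun _ => hx⟩
    · exact ⟨0, fun h => absurd h hi⟩
  choose x hx using hlim
  have hx₀ : x i₀ = 0 := by
    refine tendsto_nhds_unique (hx i₀ hi₀) ?_
    simp [y]
  have hsum : ∑ i ∈ I, ‖x i‖ = 1 := by
    refine tendsto_nhds_unique (tendsto_finsetSum I fun i hi => (hx i hi).norm) ?_
    refine tendsto_const_nhds.congr fun n => ?_
    simp only [hy_norm]
    rw [← Finset.mul_sum, inv_mul_cancel₀ (hD n).ne']
  have hx_sub : ∀ i ∈ I, ∀ j ∈ I, Tendsto (fun n => y n j - y n i) F (𝓝 (x j - x i)) :=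
    fun i hi j hj => (hx j hj).sub (hx i hi)
  have hx_nonneg : ∀ i ∈ I, ∀ j ∈ I, ∀ l ∈ I, 0 ≤ ⟪x j - x i, x l - x i⟫ := by
    intro i hi j hj l hl
    refine ge_of_tendsto' ((hx_sub i hi j hj).inner (hx_sub i hi l hl)) fun n => ?_
    rw [hy_sub, hy_sub, real_inner_smul_left, real_inner_smul_right]
    have := hD n
    have := hnonneg n i l j
    positivity
  have hx_eq : ∀ i ∈ I, ∀ j ∈ I, i ≠ j → x j - x i = ‖x j - x i‖ • u i j := by
    intro i hi j hj hij
    refine tendsto_nhds_unique (hx_sub i hi j hj) ?_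
    refine ((hx_sub i hi j hj).norm.smul (hu i j hij)).congr fun n => ?_
    have hpos : 0 < ‖q n j - q n i‖ := norm_pos_iff.2 (sub_ne_zero.2 (hq n _ _ hij.symm))
    rw [hy_sub, norm_smul, norm_inv, Real.norm_of_nonneg (hD n).le, smul_smul, mul_assoc,
      mul_inv_cancel₀ hpos.ne', mul_one]
  have hortho : ∀ i ∈ I, ∀ j ∈ I, ∀ l ∈ I, i ≠ j → x i = x j → ⟪u i j, x l - x i⟫ = 0 := by
    intro i hi j hj l hl hij hxij
    have hpos : ∀ n, 0 < ‖q n j - q n i‖ := fun n =>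
      norm_pos_iff.2 (sub_ne_zero.2 (hq n _ _ hij.symm))
    have hlim := (hu i j hij).inner (𝕜 := ℝ) (hx_sub i hi l hl)
    have hzero : Tendsto (fun n => ‖y n j - y n i‖) F (𝓝 0) := by
      simpa [hxij] using (hx_sub i hi j hj).norm
    refine tendsto_nhds_unique hlim (squeeze_zero (fun n => ?_) (fun n => ?_) hzero)
    · rw [hy_sub, real_inner_smul_left, real_inner_smul_right]
      have := hD n
      have := hnonneg n i l j
      positivity
    · rw [hy_sub, hy_sub, real_inner_smul_left, real_inner_smul_right, norm_smul, norm_inv,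
        Real.norm_of_nonneg (hD n).le, mul_left_comm]
      refine mul_le_mul_of_nonneg_left ?_ (inv_nonneg.2 (hD n).le)
      rw [inv_mul_le_iff₀ (hpos n), ← sq, real_inner_comm]
      exact inner_sub_le_of_nonneg (hnonneg n j i l)
  let U : Finset ι → Submodule ℝ E := fun J =>
    Submodule.span ℝ {v : E | ∃ i ∈ J, ∃ j ∈ J, i ≠ j ∧ v = u i j}
  obtain ⟨z, hz, hmax⟩ := Finset.exists_max_image (I.image x)
    (fun z => Module.finrank ℝ (U {i ∈ I | x i = z})) ⟨_, Finset.mem_image_of_mem x hi₀⟩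
  set A := {i ∈ I | x i = z} with hA
  have hfiber : ∀ w ∈ I.image x, {i ∈ I | x i = w}.card ≤ 2 ^ Module.finrank ℝ (U A) := by
    intro w hw
    refine (ih _ (Finset.filter_ssubset.2 ?_)).trans
      (Nat.pow_le_pow_right two_pos (hmax w hw))
    by_contra! hall
    have hw0 : w = 0 := by rw [← hall i₀ hi₀, hx₀]
    have : ∑ i ∈ I, ‖x i‖ = 0 := Finset.sum_eq_zero fun i hi => by rw [hall i hi, hw0, norm_zero]
    linarith
  have himage : (I.image x).card ≤
      2 ^ Module.finrank ℝ (Submodule.span ℝ (I.image x : Set E)) := by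
    refine card_le_two_pow_finrank_span _ (hx₀ ▸ Finset.mem_image_of_mem x hi₀) ?_
    simp only [Finset.forall_mem_image]
    exact hx_nonneg
  have hle₁ : U A ≤ U I := Submodule.span_mono <| by
    rintro v ⟨i, hi, j, hj, hij⟩
    exact ⟨i, (Finset.mem_filter.1 hi).1, j, (Finset.mem_filter.1 hj).1, hij⟩
  have hle₂ : Submodule.span ℝ (I.image x : Set E) ≤ U I := by
    refine Submodule.span_le.2 fun v hv => ?_
    obtain ⟨i, hi, rfl⟩ := Finset.mem_image.1 (Finset.mem_coe.1 hv)
    by_cases h : i₀ = i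
    · rw [← h, hx₀]
      exact zero_mem _
    · have := hx_eq i₀ hi₀ i hi h
      rw [hx₀, sub_zero] at this
      rw [this]
      exact Submodule.smul_mem _ _ (Submodule.subset_span ⟨i₀, hi₀, i, hi, h, rfl⟩)
  have hdisj : Disjoint (U A) (Submodule.span ℝ (I.image x : Set E)) := by
    refine Submodule.IsOrtho.disjoint (Submodule.isOrtho_span.2 ?_)
    rintro _ ⟨i, hi, j, hj, hij, rfl⟩ v hv
    obtain ⟨l, hl, rfl⟩ := Finset.mem_image.1 (Finset.mem_coe.1 hv)
    obtain ⟨hi, hxi⟩ := Finset.mem_filter.1 hi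
    obtain ⟨hj, hxj⟩ := Finset.mem_filter.1 hj
    have h1 := hortho i hi j hj l hl hij (hxi.trans hxj.symm)
    have h2 := hortho i hi j hj i₀ hi₀ hij (hxi.trans hxj.symm)
    rw [inner_sub_right] at h1 h2
    rw [hx₀, inner_zero_right] at h2
    linarith
  have hfinrank : Module.finrank ℝ (U A) +
      Module.finrank ℝ (Submodule.span ℝ (I.image x : Set E)) ≤ Module.finrank ℝ (U I) := by
    rw [← Submodule.finrank_sup_add_finrank_inf_eq, hdisj.eq_bot, finrank_bot, add_zero]
    exact Submodule.finrank_mono (sup_le hle₁ hle₂)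
  calc I.card ≤ 2 ^ Module.finrank ℝ (U A) * (I.image x).card :=
        Finset.card_le_mul_card_image I _ hfiber
    _ ≤ 2 ^ Module.finrank ℝ (U A) *
        2 ^ Module.finrank ℝ (Submodule.span ℝ (I.image x : Set E)) :=
        Nat.mul_le_mul_left _ himage
    _ ≤ 2 ^ Module.finrank ℝ (U I) := by
        rw [← pow_add]
        exact Nat.pow_le_pow_right two_pos hfinrank

theorem exists_embedding_dist_le {β : Type*} [PseudoMetricSpace β] {s : Set β}
    (hs : TotallyBounded s) {ε : ℝ} (hε : 0 < ε) (n : ℕ) :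
    ∃ N : ℕ, ∀ f : Fin N → β, (∀ x, f x ∈ s) →
      ∃ e : Fin n ↪ Fin N, ∀ a b, dist (f (e a)) (f (e b)) ≤ ε := by
  classical
  obtain ⟨t, ht, hst⟩ := Metric.totallyBounded_iff.1 hs (ε / 2) (half_pos hε)
  refine ⟨ht.toFinset.card * n + 1, fun f hf => ?_⟩
  have hcov : ∀ x, ∃ y ∈ t, dist (f x) y < ε / 2 := fun x => by
    simpa using hst (hf x)
  choose g hgt hg using hcov
  obtain ⟨y, -, hy⟩ := Finset.exists_lt_card_fiber_of_mul_lt_card_of_maps_to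
    (s := Finset.univ) (t := ht.toFinset) (f := g) (n := n)
    (fun x _ => ht.mem_toFinset.2 (hgt x)) (by simp)
  refine ⟨(Finset.orderEmbOfCardLe _ hy.le).toEmbedding, fun a b => ?_⟩
  have key : ∀ a, dist (f (Finset.orderEmbOfCardLe _ hy.le a)) y < ε / 2 := fun a => by
    have hgy := (Finset.mem_filter.1 (Finset.orderEmbOfCardLe_mem _ hy.le a)).2
    simpa only [hgy] using hg (Finset.orderEmbOfCardLe _ hy.le a)
  have := dist_triangle_right (f (Finset.orderEmbOfCardLe _ hy.le a))
    (f (Finset.orderEmbOfCardLe _ hy.le b)) y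
  have := key a
  have := key b
  simp only [RelEmbedding.coe_toEmbedding]
  linarith

/-- Among sufficiently many points there is a pair whose distance is not comparable to any of
`m` prescribed numbers. -/
theorem exists_pair_dist_incomparable [FiniteDimensional ℝ E] {ε : ℝ} (hε : 0 < ε) (m : ℕ) :
    ∃ N : ℕ, ∀ P : Fin N → E, Function.Injective P → ∀ S : Finset ℝ, S.card ≤ m →
      ∃ a b, a ≠ b ∧ ∀ s ∈ S, ‖P b - P a‖ ≤ ε * s ∨ s ≤ ε * ‖P b - P a‖ := by
  induction m with
  | zero =>
    refine ⟨2, fun P _ S hS => ⟨0, 1, by decide, ?_⟩⟩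
    simp [Finset.card_eq_zero.1 (Nat.le_zero.1 hS)]
  | succ m ih =>
    obtain ⟨N', hN'⟩ := ih
    obtain ⟨N₁, hN₁⟩ := exists_embedding_dist_le
      (isCompact_closedBall (0 : E) 1).totallyBounded (pow_pos hε 2) N'
    refine ⟨N₁ + 2, fun P hP S hS => ?_⟩
    obtain ⟨⟨a, b⟩, -, hab⟩ := Finset.exists_max_image Finset.univ
      (fun c : Fin (N₁ + 2) × Fin (N₁ + 2) => ‖P c.2 - P c.1‖) Finset.univ_nonempty
    have hmax : ∀ c d, ‖P d - P c‖ ≤ ‖P b - P a‖ := fun c d => hab (c, d) (Finset.mem_univ _)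
    have hpos : 0 < ‖P b - P a‖ := by
      refine lt_of_lt_of_le ?_ (hmax 0 1)
      exact norm_pos_iff.2 (sub_ne_zero.2 (hP.ne (by simp)))
    by_cases hgood : ∀ s ∈ S, ‖P b - P a‖ ≤ ε * s ∨ s ≤ ε * ‖P b - P a‖
    · refine ⟨a, b, ?_, hgood⟩
      rintro rfl
      simp at hpos
    push Not at hgood
    obtain ⟨s, hs, -, hs2⟩ := hgood
    obtain ⟨e, he⟩ := hN₁
      (fun x => ‖P b - P a‖⁻¹ • (P (Fin.castLE (Nat.le_add_right _ _) x) - P a)) (fun x => by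
        rw [mem_closedBall_zero_iff, norm_smul, norm_inv, norm_norm, inv_mul_le_one₀ hpos]
        exact hmax _ _)
    let g : Fin N' ↪ Fin (N₁ + 2) := e.trans (Fin.castLEEmb (Nat.le_add_right _ _))
    have hclose : ∀ c d, ‖P (g d) - P (g c)‖ ≤ ε ^ 2 * ‖P b - P a‖ := fun c d => by
      have := he d c
      rw [dist_eq_norm, ← smul_sub, sub_sub_sub_cancel_right, norm_smul, norm_inv, norm_norm,
        inv_mul_le_iff₀ hpos, mul_comm] at this
      exact this
    classical
    obtain ⟨c, d, hcd, h⟩ := hN' (P ∘ g) (hP.comp g.injective) (S.erase s) (by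
      rw [Finset.card_erase_of_mem hs]
      omega)
    refine ⟨g c, g d, g.injective.ne hcd, fun t ht => ?_⟩
    by_cases hts : t = s
    · left
      rw [hts]
      have := hclose c d
      nlinarith
    · exact h t (Finset.mem_erase.2 ⟨hts, ht⟩)

/-- A family of point sequences, indexed by `ι`, in which points of different sequences are
distinct and form double-normal pairs of the set of all the points. -/
structure IsDoubleNormalFamily {ι α : Type*} (P : ι → α → E) : Prop where
  injective : ∀ i, Function.Injective (P i)
  ne : ∀ i j, i ≠ j → ∀ a b, P i a ≠ P j b
  inner_nonneg : ∀ i j, i ≠ j → ∀ a b l c, 0 ≤ ⟪P l c - P i a, P j b - P i a⟫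

namespace IsDoubleNormalFamily

variable {ι α : Type*} {P : ι → α → E}

theorem comp {β : Type*} (hP : IsDoubleNormalFamily P) (e : ι → β ↪ α) :
    IsDoubleNormalFamily fun i b => P i (e i b) where
  injective i := (hP.injective i).comp (e i).injective
  ne i j hij _ _ := hP.ne i j hij _ _
  inner_nonneg i j hij _ _ _ _ := hP.inner_nonneg i j hij _ _ _ _

theorem inner_nonneg_of_same (hP : IsDoubleNormalFamily P) {i j : ι} (hij : i ≠ j) (a a' b : α) :
    0 ≤ ⟪P j b - P i a, P i a' - P i a⟫ := by
  rw [real_inner_comm]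
  exact hP.inner_nonneg i j hij _ _ _ _

theorem abs_inner_le_sq_of_ne (hP : IsDoubleNormalFamily P) {j l : ι} (hjl : j ≠ l)
    (b c : α) (i : ι) (a a' : α) :
    |⟪P i a' - P i a, P l c - P j b⟫| ≤ ‖P l c - P j b‖ ^ 2 :=
  abs_inner_sub_le_of_nonneg (hP.inner_nonneg j l hjl _ _ _ _)
    (hP.inner_nonneg l j hjl.symm _ _ _ _) (hP.inner_nonneg j l hjl _ _ _ _)
    (hP.inner_nonneg l j hjl.symm _ _ _ _)

theorem abs_inner_le_sq_of_same (hP : IsDoubleNormalFamily P) {i j l : ι} (hij : i ≠ j)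
    (hil : i ≠ l) (a a' b c : α) :
    |⟪P i a' - P i a, P l c - P j b⟫| ≤ ‖P i a' - P i a‖ ^ 2 := by
  rw [real_inner_comm]
  exact abs_inner_sub_le_of_nonneg (hP.inner_nonneg_of_same hil _ _ _)
    (hP.inner_nonneg_of_same hil _ _ _) (hP.inner_nonneg_of_same hij _ _ _)
    (hP.inner_nonneg_of_same hij _ _ _)

end IsDoubleNormalFamily

theorem norm_smul_inv_norm_smul (v : E) : ‖v‖ • (‖v‖⁻¹ • v) = v := by
  by_cases hv : v = 0
  · simp [hv]
  · rw [smul_smul, mul_inv_cancel₀ (norm_ne_zero_iff.2 hv), one_smul]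

theorem norm_sub_le_of_dist_normalize_le {v w : E} {δ : ℝ} (hδ : δ ≤ 1 / 2)
    (h : ‖‖w‖⁻¹ • w - ‖v‖⁻¹ • v‖ ≤ δ) (hv : 0 ≤ ⟪v - w, v⟫) (hw : 0 ≤ ⟪w - v, w⟫) :
    ‖w - v‖ ≤ 4 * δ * ‖v‖ := by
  have hδ0 : 0 ≤ δ := (norm_nonneg _).trans h
  have h1 : 0 ≤ ⟪w - v, ‖w‖⁻¹ • w⟫ := by
    rw [real_inner_smul_right]
    positivity
  have h2 : ⟪w - v, ‖v‖⁻¹ • v⟫ ≤ 0 := by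
    rw [← neg_sub v w, inner_neg_left, real_inner_smul_right, neg_nonpos]
    positivity
  have h3 : ⟪w - v, ‖w‖⁻¹ • w⟫ - ⟪w - v, ‖v‖⁻¹ • v⟫ ≤ δ * ‖w - v‖ := by
    rw [← inner_sub_right, mul_comm]
    exact (real_inner_le_norm _ _).trans (mul_le_mul_of_nonneg_left h (norm_nonneg _))
  have h4 : ‖w - v‖ ^ 2 =
      ‖w‖ * ⟪w - v, ‖w‖⁻¹ • w⟫ - ‖v‖ * ⟪w - v, ‖v‖⁻¹ • v⟫ := by
    rw [← real_inner_smul_right, ← real_inner_smul_right, norm_smul_inv_norm_smul,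
      norm_smul_inv_norm_smul, ← inner_sub_right, real_inner_self_eq_norm_sq]
  have h5 : ‖w - v‖ * ‖w - v‖ ≤ δ * (‖w‖ + ‖v‖) * ‖w - v‖ := by
    have := norm_nonneg w
    have := norm_nonneg v
    nlinarith
  rcases (norm_nonneg (w - v)).eq_or_lt with h0 | h0
  · rw [← h0]
    positivity
  · have h6 := le_of_mul_le_mul_right h5 h0
    have h7 : ‖w‖ ≤ ‖w - v‖ + ‖v‖ := by simpa using norm_add_le (w - v) v
    nlinarith [norm_nonneg v]

/-- Large double-normal families contain subfamilies of prescribed size all of whose parts have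
small diameter compared to their distances from the other parts. -/
theorem exists_clustered_subfamily [FiniteDimensional ℝ E] {ι : Type*} [Fintype ι] {δ : ℝ}
    (hδ : 0 < δ) (hδ' : δ ≤ 1 / 2) (S : Finset ι) (n : ℕ) :
    ∃ N : ℕ, ∀ P : ι → Fin N → E, IsDoubleNormalFamily P → ∃ e : ι → Fin n ↪ Fin N,
      ∀ i ∈ S, ∀ j, i ≠ j → ∀ a a' b,
        ‖P i (e i a') - P i (e i a)‖ ≤ 4 * δ * ‖P i (e i a) - P j (e j b)‖ := by
  classical
  induction S using Finset.induction_on generalizing n with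
  | empty => exact ⟨n, fun P _ => ⟨fun _ => Function.Embedding.refl _, by simp⟩⟩
  | insert i S _ ih =>
    obtain ⟨N₁, hN₁⟩ := exists_embedding_dist_le
      (isCompact_closedBall (0 : ι × Fin n → E) 1).totallyBounded hδ n
    obtain ⟨N, hN⟩ := ih (N₁ + n)
    refine ⟨N, fun P hP => ?_⟩
    obtain ⟨e₀, he₀⟩ := hN P hP
    let t : Fin n ↪ Fin (N₁ + n) := Fin.castLEEmb (Nat.le_add_left _ _)
    let t₁ : Fin N₁ ↪ Fin (N₁ + n) := Fin.castLEEmb (Nat.le_add_right _ _)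
    let v : Fin N₁ → ι × Fin n → E := fun x c => P i (e₀ i (t₁ x)) - P c.1 (e₀ c.1 (t c.2))
    obtain ⟨g, hg⟩ := hN₁ (fun x c => ‖v x c‖⁻¹ • v x c) (fun x => by
      rw [mem_closedBall_zero_iff, pi_norm_le_iff_of_nonneg zero_le_one]
      intro c
      rw [norm_smul, norm_inv, norm_norm]
      exact inv_mul_le_one)
    let s : ι → Fin n ↪ Fin (N₁ + n) := Function.update (fun _ => t) i (g.trans t₁)
    refine ⟨fun j => (s j).trans (e₀ j), fun i' hi' j hij a a' b => ?_⟩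
    simp only [Function.Embedding.trans_apply]
    by_cases hi : i' = i
    · subst hi
      have hsi : ∀ a, s i' a = t₁ (g a) := fun a => by simp [s]
      have hsj : s j b = t b := by simp [s, hij.symm]
      rw [hsi, hsi, hsj]
      have h1 := (dist_pi_le_iff hδ.le).1 (hg a' a) (j, b)
      rw [dist_eq_norm] at h1
      have hsub : ∀ c d, v c (j, b) - v d (j, b) = P i' (e₀ i' (t₁ c)) - P i' (e₀ i' (t₁ d)) :=
        fun c d => sub_sub_sub_cancel_right _ _ _
      have hnn : ∀ c d, 0 ≤ ⟪v c (j, b) - v d (j, b), v c (j, b)⟫ := fun c d => by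
        have := hP.inner_nonneg i' j hij (e₀ i' (t₁ c)) (e₀ j (t b)) i' (e₀ i' (t₁ d))
        rwa [hsub, ← inner_neg_neg, neg_sub, neg_sub]
      have h2 := norm_sub_le_of_dist_normalize_le hδ' h1 (hnn _ _) (hnn _ _)
      rwa [hsub] at h2
    · exact he₀ i' ((Finset.mem_insert.1 hi').resolve_left hi) j hij _ _ _

theorem abs_inner_le_of_norm_incomparable {v w : E} {ε : ℝ}
    (hv : |⟪v, w⟫| ≤ ‖v‖ ^ 2) (hw : |⟪v, w⟫| ≤ ‖w‖ ^ 2)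
    (h : ‖v‖ ≤ ε * ‖w‖ ∨ ‖w‖ ≤ ε * ‖v‖) : |⟪v, w⟫| ≤ ε * (‖v‖ * ‖w‖) := by
  have := norm_nonneg v
  have := norm_nonneg w
  rcases h with h | h <;> nlinarith

theorem exists_pairs_dist_incomparable [FiniteDimensional ℝ E] (ι : Type*) [Fintype ι]
    {ε : ℝ} (hε : 0 < ε) (m : ℕ) :
    ∃ N : ℕ, ∀ P : ι → Fin N → E, (∀ i, Function.Injective (P i)) → ∀ S : Finset ℝ,
      S.card ≤ m → ∃ a b : ι → Fin N, (∀ i, a i ≠ b i) ∧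
        (∀ i, ∀ s ∈ S, ‖P i (b i) - P i (a i)‖ ≤ ε * s ∨ s ≤ ε * ‖P i (b i) - P i (a i)‖) ∧
        (∀ i j, i ≠ j → ‖P i (b i) - P i (a i)‖ ≤ ε * ‖P j (b j) - P j (a j)‖ ∨
          ‖P j (b j) - P j (a j)‖ ≤ ε * ‖P i (b i) - P i (a i)‖) := by
  classical
  obtain ⟨N, hN⟩ := exists_pair_dist_incomparable (E := E) hε (m + Fintype.card ι)
  refine ⟨N, fun P hP S hS => ?_⟩
  have key : ∀ T : Finset ι, ∃ a b : ι → Fin N, ∀ i ∈ T, a i ≠ b i ∧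
      (∀ s ∈ S, ‖P i (b i) - P i (a i)‖ ≤ ε * s ∨ s ≤ ε * ‖P i (b i) - P i (a i)‖) ∧
      (∀ j ∈ T, i ≠ j → ‖P i (b i) - P i (a i)‖ ≤ ε * ‖P j (b j) - P j (a j)‖ ∨
        ‖P j (b j) - P j (a j)‖ ≤ ε * ‖P i (b i) - P i (a i)‖) := by
    intro T
    induction T using Finset.induction_on with
    | empty =>
      have hchoose : ∀ i, ∃ _ : Fin N, True := fun i => by
        obtain ⟨a, -⟩ := hN (P i) (hP i) ∅ (by simp)
        exact ⟨a, trivial⟩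
      choose a _ using hchoose
      exact ⟨a, a, by simp⟩
    | insert i T hi ih =>
      obtain ⟨a, b, hab⟩ := ih
      obtain ⟨c, d, hcd, h⟩ := hN (P i) (hP i)
        (S ∪ Finset.univ.image fun j => ‖P j (b j) - P j (a j)‖)
        ((Finset.card_union_le _ _).trans
          (add_le_add hS (Finset.card_image_le.trans Finset.card_univ.le)))
      have hd : ∀ j, ‖P i d - P i c‖ ≤ ε * ‖P j (b j) - P j (a j)‖ ∨
          ‖P j (b j) - P j (a j)‖ ≤ ε * ‖P i d - P i c‖ := fun j =>
        h _ (Finset.mem_union_right _ (Finset.mem_image_of_mem _ (Finset.mem_univ j)))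
      have hne : ∀ j ∈ T, j ≠ i := fun j hj hji => hi (hji ▸ hj)
      refine ⟨Function.update a i c, Function.update b i d, fun j hj => ?_⟩
      rcases Finset.mem_insert.1 hj with rfl | hj
      · simp only [Function.update_self]
        refine ⟨hcd, fun s hs => h s (Finset.mem_union_left _ hs), fun l hl hjl => ?_⟩
        rw [Function.update_of_ne hjl.symm, Function.update_of_ne hjl.symm]
        exact hd l
      · rw [Function.update_of_ne (hne j hj), Function.update_of_ne (hne j hj)]
        refine ⟨(hab j hj).1, (hab j hj).2.1, fun l hl hjl => ?_⟩
        rcases Finset.mem_insert.1 hl with rfl | hl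
        · simp only [Function.update_self]
          exact (hd j).symm
        · rw [Function.update_of_ne (hne l hl), Function.update_of_ne (hne l hl)]
          exact (hab j hj).2.2 l hl hjl
  obtain ⟨a, b, hab⟩ := key Finset.univ
  exact ⟨a, b, fun i => (hab i (Finset.mem_univ i)).1, fun i => (hab i (Finset.mem_univ i)).2.1,
    fun i j hij => (hab i (Finset.mem_univ i)).2.2 j (Finset.mem_univ j) hij⟩

theorem exists_nearly_orthogonal_configuration [FiniteDimensional ℝ E] {ι : Type*} [Fintype ι]
    (h : ∀ r : ℕ, ∃ P : ι → Fin r → E, IsDoubleNormalFamily P) {ε : ℝ} (hε : 0 < ε)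
    (hε' : ε ≤ 1) :
    ∃ q a b : ι → E, (∀ i, a i ≠ b i) ∧ (∀ i j, i ≠ j → q i ≠ q j) ∧
      (∀ i j l, 0 ≤ ⟪q l - q i, q j - q i⟫) ∧
      (∀ i j, i ≠ j → |⟪b i - a i, b j - a j⟫| ≤
        3 * ε * (‖b i - a i‖ * ‖b j - a j‖)) ∧
      (∀ i j l, j ≠ l → |⟪b i - a i, q l - q j⟫| ≤
        3 * ε * (‖b i - a i‖ * ‖q l - q j‖)) := by
  classical
  obtain ⟨n, hn⟩ := exists_pairs_dist_incomparable (E := E) ι hε (Fintype.card (ι × ι))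
  obtain ⟨N, hN⟩ := exists_clustered_subfamily (E := E) (ι := ι) (δ := ε / 8) (by positivity)
    (by linarith) Finset.univ (n + 1)
  obtain ⟨P, hP⟩ := h N
  obtain ⟨e, he⟩ := hN P hP
  let W : ι → Fin (n + 1) → E := fun i x => P i (e i x)
  have hW : IsDoubleNormalFamily W := hP.comp e
  let q : ι → E := fun i => W i (Fin.last n)
  have hclose : ∀ i j, i ≠ j → ∀ x y, ‖W i y - W i x‖ ≤ ε * ‖q j - q i‖ := by
    intro i j hij x y
    have h1 := he i (Finset.mem_univ i) j hij (Fin.last n) y (Fin.last n)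
    have h2 := he i (Finset.mem_univ i) j hij (Fin.last n) x (Fin.last n)
    rw [norm_sub_rev (P i (e i (Fin.last n))) (P j _)] at h1 h2
    have h3 := norm_sub_le_norm_sub_add_norm_sub (W i y) (q i) (W i x)
    rw [norm_sub_rev (q i)] at h3
    simp only [W, q] at h3 ⊢
    linarith
  obtain ⟨a, b, hab, hS, hpair⟩ := hn (fun i x => W i x.castSucc)
    (fun i => (hW.injective i).comp (Fin.castSucc_injective n))
    (Finset.univ.image fun c : ι × ι => ‖q c.2 - q c.1‖)
    (Finset.card_image_le.trans Finset.card_univ.le)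
  have hweaken : ∀ {v w : E}, |⟪v, w⟫| ≤ ε * (‖v‖ * ‖w‖) → |⟪v, w⟫| ≤ 3 * ε * (‖v‖ * ‖w‖) :=
    fun {v w} hvw => hvw.trans (mul_le_mul_of_nonneg_right (by linarith) (by positivity))
  have hfar : ∀ i l, i ≠ l → |⟪W i (b i).castSucc - W i (a i).castSucc, q l - q i⟫| ≤
      3 * ε * (‖W i (b i).castSucc - W i (a i).castSucc‖ * ‖q l - q i‖) := by
    intro i l hil
    set v := W i (b i).castSucc - W i (a i).castSucc with hv
    have h1 : |⟪v, q l - W i (a i).castSucc⟫| ≤ ‖v‖ ^ 2 := by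
      rw [abs_of_nonneg (hW.inner_nonneg i l hil _ _ _ _), real_inner_comm]
      exact inner_sub_le_of_nonneg (hW.inner_nonneg_of_same hil _ _ _)
    have h2 := abs_real_inner_le_norm v (W i (a i).castSucc - q i)
    have h3 : ⟪v, q l - q i⟫ =
        ⟪v, q l - W i (a i).castSucc⟫ + ⟪v, W i (a i).castSucc - q i⟫ := by
      rw [← inner_add_right, sub_add_sub_cancel]
    have h4 : ‖v‖ ≤ ε * ‖q l - q i‖ := hclose i l hil _ _
    have h5 : ‖W i (a i).castSucc - q i‖ ≤ ε * ‖q l - q i‖ := hclose i l hil _ _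
    have h6 := abs_add_le ⟪v, q l - W i (a i).castSucc⟫ ⟪v, W i (a i).castSucc - q i⟫
    rw [← h3] at h6
    have h7 := mul_le_mul_of_nonneg_left h4 (norm_nonneg v)
    have h8 := mul_le_mul_of_nonneg_left h5 (norm_nonneg v)
    have h9 : 0 ≤ ε * (‖v‖ * ‖q l - q i‖) := by positivity
    nlinarith
  refine ⟨q, fun i => W i (a i).castSucc, fun i => W i (b i).castSucc,
    fun i => (hW.injective i).ne ((Fin.castSucc_injective n).ne (hab i)),
    fun i j hij => hW.ne i j hij _ _, fun i j l => ?_, fun i j hij => ?_, fun i j l hjl => ?_⟩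
  · by_cases hij : i = j
    · simp [hij]
    · exact hW.inner_nonneg i j hij _ _ _ _
  · refine hweaken (abs_inner_le_of_norm_incomparable
      (hW.abs_inner_le_sq_of_same hij hij _ _ _ _) ?_ (hpair i j hij))
    rw [real_inner_comm]
    exact hW.abs_inner_le_sq_of_same hij.symm hij.symm _ _ _ _
  · by_cases hij : i = j
    · exact hij ▸ hfar i l (hij ▸ hjl)
    by_cases hil : i = l
    · subst hil
      rw [← neg_sub (q j) (q i), inner_neg_right, abs_neg, norm_neg]
      exact hfar i j hij
    exact hweaken (abs_inner_le_of_norm_incomparable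
      (hW.abs_inner_le_sq_of_same hij hil _ _ _ _) (hW.abs_inner_le_sq_of_ne hjl _ _ _ _ _)
      (hS i _ (Finset.mem_image_of_mem _ (Finset.mem_univ (j, l)))))

end

open Filter Topology in
theorem exists_limit_of_norm_eq_one {E : Type*} [NormedAddCommGroup E] [NormedSpace ℝ E]
    [FiniteDimensional ℝ E] {κ : Type*} (F : Ultrafilter κ) {f : κ → E} (hf : ∀ n, ‖f n‖ = 1) :
    ∃ x, ‖x‖ = 1 ∧ Tendsto f F (𝓝 x) := by
  have : ProperSpace E := FiniteDimensional.proper ℝ E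
  obtain ⟨x, hx, hlim⟩ := (isCompact_sphere (0 : E) 1).ultrafilter_le_nhds (F.map f) (by
    rw [Ultrafilter.coe_map, le_principal_iff]
    exact Filter.mem_map.2 (Filter.univ_mem' fun n => by simpa using hf n))
  exact ⟨x, by simpa using hx, hlim⟩

open Filter Topology in
theorem inner_eq_zero_of_tendsto_normalize {E : Type*} [NormedAddCommGroup E]
    [InnerProductSpace ℝ E] {κ : Type*} {F : Filter κ} [F.NeBot] {v w : κ → E} {x y : E}
    {c : κ → ℝ} (hx : Tendsto (fun n => ‖v n‖⁻¹ • v n) F (𝓝 x))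
    (hy : Tendsto (fun n => ‖w n‖⁻¹ • w n) F (𝓝 y)) (hc : Tendsto c F (𝓝 0))
    (h : ∀ n, |⟪v n, w n⟫| ≤ c n * (‖v n‖ * ‖w n‖)) (hv : ∀ n, v n ≠ 0) (hw : ∀ n, w n ≠ 0) :
    ⟪x, y⟫ = 0 := by
  refine tendsto_nhds_unique (hx.inner hy) (squeeze_zero_norm (fun n => ?_) hc)
  have hv' := norm_pos_iff.2 (hv n)
  have hw' := norm_pos_iff.2 (hw n)
  rw [real_inner_smul_left, real_inner_smul_right, ← mul_assoc, ← mul_inv, norm_mul, norm_inv,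
    Real.norm_of_nonneg (mul_pos hv' hw').le, inv_mul_le_iff₀ (mul_pos hv' hw'), mul_comm]
  exact h n

theorem ContainsDNMultipartite.exists_isDoubleNormalFamily {d k r : ℕ}
    (h : ContainsDNMultipartite d k r) :
    ∃ P : Fin k → Fin r → Euc d, IsDoubleNormalFamily P := by
  obtain ⟨V, P, hPV, hcard, -, hP⟩ := h
  let f : ∀ i, Fin r ≃ P i := fun i => ((P i).equivFinOfCardEq (hcard i)).symm
  refine ⟨fun i x => f i x, fun i => Subtype.val_injective.comp (f i).injective,
    fun i j hij a b => (hP i j hij _ (f i a).2 _ (f j b).2).1, fun i j hij a b l c => ?_⟩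
  exact ((hP i j hij _ (f i a).2 _ (f j b).2).2.2.2 _ (hPV l (f l c).2)).1

open Filter Topology in
theorem stmt6 (d k : ℕ) (hk : 2 ≤ k)
    (h : ∀ r : ℕ, ContainsDNMultipartite d k r) :
    ∃ u : Fin k → Fin k → Euc d,
      (∀ i j, ‖u i j‖ = 1) ∧
      (∀ i j, i ≠ j → ⟪u i i, u j j⟫ = 0) ∧
      (∀ i j l, j ≠ l → ⟪u i i, u j l⟫ = 0) ∧
      k ≤ 2 ^ (Module.finrank ℝ
        (Submodule.span ℝ {v : Euc d | ∃ j l : Fin k, j ≠ l ∧ v = u j l})) := by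
  have hfam := fun r => (h r).exists_isDoubleNormalFamily
  choose q a b hab hq hnonneg hpair hcross using fun n : ℕ =>
    exists_nearly_orthogonal_configuration hfam (ε := 1 / ((n : ℝ) + 1)) Nat.one_div_pos_of_nat
      ((div_le_one (by positivity)).2 (by linarith [n.cast_nonneg (α := ℝ)]))
  let F : Ultrafilter ℕ := hyperfilter ℕ
  have hc : Tendsto (fun n : ℕ => 3 * (1 / ((n : ℝ) + 1))) F (𝓝 0) := by
    simpa using (tendsto_one_div_add_atTop_nhds_zero_nat.const_mul (3 : ℝ)).mono_left
      Nat.hyperfilter_le_atTop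
  let v : ℕ → Fin k → Fin k → Euc d := fun n i j =>
    if i = j then b n i - a n i else q n j - q n i
  have hv_self : ∀ n i, v n i i = b n i - a n i := fun n i => if_pos rfl
  have hv_ne : ∀ n i j, i ≠ j → v n i j = q n j - q n i := fun n i j hij => if_neg hij
  have hv : ∀ n i j, v n i j ≠ 0 := fun n i j => by
    by_cases hij : i = j
    · rw [← hij, hv_self]
      exact sub_ne_zero.2 (hab n i).symm
    · rw [hv_ne n i j hij]
      exact sub_ne_zero.2 (hq n i j hij).symm
  choose u hu hlim using fun i j => exists_limit_of_norm_eq_one F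
    (f := fun n => ‖v n i j‖⁻¹ • v n i j) fun n => norm_smul_inv_norm (𝕜 := ℝ) (hv n i j)
  refine ⟨u, hu, fun i j hij => ?_, fun i j l hjl => ?_, ?_⟩
  · refine inner_eq_zero_of_tendsto_normalize (hlim i i) (hlim j j) hc (fun n => ?_)
      (fun n => hv n i i) (fun n => hv n j j)
    rw [hv_self, hv_self]
    exact hpair n i j hij
  · refine inner_eq_zero_of_tendsto_normalize (hlim i i) (hlim j l) hc (fun n => ?_)
      (fun n => hv n i i) (fun n => hv n j l)
    rw [hv_self, hv_ne n j l hjl]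
    exact hcross n i j l hjl
  · have hset : {w : Euc d | ∃ j l : Fin k, j ≠ l ∧ w = u j l} =
        {w | ∃ j ∈ Finset.univ, ∃ l ∈ Finset.univ, j ≠ l ∧ w = u j l} := by simp
    rw [hset]
    exact (Finset.card_fin k).ge.trans (card_le_two_pow_finrank_of_tendsto F q u hq hnonneg
      (fun i j hij => by simpa only [hv_ne _ i j hij] using hlim i j) Finset.univ)
end
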